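/- Let Ω be a bounded Lipschitz domain in ℝ^N (N ≥ 2), a > 0 and V ∈ 𝒱(Ω,a). Let u be a positive L_V-harmonic function in Ω with Martin representation u = ∫_{∂Ω} K_y^V dμ(y), and let s be a nonnegative L_V-superharmonic function in Ω satisfying the strong Harnack property (HP)_Ω. Then for μ-almost all y ∈ ∂Ω the ratio s/u admits a nontangential limit f(y) at y, and f(y) = (dν/dμ)(y) for μ-almost every y, where ν is the measure on ∂Ω associated to the greatest L_V-harmonic minorant of s. -/

import Mathlib

open MeasureTheory Metric Set Filter Topology
open scoped ENNReal NNReal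

noncomputable section

namespace Anc

abbrev ES (N : ℕ) := EuclideanSpace ℝ (Fin N)

/-- `δ_Ω(x)`: the distance from `x` to the complement of `Ω`. -/
def dista {N : ℕ} (Ω : Set (ES N)) (x : ES N) : ℝ := infDist x Ωᶜ

/-- Pointwise Laplacian (junk values where the derivatives do not exist). -/
def lap {N : ℕ} (u : ES N → ℝ) (x : ES N) : ℝ :=
  ∑ i : Fin N,
    fderiv ℝ (fun y => fderiv ℝ u y (EuclideanSpace.single i 1)) x (EuclideanSpace.single i 1)

/-- Smooth compactly supported test functions in `Ω`. -/
def IsTestFun {N : ℕ} (Ω : Set (ES N)) (φ : ES N → ℝ) : Prop :=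
  ContDiff ℝ (⊤ : ℕ∞) φ ∧ IsCompact (tsupport φ) ∧ tsupport φ ⊆ Ω

/-- `u` is a continuous weak solution of `Δu - V·u = 0` in `Ω` (i.e. `L_V`-harmonic). -/
def LVHarmonic {N : ℕ} (Ω : Set (ES N)) (V u : ES N → ℝ) : Prop :=
  ContinuousOn u Ω ∧ LocallyIntegrableOn u Ω ∧
    LocallyIntegrableOn (fun x => V x * u x) Ω ∧
    ∀ φ, IsTestFun Ω φ → ∫ x in Ω, u x * lap φ x = ∫ x in Ω, V x * u x * φ x

/-- `s` is `L_V`-superharmonic in `Ω` (weakly, `Δs - V·s ≤ 0`, `s` l.s.c.). -/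
def LVSuperharmonic {N : ℕ} (Ω : Set (ES N)) (V s : ES N → ℝ) : Prop :=
  LowerSemicontinuousOn s Ω ∧ LocallyIntegrableOn s Ω ∧
    LocallyIntegrableOn (fun x => V x * s x) Ω ∧
    ∀ φ, IsTestFun Ω φ → (∀ x, 0 ≤ φ x) →
      ∫ x in Ω, s x * lap φ x ≤ ∫ x in Ω, V x * s x * φ x

/-- The class `𝒱(Ω,a)` of nonnegative Borel potentials with `V(x) ≤ a/δ_Ω(x)²`. -/
def VClass {N : ℕ} (Ω : Set (ES N)) (a : ℝ) (V : ES N → ℝ) : Prop :=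
  Measurable V ∧ ∀ x ∈ Ω, 0 ≤ V x ∧ V x * dista Ω x ^ 2 ≤ a

/-- Lipschitz domain: open, connected, and near every boundary point, after an
orthogonal change of coordinates, the domain is the region above the graph of a
Lipschitz function. -/
def IsLipschitzDomain {N : ℕ} (Ω : Set (ES N)) : Prop :=
  IsOpen Ω ∧ IsConnected Ω ∧
    ∀ z ∈ frontier Ω, ∃ (g : ES N ≃ₗᵢ[ℝ] ES N) (i : Fin N) (f : ES N → ℝ)
      (L : ℝ≥0) (ε : ℝ), 0 < ε ∧ LipschitzWith L f ∧
      (∀ x w : ES N, (∀ j, j ≠ i → x j = w j) → f x = f w) ∧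
      ∀ x ∈ ball z ε, (x ∈ Ω ↔ f (g x) < g x i)

/-- `Ω` has a `C^{1,α}` boundary near `y`. -/
def IsC1AlphaNear {N : ℕ} (Ω : Set (ES N)) (α : ℝ) (y : ES N) : Prop :=
  ∃ (g : ES N ≃ₗᵢ[ℝ] ES N) (i : Fin N) (f : ES N → ℝ) (C : ℝ≥0) (ε : ℝ),
    0 < ε ∧ ContDiff ℝ 1 f ∧ HolderWith C α.toNNReal (fderiv ℝ f) ∧
    (∀ x w : ES N, (∀ j, j ≠ i → x j = w j) → f x = f w) ∧
    ∀ x ∈ ball y ε, (x ∈ Ω ↔ f (g x) < g x i)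

/-- `K` is the `L_V`-Martin kernel of `Ω` with pole `y ∈ ∂Ω`, normalized at `x₀`:
the unique positive `L_V`-harmonic function vanishing on `∂Ω ∖ {y}` with `K x₀ = 1`. -/
def IsMartinKernel {N : ℕ} (Ω : Set (ES N)) (V : ES N → ℝ) (x₀ y : ES N)
    (K : ES N → ℝ) : Prop :=
  LVHarmonic Ω V K ∧ (∀ x ∈ Ω, 0 < K x) ∧ K x₀ = 1 ∧
    ∀ z ∈ frontier Ω, z ≠ y → Tendsto K (𝓝[Ω] z) (𝓝 0)

/-- `G` is the `L_V`-Green function of `Ω` with pole `y ∈ Ω`: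
positive, vanishing at the boundary, and `L_V G = -δ_y` weakly. -/
def IsGreenFunction {N : ℕ} (Ω : Set (ES N)) (V : ES N → ℝ) (y : ES N)
    (G : ES N → ℝ) : Prop :=
  ContinuousOn G (Ω \ {y}) ∧ (∀ x ∈ Ω \ {y}, 0 < G x) ∧ LocallyIntegrableOn G Ω ∧
    (∀ z ∈ frontier Ω, Tendsto G (𝓝[Ω \ {y}] z) (𝓝 0)) ∧
    ∀ φ, IsTestFun Ω φ → ∫ x in Ω, G x * (lap φ x - V x * φ x) = -φ y

/-- `y ∈ ∂Ω` is finely regular w.r.t. `V`, `Ky` being the classical Martin kernel at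
`y`: the greatest `L_V`-harmonic minorant of `Ky` is positive, equivalently `Ky`
admits a positive `L_V`-harmonic minorant. -/
def FinelyRegular {N : ℕ} (Ω : Set (ES N)) (V Ky : ES N → ℝ) : Prop :=
  ∃ h, LVHarmonic Ω V h ∧ (∀ x ∈ Ω, 0 < h x) ∧ ∀ x ∈ Ω, h x ≤ Ky x

/-- `h` is the greatest nonnegative `L_V`-harmonic minorant of `w` in `Ω`. -/
def IsGreatestLVHarmMinorant {N : ℕ} (Ω : Set (ES N)) (V w h : ES N → ℝ) : Prop :=
  LVHarmonic Ω V h ∧ (∀ x ∈ Ω, 0 ≤ h x ∧ h x ≤ w x) ∧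
    ∀ g, LVHarmonic Ω V g → (∀ x ∈ Ω, 0 ≤ g x ∧ g x ≤ w x) → ∀ x ∈ Ω, g x ≤ h x

/-- Classical superharmonicity via the sub-mean value property. -/
def IsSuperharmonicOn {N : ℕ} (W : Set (ES N)) (s : ES N → ℝ) : Prop :=
  LowerSemicontinuousOn s W ∧ LocallyIntegrableOn s W ∧
    ∀ x ∈ W, ∀ t > (0:ℝ), closedBall x t ⊆ W → ⨍ z in ball x t, s z ≤ s x

/-- The réduite of `w` over `A` in `W`: infimum of the nonnegative superharmonic
functions in `W` dominating `w` on `A`. -/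
def reduite {N : ℕ} (W : Set (ES N)) (w : ES N → ℝ) (A : Set (ES N)) (x : ES N) : ℝ :=
  sInf {v | ∃ s : ES N → ℝ, IsSuperharmonicOn W s ∧ (∀ z ∈ W, 0 ≤ s z) ∧
    (∀ z ∈ A, w z ≤ s z) ∧ v = s x}

/-- The lower semicontinuous regularization `R̂` of the réduite. -/
def reduiteReg {N : ℕ} (W : Set (ES N)) (w : ES N → ℝ) (A : Set (ES N)) (x : ES N) : ℝ :=
  liminf (reduite W w A) (𝓝[W] x)

/-- Nontangential approach region at `y` with aperture `κ`. -/
def ntRegion {N : ℕ} (Ω : Set (ES N)) (y : ES N) (κ : ℝ) : Set (ES N) :=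
  {x | x ∈ Ω ∧ dist x y ≤ κ * dista Ω x}

/-- `g` tends to `l` nontangentially at `y`. -/
def TendstoNT {N : ℕ} (Ω : Set (ES N)) (g : ES N → ℝ) (y : ES N) (l : Filter ℝ) : Prop :=
  ∀ κ > (0:ℝ), Tendsto g (𝓝[ntRegion Ω y κ] y) l

/-- Truncated cone `{y + t(ν+v) : 0 < t ≤ η, ‖v‖ ≤ η}` with vertex `y`. -/
def truncCone {N : ℕ} (y ν : ES N) (η : ℝ) : Set (ES N) :=
  {x | ∃ (t : ℝ) (v : ES N), 0 < t ∧ t ≤ η ∧ ‖v‖ ≤ η ∧ x = y + t • (ν + v)}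

/-- Last coordinate of a point of `ℝ^{n+1}`. -/
def lastC {n : ℕ} (x : ES (n + 1)) : ℝ := x (Fin.last n)

/-- First `n` coordinates of a point of `ℝ^{n+1}`. -/
def firstC {n : ℕ} (x : ES (n + 1)) : ES n :=
  (EuclideanSpace.equiv (Fin n) ℝ).symm fun i => x i.castSucc

/-- The region `U_f(r,ρ) = {(x',x_N) : |x'| < r, f(x') < x_N < ρ}`. -/
def Ucyl {n : ℕ} (f : ES n → ℝ) (r ρ : ℝ) : Set (ES (n + 1)) :=
  {x | ‖firstC x‖ < r ∧ f (firstC x) < lastC x ∧ lastC x < ρ}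

/-- The cylinder `T(t) = B_{N-1}(0,tr) × (-tρ, tρ)`. -/
def Tcyl (n : ℕ) (r ρ t : ℝ) : Set (ES (n + 1)) :=
  {x | ‖firstC x‖ < t * r ∧ |lastC x| < t * ρ}

/-- The graph part `∂_#U` of the boundary of `U_f(r,ρ)`. -/
def graphBdry {n : ℕ} (f : ES n → ℝ) (r ρ : ℝ) : Set (ES (n + 1)) :=
  frontier (Ucyl f r ρ) ∩ {x | ‖firstC x‖ < r ∧ lastC x = f (firstC x)}

section
lemma hasFDerivAt_normsq {N : ℕ} (x y : ES N) :
    HasFDerivAt (fun y : ES N => ‖y - x‖ ^ 2) (2 • (innerSL ℝ (y - x))) y := by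
  have h := (HasStrictFDerivAt.hasFDerivAt (hasStrictFDerivAt_norm_sq (y - x))).comp y
    ((hasFDerivAt_id y).sub_const x)
  simp only [ContinuousLinearMap.comp_id] at h
  exact h

lemma fderiv_radial {N : ℕ} (H H1 : ℝ → ℝ) (h1 : ∀ s, HasDerivAt H (H1 s) s)
    (x y : ES N) (i : Fin N) :
    HasFDerivAt (fun y : ES N => H (‖y - x‖ ^ 2)) (H1 (‖y - x‖ ^ 2) • (2 • (innerSL ℝ (y - x)))) y := by
  exact (h1 _).comp_hasFDerivAt y (hasFDerivAt_normsq x y)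

lemma lap_radial {N : ℕ} (H H1 H2 : ℝ → ℝ) (h1 : ∀ s, HasDerivAt H (H1 s) s)
    (h2 : ∀ s, HasDerivAt H1 (H2 s) s) (x y : ES N) :
    lap (fun y : ES N => H (‖y - x‖ ^ 2)) y
      = 4 * ‖y - x‖ ^ 2 * H2 (‖y - x‖ ^ 2) + 2 * N * H1 (‖y - x‖ ^ 2) := by
  unfold lap
  have e1 : ∀ i : Fin N, (fun y : ES N => fderiv ℝ (fun y : ES N => H (‖y - x‖ ^ 2)) y (EuclideanSpace.single i 1))
      = fun y => H1 (‖y - x‖ ^ 2) * (2 * (y i - x i)) := by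
    intro i; funext z
    rw [(fderiv_radial H H1 h1 x z i).fderiv]
    simp [EuclideanSpace.inner_single_right]
  have e2 : ∀ i : Fin N, fderiv ℝ (fun y : ES N => fderiv ℝ (fun y : ES N => H (‖y - x‖ ^ 2)) y (EuclideanSpace.single i 1)) y (EuclideanSpace.single i 1)
      = 4 * (y i - x i) ^ 2 * H2 (‖y - x‖ ^ 2) + 2 * H1 (‖y - x‖ ^ 2) := by
    intro i
    rw [e1]
    have hp : HasFDerivAt (fun y : ES N => y i) (EuclideanSpace.proj i : ES N →L[ℝ] ℝ) y :=
      (EuclideanSpace.proj i : ES N →L[ℝ] ℝ).hasFDerivAt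
    have := (fderiv_radial H1 H2 h2 x y i).mul ((hp.sub_const (x i)).const_mul 2)
    have e3 := this.fderiv
    rw [show (fun y : ES N => H1 (‖y - x‖ ^ 2) * (2 * (y i - x i))) = ((fun y : ES N => H1 (‖y - x‖ ^ 2)) * fun y => 2 * (y i - x i)) from rfl, e3]
    simp [EuclideanSpace.inner_single_right]
    ring
  rw [Finset.sum_congr rfl (fun i _ => e2 i), Finset.sum_add_distrib, ← Finset.sum_mul, ← Finset.mul_sum]
  have : ‖y - x‖ ^ 2 = ∑ i, (y i - x i) ^ 2 := by
    rw [EuclideanSpace.norm_sq_eq]; simp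
  rw [← this]
  simp
  ring

/-! bump functions -/

abbrev E1 : ℝ → ℝ := deriv expNegInvGlue
abbrev E2 : ℝ → ℝ := deriv E1

lemma E0_contDiff : ContDiff ℝ (⊤ : ℕ∞) expNegInvGlue := expNegInvGlue.contDiff
lemma E1_contDiff : ContDiff ℝ (⊤ : ℕ∞) E1 := by
  have := (contDiff_infty_iff_deriv (f := expNegInvGlue) (𝕜 := ℝ)).1 E0_contDiff
  exact this.2
lemma E2_contDiff : ContDiff ℝ (⊤ : ℕ∞) E2 := by
  have := (contDiff_infty_iff_deriv (f := E1) (𝕜 := ℝ)).1 E1_contDiff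
  exact this.2
lemma E0_deriv (x : ℝ) : HasDerivAt expNegInvGlue (E1 x) x :=
  ((E0_contDiff.differentiable (by simp)) x).hasDerivAt
lemma E1_deriv (x : ℝ) : HasDerivAt E1 (E2 x) x :=
  ((E1_contDiff.differentiable (by simp)) x).hasDerivAt

lemma E1_nonneg (x : ℝ) : 0 ≤ E1 x := expNegInvGlue.monotone.deriv_nonneg

lemma E1_pos_eq {x : ℝ} (hx : 0 < x) : E1 x = (x⁻¹) ^ 2 * Real.exp (-x⁻¹) := by
  have : HasDerivAt (fun x : ℝ => Real.exp (-x⁻¹)) (Real.exp (-x⁻¹) * (- (-(x^2)⁻¹))) x :=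
    ((hasDerivAt_inv hx.ne').neg).exp
  have h2 : HasDerivAt expNegInvGlue (Real.exp (-x⁻¹) * (- (-(x^2)⁻¹))) x := by
    refine this.congr_of_eventuallyEq ?_
    filter_upwards [lt_mem_nhds hx] with y hy
    simp [expNegInvGlue, not_le.2 hy]
  show deriv expNegInvGlue x = _
  rw [h2.deriv]
  field_simp

lemma E1_nonpos_eq {x : ℝ} (hx : x ≤ 0) : E1 x = 0 := by
  have h1 : HasDerivWithinAt expNegInvGlue (E1 x) (Iic x) x := (E0_deriv x).hasDerivWithinAt
  have h2 : HasDerivWithinAt expNegInvGlue 0 (Iic x) x := by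
    refine (hasDerivWithinAt_const x (Iic x) (0:ℝ)).congr ?_ ?_
    · intro y hy; exact expNegInvGlue.zero_of_nonpos (le_trans hy hx)
    · exact expNegInvGlue.zero_of_nonpos hx
  exact (uniqueDiffWithinAt_Iic x).eq_deriv _ h1 h2

lemma E0_le_E1 {x : ℝ} (hx : x ≤ 1) : expNegInvGlue x ≤ E1 x := by
  rcases le_or_gt x 0 with h | h
  · rw [E1_nonpos_eq h, expNegInvGlue.zero_of_nonpos h]
  · rw [E1_pos_eq h]
    simp only [expNegInvGlue, not_le.2 h, if_false]
    have : 1 ≤ x⁻¹ := (one_le_inv₀ h).2 hx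
    have h2 : 1 ≤ (x⁻¹)^2 := one_le_pow₀ this
    nlinarith [Real.exp_pos (-x⁻¹)]

lemma E1_lower {x : ℝ} (hx : 7/16 ≤ x) (hx1 : x ≤ 1) : Real.exp (-3) ≤ E1 x := by
  have h : 0 < x := by linarith
  rw [E1_pos_eq h]
  have : 1 ≤ x⁻¹ := (one_le_inv₀ h).2 hx1
  have h3 : x⁻¹ ≤ 3 := by
    rw [inv_le_comm₀ h (by norm_num)]; linarith
  have : Real.exp (-3) ≤ Real.exp (-x⁻¹) := Real.exp_le_exp.2 (by linarith)
  have h2 : 1 ≤ (x⁻¹)^2 := one_le_pow₀ (by assumption)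
  nlinarith [Real.exp_pos (-x⁻¹)]

def Zc (N : ℕ) : ℝ := ∫ ξ : ES N, E1 (1 - ‖ξ‖ ^ 2)

lemma E1n_contDiff (N : ℕ) : ContDiff ℝ (⊤ : ℕ∞) (fun ξ : ES N => E1 (1 - ‖ξ‖ ^ 2)) :=
  E1_contDiff.comp (contDiff_const.sub (contDiff_norm_sq ℝ))

lemma E1n_compact (N : ℕ) : HasCompactSupport (fun ξ : ES N => E1 (1 - ‖ξ‖ ^ 2)) := by
  refine HasCompactSupport.intro (isCompact_closedBall (0 : ES N) 1) ?_
  intro x hx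
  apply E1_nonpos_eq
  simp at hx
  nlinarith

lemma Zc_pos (N : ℕ) : 0 < Zc N := by
  unfold Zc
  refine (E1n_contDiff N).continuous.integral_pos_of_hasCompactSupport_nonneg_nonzero (E1n_compact N)
    (fun x => E1_nonneg _) (x := 0) ?_
  have := E1_lower (x := 1) (by norm_num) le_rfl
  have h2 := Real.exp_pos (-3)
  simp
  exact (h2.trans_le this).ne'

def et {N : ℕ} (ξ : ES N) : ℝ := E1 (1 - ‖ξ‖ ^ 2) / Zc N
def ph {N : ℕ} (ξ : ES N) : ℝ := expNegInvGlue (1 - ‖ξ‖ ^ 2) / (2 * Zc N)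

variable {N : ℕ}

lemma et_nonneg (ξ : ES N) : 0 ≤ et ξ := div_nonneg (E1_nonneg _) (Zc_pos N).le
lemma ph_nonneg (ξ : ES N) : 0 ≤ ph ξ :=
  div_nonneg (expNegInvGlue.nonneg _) (by have := Zc_pos N; positivity)
lemma ph_le (ξ : ES N) : ph ξ ≤ et ξ / 2 := by
  unfold ph et
  have := Zc_pos N
  rw [div_div, mul_comm (Zc N) 2]
  gcongr
  exact E0_le_E1 (by nlinarith [norm_nonneg ξ])
lemma et_contDiff : ContDiff ℝ (⊤ : ℕ∞) (et : ES N → ℝ) := (E1n_contDiff N).div_const _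
lemma ph_contDiff : ContDiff ℝ (⊤ : ℕ∞) (ph : ES N → ℝ) :=
  (E0_contDiff.comp (contDiff_const.sub (contDiff_norm_sq ℝ))).div_const _
lemma et_continuous : Continuous (et : ES N → ℝ) := et_contDiff.continuous
lemma ph_continuous : Continuous (ph : ES N → ℝ) := ph_contDiff.continuous
lemma et_zero {ξ : ES N} (h : 1 ≤ ‖ξ‖) : et ξ = 0 := by
  unfold et; rw [E1_nonpos_eq (by nlinarith)]; simp
lemma ph_zero {ξ : ES N} (h : 1 ≤ ‖ξ‖) : ph ξ = 0 := by
  unfold ph; rw [expNegInvGlue.zero_of_nonpos (by nlinarith)]; simp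
lemma et_compact : HasCompactSupport (et : ES N → ℝ) :=
  HasCompactSupport.intro (isCompact_closedBall (0 : ES N) 1) (fun x hx => et_zero (by simp at hx; linarith))
lemma ph_compact : HasCompactSupport (ph : ES N → ℝ) :=
  HasCompactSupport.intro (isCompact_closedBall (0 : ES N) 1) (fun x hx => ph_zero (by simp at hx; linarith))
lemma et_integrable : Integrable (et : ES N → ℝ) := et_continuous.integrable_of_hasCompactSupport et_compact
lemma ph_integrable : Integrable (ph : ES N → ℝ) := ph_continuous.integrable_of_hasCompactSupport ph_compact
lemma et_integral : ∫ ξ : ES N, et ξ = 1 := by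
  unfold et
  rw [integral_div]; exact div_self (Zc_pos N).ne'
def cet (N : ℕ) : ℝ := Real.exp (-3) / Zc N
lemma cet_pos : 0 < cet N := div_pos (Real.exp_pos _) (Zc_pos N)
lemma et_lower {ξ : ES N} (h : ‖ξ‖ ≤ 3/4) : cet N ≤ et ξ := by
  unfold cet et
  have := Zc_pos N
  gcongr
  exact E1_lower (by nlinarith [norm_nonneg ξ]) (by nlinarith [norm_nonneg ξ])
lemma et_lipschitz : ∃ C : ℝ≥0, LipschitzWith C (et : ES N → ℝ) :=
  (et_contDiff).lipschitzWith_of_hasCompactSupport et_compact (by simp)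
def cph (N : ℕ) : ℝ := ∫ ξ : ES N, ph ξ
lemma cph_pos : 0 < cph N := by
  refine ph_continuous.integral_pos_of_hasCompactSupport_nonneg_nonzero ph_compact
    (fun x => ph_nonneg _) (x := 0) ?_
  have h0 := Zc_pos N
  have : 0 < expNegInvGlue (1:ℝ) := expNegInvGlue.pos_of_pos one_pos
  unfold ph; simp only [norm_zero]; norm_num; exact ne_of_gt h0

/-- scaled kernels -/
def teta (ρ : ℝ) (x y : ES N) : ℝ := (ρ ^ N)⁻¹ * et (ρ⁻¹ • (y - x))
def tphi (ρ : ℝ) (x y : ES N) : ℝ := ρ * (ρ ^ N)⁻¹ * ph (ρ⁻¹ • (y - x))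
def tdet (ρ : ℝ) (x y : ES N) : ℝ :=
  -(N * E1 (1 - ‖y - x‖ ^ 2 / ρ ^ 2) - 2 * (‖y - x‖ ^ 2 / ρ ^ 2) * E2 (1 - ‖y - x‖ ^ 2 / ρ ^ 2))
    * (ρ ^ N)⁻¹ * ρ⁻¹ / Zc N

lemma lap_tphi {ρ : ℝ} (hρ : 0 < ρ) (x y : ES N) : lap (tphi ρ x) y = tdet ρ x y := by
  have h := Zc_pos N
  have e : (tphi ρ x : ES N → ℝ) = fun y => (fun s : ℝ => ρ * (ρ ^ N)⁻¹ / (2 * Zc N) * expNegInvGlue (1 - s * (ρ^2)⁻¹)) (‖y - x‖ ^ 2) := by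
    funext z
    simp only [tphi, ph, norm_smul, norm_inv, Real.norm_eq_abs, mul_pow, inv_pow, sq_abs]
    rw [mul_comm ((ρ ^ 2)⁻¹)]
    ring
  have hl : ∀ s : ℝ, HasDerivAt (fun s : ℝ => 1 - s * (ρ^2)⁻¹) (-(ρ^2)⁻¹) s := by
    intro s
    have := ((hasDerivAt_id s).mul_const ((ρ^2)⁻¹)).const_sub 1
    simpa using this
  rw [e, lap_radial (fun s : ℝ => ρ * (ρ ^ N)⁻¹ / (2 * Zc N) * expNegInvGlue (1 - s * (ρ^2)⁻¹)) (fun s => ρ * (ρ ^ N)⁻¹ / (2 * Zc N) * (E1 (1 - s * (ρ^2)⁻¹) * (-(ρ^2)⁻¹)))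
    (fun s => ρ * (ρ ^ N)⁻¹ / (2 * Zc N) * (E2 (1 - s * (ρ^2)⁻¹) * (-(ρ^2)⁻¹) * (-(ρ^2)⁻¹)))]
  · unfold tdet
    simp only [div_eq_mul_inv]
    field_simp
    ring
  · intro s
    exact ((E0_deriv _).comp s (hl s)).const_mul _
  · intro s
    exact (((E1_deriv _).comp s (hl s)).mul_const _).const_mul _

lemma teta_deriv {ρ : ℝ} (hρ : 0 < ρ) (x y : ES N) :
    HasDerivAt (fun ρ => teta ρ x y) (tdet ρ x y) ρ := by
  have h := Zc_pos N
  have e : (fun ρ => teta ρ x y) =ᶠ[𝓝 ρ] fun ρ => (ρ ^ N)⁻¹ * (E1 (1 - ‖y - x‖ ^ 2 * (ρ ^ 2)⁻¹) / Zc N) := by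
    filter_upwards with z
    simp only [teta, et, norm_smul, norm_inv, Real.norm_eq_abs, mul_pow, inv_pow, sq_abs]
    rw [mul_comm ((z ^ 2)⁻¹)]
  refine HasDerivAt.congr_of_eventuallyEq ?_ e
  have h1 : HasDerivAt (fun ρ : ℝ => (ρ ^ N)⁻¹) (-(N * ρ ^ (N-1)) / (ρ ^ N)^2) ρ :=
    (hasDerivAt_pow N ρ).inv (pow_pos hρ _).ne'
  have h2 : HasDerivAt (fun ρ : ℝ => (ρ ^ 2)⁻¹) (-(2 * ρ) / (ρ ^ 2)^2) ρ := by
    have := (hasDerivAt_pow 2 ρ).inv (pow_pos hρ _).ne'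
    norm_num at this ⊢
    exact this
  have h3 := (h1.mul (((E1_deriv _).comp ρ ((h2.const_mul (‖y - x‖ ^ 2)).const_sub 1)).div_const (Zc N)))
  refine h3.congr_deriv ?_
  unfold tdet
  simp only [Function.comp, div_eq_mul_inv]
  rcases Nat.eq_zero_or_pos N with h0 | h0
  · subst h0; simp; field_simp; simp
  · obtain ⟨n, rfl⟩ : ∃ n, N = n + 1 := ⟨N - 1, by omega⟩
    simp only [Nat.add_sub_cancel]
    field_simp
    ring
end

section
variable {N : ℕ}

/-- unit ball averages -/
def Mav (f : ES N → ℝ) (x : ES N) (ρ : ℝ) : ℝ := ∫ ξ in closedBall (0 : ES N) 1, f (x + ρ • ξ) * et ξ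

lemma change_var (f k : ES N → ℝ) (hk : ∀ ξ, 1 ≤ ‖ξ‖ → k ξ = 0) (x : ES N) {ρ : ℝ} (hρ : 0 < ρ) :
    ∫ ξ in closedBall (0 : ES N) 1, f (x + ρ • ξ) * k ξ
      = ∫ y, f y * ((ρ ^ N)⁻¹ * k (ρ⁻¹ • (y - x))) := by
  have h1 : ∫ ξ in closedBall (0 : ES N) 1, f (x + ρ • ξ) * k ξ = ∫ ξ, f (x + ρ • ξ) * k ξ := by
    apply setIntegral_eq_integral_of_forall_compl_eq_zero
    intro ξ hξ
    rw [hk ξ (by simp at hξ; linarith)]; simp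
  rw [h1]
  have h2 := Measure.integral_comp_smul (volume : Measure (ES N)) (fun y => f (x + y) * k (ρ⁻¹ • y)) ρ
  simp only [smul_smul, inv_mul_cancel₀ hρ.ne', one_smul] at h2
  rw [h2]
  simp only [finrank_euclideanSpace, Fintype.card_fin, smul_eq_mul]
  rw [← integral_const_mul, ← integral_add_left_eq_self (fun y => f y * ((ρ ^ N)⁻¹ * k (ρ⁻¹ • (y - x)))) x]
  congr 1; funext y
  rw [abs_of_pos (by positivity), add_sub_cancel_left]; ring

lemma Mav_eq (f : ES N → ℝ) (x : ES N) {ρ : ℝ} (hρ : 0 < ρ) :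
    Mav f x ρ = ∫ y, f y * teta ρ x y := change_var f et (fun _ => et_zero) x hρ

lemma tphi_int (g : ES N → ℝ) (x : ES N) {ρ : ℝ} (hρ : 0 < ρ) :
    ∫ y, g y * tphi ρ x y = ρ * ∫ ξ in closedBall (0 : ES N) 1, g (x + ρ • ξ) * ph ξ := by
  rw [change_var g ph (fun _ => ph_zero) x hρ, ← integral_const_mul]
  congr 1; funext y; unfold tphi; ring

lemma tdet_zero {ρ : ℝ} (hρ : 0 < ρ) {x y : ES N} (h : ρ < dist y x) : tdet ρ x y = 0 := by
  have h1 : 1 - ‖y - x‖ ^ 2 / ρ ^ 2 < 0 := by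
    rw [dist_eq_norm] at h
    have : 1 < ‖y - x‖ ^ 2 / ρ ^ 2 := by
      rw [one_lt_div (by positivity)]; gcongr
    linarith
  have e2 : E2 (1 - ‖y - x‖ ^ 2 / ρ ^ 2) = 0 := by
    have : E1 =ᶠ[𝓝 (1 - ‖y - x‖ ^ 2 / ρ ^ 2)] fun _ => 0 := by
      filter_upwards [gt_mem_nhds h1] with z hz
      exact E1_nonpos_eq hz.le
    exact this.deriv_eq.trans (by simp)
  unfold tdet
  rw [e2, E1_nonpos_eq h1.le]; simp

lemma teta_zero {ρ : ℝ} (hρ : 0 < ρ) {x y : ES N} (h : ρ < dist y x) : teta ρ x y = 0 := by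
  unfold teta
  rw [et_zero]; simp
  rw [norm_smul, norm_inv, Real.norm_eq_abs, abs_of_pos hρ, ← dist_eq_norm]
  rw [inv_mul_eq_div, le_div_iff₀ hρ]; linarith

lemma tphi_zero {ρ : ℝ} (hρ : 0 < ρ) {x y : ES N} (h : ρ < dist y x) : tphi ρ x y = 0 := by
  unfold tphi
  rw [ph_zero]; simp
  rw [norm_smul, norm_inv, Real.norm_eq_abs, abs_of_pos hρ, ← dist_eq_norm]
  rw [inv_mul_eq_div, le_div_iff₀ hρ]; linarith

lemma tphi_tsupport {ρ : ℝ} (hρ : 0 < ρ) (x : ES N) : tsupport (tphi ρ x) ⊆ closedBall x ρ := by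
  refine closure_minimal ?_ isClosed_closedBall
  intro y hy
  by_contra h
  simp at h
  exact hy (tphi_zero hρ h)

lemma tphi_test {Ω : Set (ES N)} {ρ : ℝ} (hρ : 0 < ρ) {x : ES N} (h : closedBall x ρ ⊆ Ω) :
    IsTestFun Ω (tphi ρ x) := by
  refine ⟨?_, ?_, (tphi_tsupport hρ x).trans h⟩
  · unfold tphi
    exact contDiff_const.mul (ph_contDiff.comp (by fun_prop))
  · exact (isCompact_closedBall x ρ).of_isClosed_subset (isClosed_tsupport _) (tphi_tsupport hρ x)

lemma tphi_nonneg {ρ : ℝ} (hρ : 0 < ρ) (x y : ES N) : 0 ≤ tphi ρ x y := by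
  unfold tphi; have := ph_nonneg (ρ⁻¹ • (y - x)); positivity

lemma tietze {f : ES N → ℝ} {K : Set (ES N)} (hK : IsClosed K) (hf : ContinuousOn f K) :
    ∃ F : ES N → ℝ, Continuous F ∧ ∀ y ∈ K, F y = f y := by
  obtain ⟨g, hg⟩ := ContinuousMap.exists_restrict_eq hK ⟨K.domRestrict f, hf.domRestrict⟩
  refine ⟨g, g.continuous, fun y hy => ?_⟩
  exact congrArg (fun h => h ⟨y, hy⟩) hg

lemma mem_cb {x ξ : ES N} {ρ R : ℝ} (hρ : 0 ≤ ρ) (hR : ρ ≤ R) (hξ : ξ ∈ closedBall (0 : ES N) 1) :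
    x + ρ • ξ ∈ closedBall x R := by
  simp only [mem_closedBall, dist_zero_right] at hξ ⊢
  rw [dist_eq_norm, add_sub_cancel_left, norm_smul, Real.norm_eq_abs, abs_of_nonneg hρ]
  nlinarith

lemma Mav_congr {f F : ES N → ℝ} {x : ES N} {ρ R : ℝ} (hρ : 0 ≤ ρ) (hR : ρ ≤ R)
    (h : ∀ y ∈ closedBall x R, F y = f y) : Mav F x ρ = Mav f x ρ := by
  unfold Mav
  refine setIntegral_congr_fun measurableSet_closedBall ?_
  intro ξ hξ
  simp only
  rw [h _ (mem_cb hρ hR hξ)]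

lemma Mav_cont {F : ES N → ℝ} (hF : Continuous F) (x : ES N) : Continuous (Mav F x) := by
  unfold Mav
  refine continuous_parametric_integral_of_continuous (μ := volume) (f := fun (ρ : ℝ) (ξ : ES N) => F (x + ρ • ξ) * et ξ) ?_
    (isCompact_closedBall (0 : ES N) 1)
  have := et_continuous (N := N)
  simp only [Function.uncurry_def]
  fun_prop

lemma Mav_contOn {f : ES N → ℝ} {x : ES N} {R : ℝ} (hf : ContinuousOn f (closedBall x R)) :
    ContinuousOn (Mav f x) (Icc 0 R) := by
  obtain ⟨F, hF, hFf⟩ := tietze isClosed_closedBall hf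
  refine (Mav_cont hF x).continuousOn.congr ?_
  intro ρ hρ
  exact (Mav_congr hρ.1 hρ.2 hFf).symm

lemma Mav_zero (f : ES N → ℝ) (x : ES N) : Mav f x 0 = f x := by
  unfold Mav
  simp only [zero_smul, add_zero]
  rw [integral_const_mul]
  have : ∫ ξ in closedBall (0 : ES N) 1, et ξ = ∫ ξ : ES N, et ξ := by
    apply setIntegral_eq_integral_of_forall_compl_eq_zero
    intro ξ hξ
    exact et_zero (by simp at hξ; linarith)
  rw [this, et_integral, mul_one]

lemma Mav_hasDeriv_cont {F : ES N → ℝ} (hF : Continuous F) (x : ES N) {ρ : ℝ} (hρ : 0 < ρ) :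
    HasDerivAt (Mav F x) (∫ y, F y * tdet ρ x y) ρ := by
  have e : Mav F x =ᶠ[𝓝 ρ] fun ρ => ∫ y, F y * teta ρ x y := by
    filter_upwards [lt_mem_nhds hρ] with z hz
    exact Mav_eq F x hz
  refine HasDerivAt.congr_of_eventuallyEq ?_ e
  have hZ := Zc_pos N
  have cE1 : Continuous E1 := E1_contDiff.continuous
  have cE2 : Continuous E2 := E2_contDiff.continuous
  have hball : Ioo (ρ/2) (2*ρ) ∈ 𝓝 ρ := Ioo_mem_nhds (by linarith) (by linarith)
  have hdetc : ContinuousOn (fun p : ℝ × ES N => F p.2 * tdet p.1 x p.2)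
      (Icc (ρ/2) (2*ρ) ×ˢ closedBall x (2*ρ)) := by
    unfold tdet
    have hne : ∀ p ∈ Icc (ρ/2) (2*ρ) ×ˢ closedBall x (2*ρ), p.1 ≠ 0 := by
      intro p hp; have := hp.1.1; intro h0; rw [h0] at this; linarith
    refine ContinuousOn.mul (by fun_prop) (ContinuousOn.div_const (ContinuousOn.mul (ContinuousOn.mul ?_ ?_) ?_) _)
    · have hq : ContinuousOn (fun p : ℝ × ES N => ‖p.2 - x‖ ^ 2 / p.1 ^ 2) (Icc (ρ/2) (2*ρ) ×ˢ closedBall x (2*ρ)) := by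
        refine ContinuousOn.div (by fun_prop) (by fun_prop) ?_
        intro p hp; exact pow_ne_zero _ (hne p hp)
      have h1 : ContinuousOn (fun p : ℝ × ES N => E1 (1 - ‖p.2 - x‖ ^ 2 / p.1 ^ 2)) (Icc (ρ/2) (2*ρ) ×ˢ closedBall x (2*ρ)) :=
        cE1.comp_continuousOn (continuousOn_const.sub hq)
      have h2 : ContinuousOn (fun p : ℝ × ES N => E2 (1 - ‖p.2 - x‖ ^ 2 / p.1 ^ 2)) (Icc (ρ/2) (2*ρ) ×ˢ closedBall x (2*ρ)) :=
        cE2.comp_continuousOn (continuousOn_const.sub hq)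
      exact ((continuousOn_const.mul h1).sub ((continuousOn_const.mul hq).mul h2)).neg
    · exact ContinuousOn.inv₀ (by fun_prop) (fun p hp => pow_ne_zero _ (hne p hp))
    · exact ContinuousOn.inv₀ (by fun_prop) hne
  obtain ⟨B, hB⟩ := (isCompact_Icc.prod (isCompact_closedBall x (2*ρ))).exists_bound_of_continuousOn hdetc
  have hteta_cont : ∀ z : ℝ, Continuous (fun y => F y * teta z x y) := by
    intro z
    unfold teta
    have := et_continuous (N := N)
    fun_prop
  have hdet_cont : Continuous (fun y => F y * tdet ρ x y) := by
    unfold tdet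
    fun_prop
  refine (hasDerivAt_integral_of_dominated_loc_of_deriv_le (F := fun z y => F y * teta z x y)
    (F' := fun z y => F y * tdet z x y) (bound := (closedBall x (2*ρ)).indicator (fun _ => B)) hball ?_ ?_ ?_ ?_ ?_ ?_).2
  · filter_upwards with z
    exact (hteta_cont z).aestronglyMeasurable
  · refine (hteta_cont ρ).integrable_of_hasCompactSupport ?_
    refine HasCompactSupport.intro (isCompact_closedBall x ρ) ?_
    intro y hy
    rw [teta_zero hρ (by simpa using hy)]; simp
  · exact hdet_cont.aestronglyMeasurable
  · filter_upwards with y z hz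
    by_cases hy : y ∈ closedBall x (2*ρ)
    · rw [indicator_of_mem hy]
      exact hB (z, y) ⟨⟨hz.1.le, hz.2.le⟩, hy⟩
    · rw [indicator_of_notMem hy]
      simp only [mem_closedBall, not_le] at hy
      rw [tdet_zero (by linarith [hz.1]) (by linarith [hz.2])]; simp
  · rw [integrable_indicator_iff measurableSet_closedBall]
    exact integrableOn_const measure_closedBall_lt_top.ne
  · filter_upwards with y z hz
    exact (teta_deriv (by linarith [hz.1]) x y).const_mul _

lemma weak_M_deriv {Ω : Set (ES N)} {f g : ES N → ℝ} (hf : ContinuousOn f Ω)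
    (hw : ∀ φ, IsTestFun Ω φ → (∀ x, 0 ≤ φ x) → ∫ x in Ω, f x * lap φ x ≤ ∫ x in Ω, g x * φ x)
    {x : ES N} {R : ℝ} (hR : closedBall x R ⊆ Ω) {ρ : ℝ} (hρ : 0 < ρ) (hρR : ρ < R) :
    ∃ D, HasDerivAt (Mav f x) D ρ ∧ D ≤ ρ * ∫ ξ in closedBall (0 : ES N) 1, g (x + ρ • ξ) * ph ξ := by
  obtain ⟨F, hF, hFf⟩ := tietze isClosed_closedBall (hf.mono hR)
  refine ⟨∫ y, F y * tdet ρ x y, ?_, ?_⟩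
  · refine (Mav_hasDeriv_cont hF x hρ).congr_of_eventuallyEq ?_
    filter_upwards [Ioo_mem_nhds hρ hρR] with z hz
    exact (Mav_congr hz.1.le hz.2.le hFf).symm
  · have hsub : closedBall x ρ ⊆ Ω := (closedBall_subset_closedBall hρR.le).trans hR
    have h1 := hw _ (tphi_test hρ hsub) (tphi_nonneg hρ x)
    rw [← tphi_int g x hρ]
    have e1 : ∫ y in Ω, f y * lap (tphi ρ x) y = ∫ y, F y * tdet ρ x y := by
      rw [setIntegral_eq_integral_of_forall_compl_eq_zero]
      · congr 1; funext y
        rw [lap_tphi hρ]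
        by_cases hy : y ∈ closedBall x R
        · rw [hFf y hy]
        · rw [tdet_zero hρ (by simp at hy; linarith)]; simp
      · intro y hy
        rw [lap_tphi hρ, tdet_zero hρ]; simp
        by_contra h; exact hy (hsub (by simpa using h))
    have e2 : ∫ y in Ω, g y * tphi ρ x y = ∫ y, g y * tphi ρ x y := by
      rw [setIntegral_eq_integral_of_forall_compl_eq_zero]
      intro y hy
      rw [tphi_zero hρ]; simp
      by_contra h; exact hy (hsub (by simpa using h))
    rw [← e1, ← e2]; exact h1
end

section
structure Dom (N : ℕ) where
  Ω : Set (ES N)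
  V : ES N → ℝ
  a : ℝ
  hN : 2 ≤ N
  hΩ : IsLipschitzDomain Ω
  hbd : Bornology.IsBounded Ω
  ha : 0 < a
  hV : VClass Ω a V

namespace Dom
variable {N : ℕ} (D : Dom N)

def d (x : ES N) : ℝ := dista D.Ω x

lemma isOpen : IsOpen D.Ω := D.hΩ.1
lemma compl_nonempty : (D.Ωᶜ).Nonempty := by
  by_contra h
  rw [Set.not_nonempty_iff_eq_empty, Set.compl_empty_iff] at h
  have hb := D.hbd
  rw [h] at hb
  have : Nonempty (Fin N) := ⟨⟨0, by have := D.hN; omega⟩⟩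
  have : Nontrivial (ES N) := inferInstance
  exact NormedSpace.unbounded_univ ℝ (ES N) hb
lemma d_nonneg (x : ES N) : 0 ≤ D.d x := infDist_nonneg
lemma d_pos {x : ES N} (hx : x ∈ D.Ω) : 0 < D.d x := by
  have := (D.isOpen.isClosed_compl.notMem_iff_infDist_pos D.compl_nonempty (x := x)).1 (by simpa using hx)
  exact this
lemma d_le {x y : ES N} (hy : y ∉ D.Ω) : D.d x ≤ dist x y := infDist_le_dist_of_mem hy
lemma d_lip (x y : ES N) : D.d x ≤ D.d y + dist x y := infDist_le_infDist_add_dist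
lemma d_cont : Continuous D.d := continuous_infDist_pt _
lemma mem_of_dist {x y : ES N} (h : dist x y < D.d x) : y ∈ D.Ω := by
  by_contra hy; exact absurd (D.d_le (x := x) hy) (not_le.2 h)
lemma mem_of_pos {x : ES N} (h : 0 < D.d x) : x ∈ D.Ω := D.mem_of_dist (x := x) (by simpa)
lemma cb_sub {x : ES N} (hx : x ∈ D.Ω) : closedBall x (D.d x / 4) ⊆ D.Ω := by
  intro y hy
  have := D.d_pos hx
  rw [mem_closedBall, dist_comm] at hy
  exact D.mem_of_dist (by linarith)
lemma d_exists_frontier (x : ES N) (hx : x ∈ D.Ω) : ∃ y ∈ frontier D.Ω, dist x y = D.d x := by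
  obtain ⟨y, hy, h⟩ := D.isOpen.isClosed_compl.exists_infDist_eq_dist D.compl_nonempty x
  refine ⟨y, ?_, h.symm⟩
  rw [frontier, D.isOpen.interior_eq]
  refine ⟨?_, hy⟩
  have hpos := D.d_pos hx
  have hd : D.d x = dist x y := h
  rw [Metric.mem_closure_iff]
  intro ε hε
  -- point on the segment
  set t : ℝ := min (1/2) (ε / (2 * D.d x)) with ht
  have ht0 : 0 < t := by positivity
  have ht1 : t ≤ 1/2 := min_le_left _ _
  have ht2 : t * D.d x ≤ ε / 2 := by
    have := min_le_right (1/2) (ε / (2 * D.d x))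
    calc t * D.d x ≤ ε / (2 * D.d x) * D.d x := by gcongr
      _ = ε / 2 := by field_simp
  refine ⟨y + t • (x - y), D.mem_of_dist (x := x) ?_, ?_⟩
  · have : x - (y + t • (x - y)) = (1 - t) • (x - y) := by
      rw [sub_smul, one_smul]; abel
    rw [dist_eq_norm, this, norm_smul, Real.norm_eq_abs, abs_of_pos (by linarith), ← dist_eq_norm, ← hd]
    nlinarith
  · rw [dist_eq_norm, sub_add_cancel_left, norm_neg, norm_smul, ← dist_eq_norm, ← hd, Real.norm_eq_abs, abs_of_pos ht0]
    linarith

lemma V_nonneg {x : ES N} (hx : x ∈ D.Ω) : 0 ≤ D.V x := (D.hV.2 x hx).1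

/-! the operator -/
def lam : ℝ := 1 / (4 * (1 + D.a))
lemma lam_pos : 0 < D.lam := by unfold lam; have := D.ha; positivity
lemma lam_lt : D.lam < 1 / 4 := by
  unfold lam; have := D.ha
  rw [div_lt_div_iff₀ (by positivity) (by norm_num)]; linarith
def rr (x : ES N) : ℝ := D.lam * D.d x
lemma rr_pos {x : ES N} (hx : x ∈ D.Ω) : 0 < D.rr x := mul_pos D.lam_pos (D.d_pos hx)
lemma rr_nonneg (x : ES N) : 0 ≤ D.rr x := mul_nonneg D.lam_pos.le (D.d_nonneg x)
lemma rr_le (x : ES N) : D.rr x ≤ D.d x / 4 := by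
  unfold rr; have := D.lam_lt; have := D.d_nonneg x; nlinarith
lemma rr_cont : Continuous D.rr := continuous_const.mul D.d_cont

def mb : Measure (ℝ × ES N) :=
  (volume.restrict (Ioc (0:ℝ) 1)).prod (volume.restrict (closedBall (0 : ES N) 1))
instance : IsFiniteMeasure (mb : Measure (ℝ × ES N)) := by
  have : IsFiniteMeasure (volume.restrict (closedBall (0 : ES N) 1)) :=
    ⟨by simpa using measure_closedBall_lt_top⟩
  unfold mb; infer_instance

lemma ae_mb : ∀ᵐ p ∂(mb : Measure (ℝ × ES N)), p ∈ Ioc (0:ℝ) 1 ×ˢ closedBall (0 : ES N) 1 := by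
  unfold mb
  rw [Measure.prod_restrict]
  exact ae_restrict_mem (measurableSet_Ioc.prod measurableSet_closedBall)

def pt (x : ES N) (p : ℝ × ES N) : ES N := x + (D.rr x * p.1) • p.2

def k0 (x : ES N) (p : ℝ × ES N) : ℝ :=
  p.1 * (2 * et p.2 - (1 - p.1 ^ 2) * D.rr x ^ 2 * D.V (D.pt x p) * ph p.2)
def kk (x : ES N) (p : ℝ × ES N) : ℝ := max 0 (min (D.k0 x p) (2 * et p.2))

lemma pt_mem {x : ES N} {p : ℝ × ES N} (hp : p ∈ Ioc (0:ℝ) 1 ×ˢ closedBall (0 : ES N) 1) :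
    D.pt x p ∈ closedBall x (D.rr x) :=
  mem_cb (mul_nonneg (D.rr_nonneg x) hp.1.1.le) (by have := D.rr_nonneg x; nlinarith [hp.1.2]) hp.2

lemma pt_mem4 {x : ES N} {p : ℝ × ES N} (hp : p ∈ Ioc (0:ℝ) 1 ×ˢ closedBall (0 : ES N) 1) :
    D.pt x p ∈ closedBall x (D.d x / 4) := closedBall_subset_closedBall (D.rr_le x) (D.pt_mem hp)

lemma V_bd {x y : ES N} (hx : x ∈ D.Ω) (hy : y ∈ closedBall x (D.d x / 4)) : D.rr x ^ 2 * D.V y ≤ 1 := by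
  have hyΩ := D.cb_sub hx hy
  have h1 := (D.hV.2 y hyΩ)
  have h2 : 3 / 4 * D.d x ≤ D.d y := by
    have := D.d_lip x y
    rw [mem_closedBall, dist_comm] at hy; linarith
  have hd := D.d_pos hx
  have h3 : D.V y * (3 / 4 * D.d x) ^ 2 ≤ D.a := by
    refine le_trans ?_ h1.2
    have : dista D.Ω y = D.d y := rfl
    rw [this]
    have := h1.1
    gcongr
  unfold rr
  have ha := D.ha
  have hl : D.lam * (4 * (1 + D.a)) = 1 := by unfold lam; field_simp
  have hl0 := D.lam_pos
  have h5 : 16 * D.lam ^ 2 * (1 + D.a) ^ 2 = 1 := by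
    have : 16 * D.lam ^ 2 * (1 + D.a) ^ 2 = (D.lam * (4 * (1 + D.a))) ^ 2 := by ring
    rw [this, hl, one_pow]
  have h4 : (16 * D.lam ^ 2) * D.a ≤ 1 := by
    rw [← h5]; gcongr; nlinarith
  have h6 : (D.lam * D.d x) ^ 2 * D.V y = D.lam^2 * (16/9) * (D.V y * (3 / 4 * D.d x) ^ 2) := by ring
  rw [h6]
  calc D.lam^2 * (16/9) * (D.V y * (3 / 4 * D.d x) ^ 2) ≤ D.lam^2 * (16/9) * D.a := by gcongr
    _ ≤ 1 := by nlinarith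

lemma k0_lower {x : ES N} (hx : x ∈ D.Ω) {p : ℝ × ES N} (hp : p ∈ Ioc (0:ℝ) 1 ×ˢ closedBall (0 : ES N) 1) :
    p.1 * et p.2 ≤ D.k0 x p := by
  unfold k0
  have h1 := D.V_bd hx (D.pt_mem4 hp)
  have h0 := D.V_nonneg (D.cb_sub hx (D.pt_mem4 hp))
  have h2 := ph_le p.2
  have h3 := ph_nonneg p.2
  have h4 := hp.1.1
  have h5 := hp.1.2
  have h6 : 0 ≤ D.rr x ^ 2 * D.V (D.pt x p) := by positivity
  have h7 : (1 - p.1 ^ 2) * D.rr x ^ 2 * D.V (D.pt x p) * ph p.2 ≤ ph p.2 := by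
    have : (1 - p.1 ^ 2) * (D.rr x ^ 2 * D.V (D.pt x p)) ≤ 1 := by nlinarith
    calc _ = ((1 - p.1 ^ 2) * (D.rr x ^ 2 * D.V (D.pt x p))) * ph p.2 := by ring
      _ ≤ 1 * ph p.2 := by gcongr
      _ = _ := one_mul _
  have h8 := et_nonneg p.2
  have : et p.2 ≤ (2 * et p.2 - (1 - p.1 ^ 2) * D.rr x ^ 2 * D.V (D.pt x p) * ph p.2) := by linarith
  gcongr

lemma k0_upper {x : ES N} (hx : x ∈ D.Ω) {p : ℝ × ES N} (hp : p ∈ Ioc (0:ℝ) 1 ×ˢ closedBall (0 : ES N) 1) :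
    D.k0 x p ≤ 2 * et p.2 := by
  unfold k0
  have h0 := D.V_nonneg (D.cb_sub hx (D.pt_mem4 hp))
  have h3 := ph_nonneg p.2
  have h4 := hp.1.1
  have h5 := hp.1.2
  have h8 := et_nonneg p.2
  have : 0 ≤ (1 - p.1 ^ 2) * D.rr x ^ 2 * D.V (D.pt x p) * ph p.2 := by
    have : 0 ≤ 1 - p.1 ^ 2 := by nlinarith
    positivity
  nlinarith

lemma kk_eq {x : ES N} (hx : x ∈ D.Ω) {p : ℝ × ES N} (hp : p ∈ Ioc (0:ℝ) 1 ×ˢ closedBall (0 : ES N) 1) :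
    D.kk x p = D.k0 x p := by
  unfold kk
  rw [min_eq_left (D.k0_upper hx hp), max_eq_right]
  exact le_trans (mul_nonneg hp.1.1.le (et_nonneg _)) (D.k0_lower hx hp)

lemma kk_nonneg (x : ES N) (p : ℝ × ES N) : 0 ≤ D.kk x p := le_max_left _ _
lemma kk_le (x : ES N) (p : ℝ × ES N) : D.kk x p ≤ 2 * et p.2 :=
  max_le (by have := et_nonneg p.2; linarith) (min_le_right _ _)
lemma et_bdd : ∃ B : ℝ, 0 < B ∧ ∀ ξ : ES N, et ξ ≤ B := by
  obtain ⟨B, hB⟩ := et_continuous.bounded_above_of_compact_support (et_compact (N := N))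
  refine ⟨max B 1, by positivity, fun ξ => le_trans (le_trans (le_abs_self _) (hB ξ)) (le_max_left _ _)⟩

lemma pt_meas : Measurable (fun q : ES N × (ℝ × ES N) => D.pt q.1 q.2) := by
  unfold pt
  have := D.rr_cont.measurable
  fun_prop
lemma kk_meas : Measurable (fun q : ES N × (ℝ × ES N) => D.kk q.1 q.2) := by
  unfold kk k0
  have h1 := (et_continuous (N := N)).measurable
  have h2 := (ph_continuous (N := N)).measurable
  have h3 := D.hV.1.comp D.pt_meas
  have h4 := D.rr_cont.measurable
  simp only [Function.comp_def] at h3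
  fun_prop

def P (f : ES N → ℝ) (x : ES N) : ℝ := ∫ p, D.kk x p * f (D.pt x p) ∂mb

structure Lc (f : ES N → ℝ) : Prop where
  meas : Measurable f
  bdd : ∀ x ∈ D.Ω, ∃ B, ∀ y ∈ closedBall x (D.d x / 4), |f y| ≤ B

variable {D}
lemma P_integrable {f : ES N → ℝ} (hf : D.Lc f) {x : ES N} (hx : x ∈ D.Ω) :
    Integrable (fun p => D.kk x p * f (D.pt x p)) mb := by
  obtain ⟨B, hB⟩ := hf.bdd x hx
  obtain ⟨C, hC, hC'⟩ := et_bdd (N := N)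
  refine Integrable.of_bound (C := 2 * C * B) ?_ ?_
  · exact ((D.kk_meas.comp (measurable_prodMk_left (x := x))).mul (hf.meas.comp (D.pt_meas.comp (measurable_prodMk_left (x := x))))).aestronglyMeasurable
  · filter_upwards [ae_mb] with p hp
    rw [norm_mul, Real.norm_eq_abs, Real.norm_eq_abs, abs_of_nonneg (D.kk_nonneg x p)]
    have h1 := hB _ (D.pt_mem4 hp)
    have h2 := (D.kk_le x p).trans (mul_le_mul_of_nonneg_left (hC' p.2) (by norm_num : (0:ℝ) ≤ 2))
    have := abs_nonneg (f (D.pt x p))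
    gcongr

lemma P_mono {f g : ES N → ℝ} (hf : D.Lc f) (hg : D.Lc g) {x : ES N} (hx : x ∈ D.Ω)
    (h : ∀ y ∈ closedBall x (D.d x / 4), f y ≤ g y) : D.P f x ≤ D.P g x := by
  refine integral_mono_ae (P_integrable hf hx) (P_integrable hg hx) ?_
  filter_upwards [ae_mb] with p hp
  exact mul_le_mul_of_nonneg_left (h _ (D.pt_mem4 hp)) (D.kk_nonneg x p)

lemma P_congr {f g : ES N → ℝ} {x : ES N}
    (h : ∀ y ∈ closedBall x (D.d x / 4), f y = g y) : D.P f x = D.P g x := by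
  refine integral_congr_ae ?_
  filter_upwards [ae_mb] with p hp
  rw [h _ (D.pt_mem4 hp)]

lemma Lc.add {f g : ES N → ℝ} (hf : D.Lc f) (hg : D.Lc g) : D.Lc (fun x => f x + g x) := by
  refine ⟨hf.meas.add hg.meas, fun x hx => ?_⟩
  obtain ⟨B, hB⟩ := hf.bdd x hx
  obtain ⟨C, hC⟩ := hg.bdd x hx
  exact ⟨B + C, fun y hy => (abs_add_le _ _).trans (add_le_add (hB y hy) (hC y hy))⟩
lemma Lc.const_mul {f : ES N → ℝ} (hf : D.Lc f) (c : ℝ) : D.Lc (fun x => c * f x) := by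
  refine ⟨hf.meas.const_mul c, fun x hx => ?_⟩
  obtain ⟨B, hB⟩ := hf.bdd x hx
  refine ⟨|c| * B, fun y hy => ?_⟩
  rw [abs_mul]; exact mul_le_mul_of_nonneg_left (hB y hy) (abs_nonneg c)
lemma Lc.const (c : ℝ) : D.Lc (fun _ => c) := ⟨measurable_const, fun _ _ => ⟨|c|, fun _ _ => le_rfl⟩⟩
lemma Lc.neg {f : ES N → ℝ} (hf : D.Lc f) : D.Lc (fun x => - f x) := by
  have := hf.const_mul (-1); simpa using this
lemma Lc.sub {f g : ES N → ℝ} (hf : D.Lc f) (hg : D.Lc g) : D.Lc (fun x => f x - g x) := by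
  have := hf.add hg.neg; simpa [sub_eq_add_neg] using this
lemma Lc.min {f g : ES N → ℝ} (hf : D.Lc f) (hg : D.Lc g) : D.Lc (fun x => min (f x) (g x)) := by
  refine ⟨hf.meas.min hg.meas, fun x hx => ?_⟩
  obtain ⟨B, hB⟩ := hf.bdd x hx
  obtain ⟨C, hC⟩ := hg.bdd x hx
  refine ⟨Max.max B C, fun y hy => ?_⟩
  rcases min_choice (f y) (g y) with h | h <;> rw [h]
  · exact (hB y hy).trans (le_max_left _ _)
  · exact (hC y hy).trans (le_max_right _ _)
lemma Lc.max {f g : ES N → ℝ} (hf : D.Lc f) (hg : D.Lc g) : D.Lc (fun x => max (f x) (g x)) := by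
  refine ⟨hf.meas.max hg.meas, fun x hx => ?_⟩
  obtain ⟨B, hB⟩ := hf.bdd x hx
  obtain ⟨C, hC⟩ := hg.bdd x hx
  refine ⟨Max.max B C, fun y hy => ?_⟩
  rcases max_choice (f y) (g y) with h | h <;> rw [h]
  · exact (hB y hy).trans (le_max_left _ _)
  · exact (hC y hy).trans (le_max_right _ _)
lemma Lc.of_contOn {f : ES N → ℝ} (hm : Measurable f) (hf : ContinuousOn f D.Ω) : D.Lc f := by
  refine ⟨hm, fun x hx => ?_⟩
  obtain ⟨B, hB⟩ := (isCompact_closedBall x (D.d x / 4)).exists_bound_of_continuousOn (hf.mono (D.cb_sub hx))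
  exact ⟨B, hB⟩
/-- a measurable function between zero and an `Lc` function -/
lemma Lc.of_le {f g : ES N → ℝ} (hm : Measurable f) (h0 : ∀ x ∈ D.Ω, 0 ≤ f x) (hfg : ∀ x ∈ D.Ω, f x ≤ g x)
    (hg : D.Lc g) : D.Lc f := by
  refine ⟨hm, fun x hx => ?_⟩
  obtain ⟨B, hB⟩ := hg.bdd x hx
  refine ⟨B, fun y hy => ?_⟩
  have hyΩ := D.cb_sub hx hy
  rw [abs_of_nonneg (h0 y hyΩ)]
  exact (hfg y hyΩ).trans ((le_abs_self _).trans (hB y hy))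

lemma P_add {f g : ES N → ℝ} (hf : D.Lc f) (hg : D.Lc g) {x : ES N} (hx : x ∈ D.Ω) :
    D.P (fun x => f x + g x) x = D.P f x + D.P g x := by
  unfold P
  rw [← integral_add (P_integrable hf hx) (P_integrable hg hx)]
  congr 1; funext p; ring
lemma P_const_mul {f : ES N → ℝ} (c : ℝ) {x : ES N} :
    D.P (fun x => c * f x) x = c * D.P f x := by
  unfold P
  rw [← integral_const_mul]
  congr 1; funext p; ring
lemma P_neg {f : ES N → ℝ} {x : ES N} : D.P (fun x => - f x) x = - D.P f x := by
  have := P_const_mul (D := D) (f := f) (x := x) (-1); simpa using this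
lemma P_sub {f g : ES N → ℝ} (hf : D.Lc f) (hg : D.Lc g) {x : ES N} (hx : x ∈ D.Ω) :
    D.P (fun x => f x - g x) x = D.P f x - D.P g x := by
  have := P_add hf hg.neg hx
  simp only [P_neg] at this
  simpa [sub_eq_add_neg] using this
lemma P_nonneg {f : ES N → ℝ} {x : ES N} (h : ∀ y ∈ closedBall x (D.d x / 4), 0 ≤ f y) : 0 ≤ D.P f x := by
  refine integral_nonneg_of_ae ?_
  filter_upwards [ae_mb] with p hp
  exact mul_nonneg (D.kk_nonneg x p) (h _ (D.pt_mem4 hp))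

lemma P_meas {f : ES N → ℝ} (hf : Measurable f) : Measurable (D.P f) := by
  have : StronglyMeasurable (fun q : ES N × (ℝ × ES N) => D.kk q.1 q.2 * f (D.pt q.1 q.2)) :=
    (D.kk_meas.mul (hf.comp D.pt_meas)).stronglyMeasurable
  exact (StronglyMeasurable.integral_prod_right (ν := mb) this).measurable

/-- convergence -/
lemma P_tendsto {f : ℕ → ES N → ℝ} {g : ES N → ℝ} {b : ES N → ℝ} (hf : ∀ n, D.Lc (f n)) (hb : D.Lc b)
    {x : ES N} (hx : x ∈ D.Ω) (hle : ∀ n, ∀ y ∈ D.Ω, |f n y| ≤ b y)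
    (ht : ∀ y ∈ D.Ω, Tendsto (fun n => f n y) atTop (𝓝 (g y))) :
    Tendsto (fun n => D.P (f n) x) atTop (𝓝 (D.P g x)) := by
  refine tendsto_integral_of_dominated_convergence (fun p => D.kk x p * b (D.pt x p)) ?_ (P_integrable hb hx) ?_ ?_
  · intro n; exact (P_integrable (hf n) hx).aestronglyMeasurable
  · intro n
    filter_upwards [ae_mb] with p hp
    rw [norm_mul, Real.norm_eq_abs, Real.norm_eq_abs, abs_of_nonneg (D.kk_nonneg x p)]
    exact mul_le_mul_of_nonneg_left (hle n _ (D.cb_sub hx (D.pt_mem4 hp))) (D.kk_nonneg x p)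
  · filter_upwards [ae_mb] with p hp
    exact (ht _ (D.cb_sub hx (D.pt_mem4 hp))).const_mul _

end Dom
end

section
namespace Dom
variable {N : ℕ} {D : Dom N}

/-- weak inequality `Δ f ≤ V f - c`. -/
def Weak (D : Dom N) (f : ES N → ℝ) (c : ℝ) : Prop :=
  ∀ φ, IsTestFun D.Ω φ → (∀ x, 0 ≤ φ x) →
    ∫ x in D.Ω, f x * lap φ x ≤ ∫ x in D.Ω, (D.V x * f x - c) * φ x

def jj (D : Dom N) (f : ES N → ℝ) (c : ℝ) (x : ES N) (t : ℝ) : ℝ :=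
  ∫ ξ in closedBall (0 : ES N) 1, (D.k0 x (t, ξ) * f (D.pt x (t, ξ))
    + c * (D.rr x) ^ 2 * (t * (1 - t ^ 2)) * ph ξ)

def Psi (D : Dom N) (f : ES N → ℝ) (x : ES N) (t : ℝ) : ℝ := (1 - t ^ 2) * Mav f x (D.rr x * t)

lemma cb_rr {x : ES N} (hx : x ∈ D.Ω) : closedBall x (D.rr x) ⊆ D.Ω :=
  (closedBall_subset_closedBall (D.rr_le x)).trans (D.cb_sub hx)

lemma int_ball_bdd {F : ES N → ℝ} (hF : Measurable F) {B : ℝ} (hB : ∀ ξ ∈ closedBall (0 : ES N) 1, |F ξ| ≤ B) :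
    IntegrableOn F (closedBall (0 : ES N) 1) := by
  have : IsFiniteMeasure (volume.restrict (closedBall (0 : ES N) 1)) :=
    ⟨by simpa using measure_closedBall_lt_top⟩
  refine Integrable.of_bound (C := B) hF.aestronglyMeasurable ?_
  filter_upwards [ae_restrict_mem measurableSet_closedBall] with ξ hξ
  exact hB ξ hξ

lemma Psi_deriv {f : ES N → ℝ} {c : ℝ} (hm : Measurable f) (hf : ContinuousOn f D.Ω) (hw : D.Weak f c) {x : ES N} (hx : x ∈ D.Ω)
    {t : ℝ} (h0 : 0 < t) (h1 : t < 1) : ∃ D', HasDerivAt (D.Psi f x) D' t ∧ D' ≤ - D.jj f c x t := by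
  have hr := D.rr_pos hx
  obtain ⟨d1, hd1, hd1'⟩ := weak_M_deriv hf hw (cb_rr hx) (ρ := D.rr x * t) (by positivity) (by nlinarith)
  have e1 : HasDerivAt (fun t => Mav f x (D.rr x * t)) (d1 * D.rr x) t := by
    have h3 : HasDerivAt (fun t : ℝ => D.rr x * t) (D.rr x) t := by
      simpa using (hasDerivAt_id t).const_mul (D.rr x)
    exact hd1.comp t h3
  have e2 : HasDerivAt (fun t : ℝ => 1 - t ^ 2) (-(2 * t)) t := by
    have := (hasDerivAt_pow 2 t).const_sub 1
    simpa using this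
  refine ⟨_, e2.mul e1, ?_⟩
  set r := D.rr x with hrdef
  obtain ⟨B, hB⟩ := (isCompact_closedBall x r).exists_bound_of_continuousOn (hf.mono (cb_rr hx))
  have hpm : Measurable (fun ξ : ES N => x + (r * t) • ξ) := by fun_prop
  have hmem : ∀ ξ ∈ closedBall (0 : ES N) 1, x + (r * t) • ξ ∈ closedBall x r := fun ξ hξ =>
    mem_cb (by positivity) (by nlinarith) hξ
  obtain ⟨C, hC, hC'⟩ := et_bdd (N := N)
  have hB0 : 0 ≤ B := le_trans (norm_nonneg _) (hB x (mem_closedBall_self hr.le))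
  have i1 : IntegrableOn (fun ξ => f (x + (r * t) • ξ) * et ξ) (closedBall (0 : ES N) 1) := by
    refine int_ball_bdd ((hm.comp hpm).mul et_continuous.measurable) (B := B * C) ?_
    intro ξ hξ
    rw [abs_mul, abs_of_nonneg (et_nonneg ξ)]
    exact mul_le_mul (hB _ (hmem ξ hξ)) (hC' ξ) (et_nonneg _) hB0
  have i2 : IntegrableOn (fun ξ => (D.V (x + (r * t) • ξ) * f (x + (r * t) • ξ)) * ph ξ) (closedBall (0 : ES N) 1) := by
    refine int_ball_bdd (((D.hV.1.comp hpm).mul (hm.comp hpm)).mul ph_continuous.measurable) (B := (1 / r ^ 2) * B * C) ?_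
    intro ξ hξ
    have hy := hmem ξ hξ
    have hV0 := D.V_nonneg (cb_rr hx hy)
    have hV1 := D.V_bd hx (closedBall_subset_closedBall (D.rr_le x) hy)
    rw [abs_mul, abs_mul, abs_of_nonneg (ph_nonneg ξ)]
    refine mul_le_mul (mul_le_mul ?_ (hB _ hy) (abs_nonneg _) (by positivity)) ?_ (ph_nonneg _) (by positivity)
    · rw [abs_of_nonneg hV0, le_div_iff₀ (by positivity)]; linarith
    · have := ph_le ξ; have := hC' ξ; have := et_nonneg ξ; linarith
  have i3 : IntegrableOn (fun ξ : ES N => ph ξ) (closedBall (0 : ES N) 1) := ph_integrable.integrableOn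
  have e3 : ∫ ξ in closedBall (0 : ES N) 1, (D.V (x + (r * t) • ξ) * f (x + (r * t) • ξ) - c) * ph ξ
      = (∫ ξ in closedBall (0 : ES N) 1, (D.V (x + (r * t) • ξ) * f (x + (r * t) • ξ)) * ph ξ)
        - c * ∫ ξ in closedBall (0 : ES N) 1, ph ξ := by
    rw [← integral_const_mul, ← integral_sub i2 (i3.const_mul c)]
    congr 1; funext ξ; ring
  have e4 : D.jj f c x t = 2 * t * (∫ ξ in closedBall (0 : ES N) 1, f (x + (r * t) • ξ) * et ξ)
      - t * (1 - t ^ 2) * r ^ 2 * (∫ ξ in closedBall (0 : ES N) 1, (D.V (x + (r * t) • ξ) * f (x + (r * t) • ξ)) * ph ξ)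
      + c * r ^ 2 * (t * (1 - t ^ 2)) * ∫ ξ in closedBall (0 : ES N) 1, ph ξ := by
    unfold jj
    rw [← integral_const_mul, ← integral_const_mul, ← integral_const_mul,
      ← integral_sub (i1.const_mul _) (i2.const_mul _)]
    refine Eq.trans ?_ (integral_add ((i1.const_mul (2 * t)).sub (i2.const_mul (t * (1 - t ^ 2) * r ^ 2))) (i3.const_mul (c * r ^ 2 * (t * (1 - t ^ 2)))))
    congr 1; funext ξ
    simp only [k0, pt, ← hrdef, Pi.sub_apply]; ring
  rw [e4]
  rw [e3] at hd1'
  unfold Mav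
  have : 0 ≤ (1 - t ^ 2) * r := by
    have : 0 ≤ 1 - t ^ 2 := by nlinarith
    positivity
  have := mul_le_mul_of_nonneg_left hd1' this
  nlinarith

lemma Psi_cont {f : ES N → ℝ} (hf : ContinuousOn f D.Ω) {x : ES N} (hx : x ∈ D.Ω) :
    ContinuousOn (D.Psi f x) (Icc 0 1) := by
  unfold Psi
  refine ContinuousOn.mul (by fun_prop) ?_
  refine (Mav_contOn (hf.mono (cb_rr hx))).comp (by fun_prop) ?_
  intro t ht
  have := D.rr_nonneg x
  exact ⟨mul_nonneg this ht.1, by nlinarith [ht.2]⟩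

lemma k0_int {f : ES N → ℝ} (hf : D.Lc f) {x : ES N} (hx : x ∈ D.Ω) :
    Integrable (fun p => D.k0 x p * f (D.pt x p)) mb := by
  refine (P_integrable hf hx).congr ?_
  filter_upwards [ae_mb] with p hp
  rw [D.kk_eq hx hp]

lemma ph_int_ball : ∫ ξ in closedBall (0 : ES N) 1, ph ξ = cph N := by
  unfold cph
  apply setIntegral_eq_integral_of_forall_compl_eq_zero
  intro ξ hξ
  exact ph_zero (by simp at hξ; linarith)

/-- the key property of `P`. -/
lemma P_weak {f : ES N → ℝ} {c : ℝ} (hm : Measurable f) (hf : ContinuousOn f D.Ω) (hw : D.Weak f c)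
    {x : ES N} (hx : x ∈ D.Ω) : D.P f x + c * (D.rr x) ^ 2 * (cph N / 4) ≤ f x := by
  have hL : D.Lc f := Lc.of_contOn hm hf
  have hfin : IsFiniteMeasure (volume.restrict (closedBall (0 : ES N) 1)) :=
    ⟨by simpa using measure_closedBall_lt_top⟩
  have i1 := k0_int hL hx
  have i2 : Integrable (fun p : ℝ × ES N => c * (D.rr x) ^ 2 * (p.1 * (1 - p.1 ^ 2)) * ph p.2) mb := by
    unfold mb
    refine Integrable.mul_prod (f := fun t : ℝ => c * (D.rr x) ^ 2 * (t * (1 - t ^ 2))) (g := fun ξ : ES N => ph ξ) ?_ ?_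
    · have : Continuous (fun t : ℝ => c * (D.rr x) ^ 2 * (t * (1 - t ^ 2))) := by fun_prop
      exact this.integrableOn_Ioc
    · exact ph_integrable.integrableOn
  have i3 := i1.add i2
  have hF : ∫ p, (D.k0 x p * f (D.pt x p) + c * (D.rr x) ^ 2 * (p.1 * (1 - p.1 ^ 2)) * ph p.2) ∂mb
      = ∫ t in Ioc (0:ℝ) 1, D.jj f c x t := by
    unfold mb at i3 ⊢
    exact integral_prod _ i3
  have hj : IntegrableOn (D.jj f c x) (Ioc 0 1) := by
    unfold mb at i3
    exact i3.integral_prod_left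
  have hj' : IntegrableOn (fun t => - D.jj f c x t) (Icc 0 1) := ((integrableOn_Icc_iff_integrableOn_Ioc (by simp)).2 hj).neg
  choose! g hg hg' using fun t (ht : t ∈ Ioo (0:ℝ) 1) => Psi_deriv hm hf hw hx ht.1 ht.2
  have key := intervalIntegral.sub_le_integral_of_hasDeriv_right_of_le (g := D.Psi f x) (g' := g) (φ := fun t => - D.jj f c x t)
    (zero_le_one' ℝ) (Psi_cont hf hx) (fun t ht => (hg t ht).hasDerivWithinAt) hj' hg'
  rw [intervalIntegral.integral_of_le zero_le_one, integral_neg, ← hF, integral_add i1 i2] at key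
  have p0 : D.Psi f x 0 = f x := by simp [Psi, Mav_zero]
  have p1 : D.Psi f x 1 = 0 := by simp [Psi]
  have e1 : ∫ p, D.k0 x p * f (D.pt x p) ∂mb = D.P f x := by
    unfold P
    refine integral_congr_ae ?_
    filter_upwards [ae_mb] with p hp
    rw [D.kk_eq hx hp]
  have e2 : ∫ p : ℝ × ES N, c * (D.rr x) ^ 2 * (p.1 * (1 - p.1 ^ 2)) * ph p.2 ∂mb = c * (D.rr x) ^ 2 * (cph N / 4) := by
    unfold mb
    rw [integral_prod_mul (fun t : ℝ => c * (D.rr x) ^ 2 * (t * (1 - t ^ 2))) (fun ξ : ES N => ph ξ), ph_int_ball]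
    rw [integral_const_mul, ← intervalIntegral.integral_of_le zero_le_one]
    have : ∫ t in (0:ℝ)..1, t * (1 - t ^ 2) = 1 / 4 := by
      have : ∀ t ∈ uIcc (0:ℝ) 1, HasDerivAt (fun t : ℝ => t ^ 2 / 2 - t ^ 4 / 4) (t * (1 - t ^ 2)) t := by
        intro t _
        have := ((hasDerivAt_pow 2 t).div_const 2).sub ((hasDerivAt_pow 4 t).div_const 4)
        refine this.congr_deriv ?_
        norm_num; ring
      rw [intervalIntegral.integral_eq_sub_of_hasDerivAt this (by apply Continuous.intervalIntegrable; fun_prop)]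
      norm_num
    rw [this]; ring
  rw [e1, e2, p0, p1] at key
  linarith

lemma Weak.of_super {s : ES N → ℝ} (hs : LVSuperharmonic D.Ω D.V s) : D.Weak s 0 := by
  intro φ h1 h2
  simpa using hs.2.2.2 φ h1 h2
lemma Weak.of_harm {s : ES N → ℝ} (hs : LVHarmonic D.Ω D.V s) : D.Weak s 0 := by
  intro φ h1 h2
  simpa using (hs.2.2.2 φ h1).le
lemma Weak.of_harm_neg {s : ES N → ℝ} (hs : LVHarmonic D.Ω D.V s) : D.Weak (fun x => - s x) 0 := by
  intro φ h1 h2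
  have := (hs.2.2.2 φ h1).ge
  simp only [sub_zero, neg_mul, mul_neg, integral_neg]
  linarith

lemma P_harm {s : ES N → ℝ} (hm : Measurable s) (hs : LVHarmonic D.Ω D.V s) {x : ES N} (hx : x ∈ D.Ω) :
    D.P s x = s x := by
  have h1 := P_weak hm hs.1 (Weak.of_harm hs) hx
  have h2 := P_weak hm.neg hs.1.neg (Weak.of_harm_neg hs) hx
  have h3 := P_neg (D := D) (f := s) (x := x)
  simp only [Pi.neg_def] at h2
  rw [h3] at h2
  linarith

/-- upper and lower mean value inequalities. -/
lemma mean_lower {f : ES N → ℝ} (hm : Measurable f) (hs : LVHarmonic D.Ω D.V f) (h0 : ∀ x ∈ D.Ω, 0 ≤ f x)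
    {x : ES N} (hx : x ∈ D.Ω) {t : ℝ} (ht : t ∈ Icc (0:ℝ) 1) : (1 - t ^ 2) * Mav f x (D.rr x * t) ≤ f x := by
  have hA : AntitoneOn (D.Psi f x) (Icc 0 1) := by
    refine antitoneOn_of_deriv_nonpos (convex_Icc 0 1) (Psi_cont hs.1 hx) ?_ ?_
    · intro t ht
      rw [interior_Icc] at ht
      obtain ⟨d, hd, _⟩ := Psi_deriv hm hs.1 (Weak.of_harm hs) hx ht.1 ht.2
      exact hd.differentiableAt.differentiableWithinAt
    · intro t ht
      rw [interior_Icc] at ht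
      obtain ⟨d, hd, hd'⟩ := Psi_deriv hm hs.1 (Weak.of_harm hs) hx ht.1 ht.2
      rw [hd.deriv]
      refine hd'.trans ?_
      rw [neg_nonpos]
      unfold jj
      refine setIntegral_nonneg measurableSet_closedBall ?_
      intro ξ hξ
      have hp : (t, ξ) ∈ Ioc (0:ℝ) 1 ×ˢ closedBall (0 : ES N) 1 := ⟨⟨ht.1, ht.2.le⟩, hξ⟩
      have h1 : 0 ≤ t * et ξ := mul_nonneg ht.1.le (et_nonneg _)
      have h2 := D.k0_lower hx hp
      simp only [zero_mul, add_zero]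
      exact mul_nonneg (h1.trans h2) (h0 _ (D.cb_sub hx (D.pt_mem4 hp)))
  have := hA (left_mem_Icc.2 zero_le_one) ht ht.1
  have p0 : D.Psi f x 0 = f x := by simp [Psi, Mav_zero]
  rw [p0] at this
  exact this

lemma mean_upper {f : ES N → ℝ} (hs : LVHarmonic D.Ω D.V f) (h0 : ∀ x ∈ D.Ω, 0 ≤ f x)
    {x : ES N} (hx : x ∈ D.Ω) {ρ : ℝ} (hρ : ρ ∈ Icc (0:ℝ) (D.rr x)) : f x ≤ Mav f x ρ := by
  have hA : AntitoneOn (Mav (fun y => - f y) x) (Icc 0 (D.rr x)) := by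
    refine antitoneOn_of_deriv_nonpos (convex_Icc 0 _) (Mav_contOn (hs.1.neg.mono (cb_rr hx))) ?_ ?_
    · intro t ht
      rw [interior_Icc] at ht
      obtain ⟨d, hd, _⟩ := weak_M_deriv hs.1.neg (Weak.of_harm_neg hs) (cb_rr hx) ht.1 ht.2
      exact hd.differentiableAt.differentiableWithinAt
    · intro t ht
      rw [interior_Icc] at ht
      obtain ⟨d, hd, hd'⟩ := weak_M_deriv hs.1.neg (Weak.of_harm_neg hs) (cb_rr hx) ht.1 ht.2
      rw [show (fun y => - f y) = -f from rfl, hd.deriv]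
      refine hd'.trans ?_
      refine mul_nonpos_of_nonneg_of_nonpos ht.1.le ?_
      refine setIntegral_nonpos measurableSet_closedBall ?_
      intro ξ hξ
      have hy := cb_rr hx (mem_cb (x := x) ht.1.le ht.2.le hξ)
      have h1 := mul_nonneg (mul_nonneg (D.V_nonneg hy) (h0 _ hy)) (ph_nonneg ξ)
      simp only [sub_zero, mul_neg, neg_mul]
      linarith
  have := hA (left_mem_Icc.2 (D.rr_nonneg x)) hρ hρ.1
  rw [Mav_zero] at this
  have e : Mav (fun y => - f y) x ρ = - Mav f x ρ := by
    unfold Mav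
    simp only [neg_mul, integral_neg]
  rw [e] at this
  linarith

end Dom
end

section
namespace Dom
variable {N : ℕ} {D : Dom N}

lemma P_lower {σ : ℝ} (hσ : 0 < σ) : ∃ c > 0, ∀ f : ES N → ℝ, D.Lc f → ∀ x ∈ D.Ω, ∀ x' : ES N, dist x' x ≤ D.rr x / 2 →
    ∀ b : ℝ, 0 ≤ b → (∀ y ∈ closedBall x (D.d x / 4), 0 ≤ f y) → (∀ y ∈ ball x' (σ * D.d x), b ≤ f y) →
    c * b ≤ D.P f x := by
  set τ := min (1/4) σ with hτ
  have hτ0 : 0 < τ := by positivity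
  have hτ1 : τ ≤ 1/4 := min_le_left _ _
  have hτ2 : τ ≤ σ := min_le_right _ _
  have hv : 0 < volume.real (ball (0 : ES N) τ) := by
    rw [Measure.real, ENNReal.toReal_pos_iff]
    exact ⟨measure_ball_pos _ _ hτ0, measure_ball_lt_top⟩
  refine ⟨(3/4) * cet N * (τ * volume.real (ball (0 : ES N) τ)), by have := cet_pos (N := N); positivity, ?_⟩
  intro f hf x hx x' hx' b hb h0 hfb
  have hr := D.rr_pos hx
  have hd := D.d_pos hx
  set ξ0 : ES N := (D.rr x)⁻¹ • (x' - x) with hξ0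
  have hξ0n : ‖ξ0‖ ≤ 1/2 := by
    rw [hξ0, norm_smul, norm_inv, Real.norm_eq_abs, abs_of_pos hr, ← dist_eq_norm, inv_mul_le_iff₀ hr]; linarith
  set S : Set (ℝ × ES N) := Ioc (1 - τ) 1 ×ˢ ball ξ0 τ with hS
  have hSm : MeasurableSet S := measurableSet_Ioc.prod measurableSet_ball
  have hSsub : S ⊆ Ioc (0:ℝ) 1 ×ˢ closedBall (0 : ES N) 1 := by
    rintro ⟨t, ξ⟩ ⟨h1, h2⟩
    refine ⟨⟨by linarith [h1.1], h1.2⟩, ?_⟩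
    simp only [mem_ball, mem_closedBall, dist_zero_right] at h2 ⊢
    have := norm_le_norm_add_norm_sub' ξ ξ0
    rw [dist_eq_norm] at h2; linarith
  have hSv : (mb : Measure (ℝ × ES N)).real S = τ * volume.real (ball (0 : ES N) τ) := by
    unfold mb
    rw [Measure.prod_restrict, Measure.real, Measure.restrict_eq_self _ hSsub, hS, Measure.prod_prod,
      ENNReal.toReal_mul, Real.volume_Ioc]
    congr 1
    · rw [ENNReal.toReal_ofReal (by linarith)]; ring
    · rw [Measure.real, Measure.addHaar_ball_center]
  have hle : ∀ᵐ p ∂(mb : Measure (ℝ × ES N)), S.indicator (fun _ => (3/4) * cet N * b) p ≤ D.kk x p * f (D.pt x p) := by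
    filter_upwards [ae_mb] with p hp
    by_cases hpS : p ∈ S
    · rw [indicator_of_mem hpS, D.kk_eq hx hp]
      obtain ⟨h1, h2⟩ := hpS
      have h2' := h2
      rw [mem_ball, dist_eq_norm] at h2
      have h3 : ‖p.2‖ ≤ 3/4 := by
        have := norm_le_norm_add_norm_sub' p.2 ξ0
        linarith
      have h4 := et_lower h3
      have h5 := D.k0_lower hx hp
      have h6 : b ≤ f (D.pt x p) := by
        apply hfb
        rw [mem_ball, dist_eq_norm]
        have e : D.pt x p - x' = D.rr x • (p.1 • p.2 - ξ0) := by
          rw [hξ0, smul_sub, smul_smul, smul_smul, mul_inv_cancel₀ hr.ne', one_smul]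
          unfold pt; abel
        rw [e, norm_smul, Real.norm_eq_abs, abs_of_pos hr]
        have e2 : p.1 • p.2 - ξ0 = (p.2 - ξ0) - (1 - p.1) • p.2 := by
          rw [sub_smul, one_smul]; abel
        have e3 : ‖p.1 • p.2 - ξ0‖ ≤ 2 * τ := by
          rw [e2]
          refine (norm_sub_le _ _).trans ?_
          rw [norm_smul, Real.norm_eq_abs, abs_of_nonneg (by linarith [h1.2])]
          nlinarith [norm_nonneg p.2, h1.1, h1.2]
        have := D.rr_le x
        calc D.rr x * ‖p.1 • p.2 - ξ0‖ ≤ (D.d x / 4) * (2 * τ) := by gcongr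
          _ < σ * D.d x := by nlinarith
      have h7 : (3/4) * cet N ≤ D.k0 x p := by
        refine le_trans ?_ h5
        have := cet_pos (N := N)
        have : 3/4 ≤ p.1 := by linarith [h1.1]
        gcongr
      have := cet_pos (N := N)
      exact mul_le_mul h7 h6 hb (by linarith)
    · rw [indicator_of_notMem hpS]
      exact mul_nonneg (D.kk_nonneg x p) (h0 _ (D.pt_mem4 hp))
  have := integral_mono_ae ((integrable_const _).indicator hSm) (P_integrable hf hx) hle
  rw [integral_indicator_const _ hSm, hSv, smul_eq_mul] at this
  refine le_trans (le_of_eq ?_) this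
  ring

/-! Harnack -/
lemma teta_cmp : ∃ K > 0, ∀ (x x' y : ES N) (ρ : ℝ), 0 < ρ → dist x x' ≤ ρ →
    teta ρ x y ≤ teta ρ x' y + K * (dist x x' / ρ) * teta (4 * ρ) x' y := by
  obtain ⟨L, hL⟩ := et_lipschitz (N := N)
  refine ⟨4 ^ N * (L + 1) / cet N, by have := cet_pos (N := N); positivity, ?_⟩
  intro x x' y ρ hρ hd
  have hc := cet_pos (N := N)
  have t0 : ∀ ρ : ℝ, 0 < ρ → ∀ x y : ES N, 0 ≤ teta ρ x y := by
    intro ρ hρ x y; unfold teta; have := et_nonneg (ρ⁻¹ • (y - x)); positivity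
  by_cases hy : dist y x' ≤ 2 * ρ
  · have h1 : et (ρ⁻¹ • (y - x)) ≤ et (ρ⁻¹ • (y - x')) + (L + 1) * (dist x x' / ρ) := by
      have h2 := hL.dist_le_mul (ρ⁻¹ • (y - x)) (ρ⁻¹ • (y - x'))
      have h3 : dist (ρ⁻¹ • (y - x)) (ρ⁻¹ • (y - x')) = dist x x' / ρ := by
        rw [dist_smul₀, dist_sub_left, norm_inv, Real.norm_eq_abs, abs_of_pos hρ]; ring
      rw [h3, Real.dist_eq] at h2
      have h4 := (abs_le.1 h2).2
      have : 0 ≤ dist x x' / ρ := by positivity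
      nlinarith
    have h5 : cet N ≤ et ((4 * ρ)⁻¹ • (y - x')) := by
      apply et_lower
      rw [norm_smul, norm_inv, Real.norm_eq_abs, abs_of_pos (by positivity), ← dist_eq_norm, inv_mul_le_iff₀ (by positivity)]
      linarith
    unfold teta
    have e1 : ((4 * ρ) ^ N)⁻¹ = (4 ^ N)⁻¹ * (ρ ^ N)⁻¹ := by rw [mul_pow, mul_inv]
    rw [e1]
    have e2 : 4 ^ N * (L + 1) / cet N * (dist x x' / ρ) * ((4 ^ N)⁻¹ * (ρ ^ N)⁻¹ * et ((4 * ρ)⁻¹ • (y - x')))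
       = (ρ ^ N)⁻¹ * ((L + 1) * (dist x x' / ρ) * (et ((4 * ρ)⁻¹ • (y - x')) / cet N)) := by
      field_simp
    rw [e2, ← mul_add]
    refine mul_le_mul_of_nonneg_left ?_ (by positivity)
    refine h1.trans ?_
    have : 1 ≤ et ((4 * ρ)⁻¹ • (y - x')) / cet N := (one_le_div hc).2 h5
    have h6 : 0 ≤ (L + 1) * (dist x x' / ρ) := by positivity
    have := le_mul_of_one_le_right h6 this
    linarith
  · rw [teta_zero hρ (x := x) (y := y)]
    · have := t0 ρ hρ x' y
      have := t0 (4 * ρ) (by positivity) x' y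
      have := cet_pos (N := N)
      positivity
    · have := dist_triangle y x x'
      linarith

lemma teta_nonneg {ρ : ℝ} (hρ : 0 < ρ) (x y : ES N) : 0 ≤ teta ρ x y := by
  unfold teta; have := et_nonneg (ρ⁻¹ • (y - x)); positivity

lemma teta_int {f : ES N → ℝ} (hm : Measurable f) {x : ES N} {ρ : ℝ} (hρ : 0 < ρ)
    (hf : ContinuousOn f (closedBall x ρ)) : Integrable (fun y => f y * teta ρ x y) := by
  obtain ⟨F, hF, hFf⟩ := tietze isClosed_closedBall hf
  have e : (fun y => f y * teta ρ x y) = fun y => F y * teta ρ x y := by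
    funext y
    by_cases hy : y ∈ closedBall x ρ
    · rw [hFf y hy]
    · rw [teta_zero hρ (by simpa using hy)]; simp
  rw [e]
  refine Continuous.integrable_of_hasCompactSupport ?_ ?_
  · unfold teta
    have := et_continuous (N := N)
    fun_prop
  · refine HasCompactSupport.intro (isCompact_closedBall x ρ) ?_
    intro y hy
    rw [teta_zero hρ (by simpa using hy)]; simp

set_option maxHeartbeats 1000000 in
lemma HP : ∀ ε > 0, ∃ σ > 0, ∀ f : ES N → ℝ, Measurable f → LVHarmonic D.Ω D.V f → (∀ x ∈ D.Ω, 0 ≤ f x) →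
    ∀ x ∈ D.Ω, ∀ x' : ES N, dist x x' ≤ σ * D.d x → f x ≤ (1 + ε) * f x' := by
  intro ε hε
  obtain ⟨K, hK, hcmp⟩ := teta_cmp (N := N)
  set τ := min (1/16) (ε / 16) with hτ
  have hτ0 : 0 < τ := by positivity
  have hτ1 : τ ≤ 1/16 := min_le_left _ _
  have hτ2 : τ ≤ ε / 16 := min_le_right _ _
  have hl := D.lam_pos
  have hl4 := D.lam_lt
  set σ := min (τ * D.lam) (τ * D.lam * ε / (4 * K)) with hσ
  have hσ0 : 0 < σ := by positivity
  have hσ1 : σ ≤ τ * D.lam := min_le_left _ _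
  have hσ2 : σ * (4 * K) ≤ τ * D.lam * ε := by
    rw [← le_div_iff₀ (by positivity)]; exact min_le_right _ _
  refine ⟨σ, hσ0, ?_⟩
  intro f hm hf h0 x hx x' hxx
  have hd := D.d_pos hx
  have hdx' : D.d x / 2 ≤ D.d x' := by
    have := D.d_lip x x'
    have : σ ≤ 1/2 := by nlinarith
    nlinarith
  have hx' : x' ∈ D.Ω := D.mem_of_pos (by linarith)
  set ρ := τ * D.rr x with hρ
  have hr := D.rr_pos hx
  have hr' := D.rr_pos hx'
  have hρ0 : 0 < ρ := by positivity
  have hrr' : D.rr x ≤ 2 * D.rr x' := by unfold rr; nlinarith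
  have hdρ : dist x x' ≤ ρ := by
    refine hxx.trans ?_
    rw [hρ]; unfold rr; nlinarith
  have hdρ2 : dist x x' / ρ ≤ ε / (4 * K) := by
    rw [div_le_div_iff₀ hρ0 (by positivity)]
    calc dist x x' * (4 * K) ≤ (σ * D.d x) * (4 * K) := by gcongr
      _ = (σ * (4 * K)) * D.d x := by ring
      _ ≤ (τ * D.lam * ε) * D.d x := by gcongr
      _ = ε * ρ := by rw [hρ]; unfold rr; ring
  have m1 := mean_upper hf h0 hx (ρ := ρ) ⟨hρ0.le, by nlinarith⟩
  have mlow : ∀ s : ℝ, 0 < s → s ≤ 4 * ρ → Mav f x' s ≤ (1 + 8 * τ) * f x' := by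
    intro s hs0 hs1
    have ht : s = D.rr x' * (s / D.rr x') := by field_simp
    have ht1 : s / D.rr x' ≤ 8 * τ := by
      rw [div_le_iff₀ hr']; nlinarith
    have ht0 : 0 ≤ s / D.rr x' := by positivity
    have := mean_lower hm hf h0 hx' (t := s / D.rr x') ⟨ht0, by linarith⟩
    rw [← ht] at this
    have hq : (s / D.rr x') ^ 2 ≤ 4 * τ := by nlinarith
    have hM : 0 ≤ Mav f x' s := by
      refine setIntegral_nonneg measurableSet_closedBall ?_
      intro ξ hξ
      refine mul_nonneg (h0 _ (cb_rr hx' (mem_cb hs0.le ?_ hξ))) (et_nonneg _)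
      nlinarith
    have hf0 := h0 x' hx'
    have h5 : (1 - 4 * τ) * Mav f x' s ≤ f x' := by nlinarith
    have h6 : 1 ≤ (1 + 8 * τ) * (1 - 4 * τ) := by nlinarith
    calc Mav f x' s ≤ ((1 + 8 * τ) * (1 - 4 * τ)) * Mav f x' s := le_mul_of_one_le_left hM h6
      _ = (1 + 8 * τ) * ((1 - 4 * τ) * Mav f x' s) := by ring
      _ ≤ (1 + 8 * τ) * f x' := by gcongr
  have m2 := mlow ρ hρ0 (by linarith)
  have m3 := mlow (4 * ρ) (by linarith) le_rfl
  have hsub : closedBall x ρ ⊆ D.Ω := (closedBall_subset_closedBall (by nlinarith)).trans (cb_rr hx)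
  have hsub4 : closedBall x' (4*ρ) ⊆ D.Ω := (closedBall_subset_closedBall (by nlinarith)).trans (cb_rr hx')
  have hsub1 : closedBall x' ρ ⊆ D.Ω := (closedBall_subset_closedBall (by linarith)).trans hsub4
  have i1 := teta_int hm hρ0 (hf.1.mono hsub)
  have i2 := teta_int hm hρ0 (hf.1.mono hsub1)
  have i3 := teta_int hm (by linarith : 0 < 4 * ρ) (hf.1.mono hsub4)
  have m4 : Mav f x ρ ≤ Mav f x' ρ + K * (dist x x' / ρ) * Mav f x' (4 * ρ) := by
    rw [Mav_eq f x hρ0, Mav_eq f x' hρ0, Mav_eq f x' (by linarith : 0 < 4 * ρ), ← integral_const_mul, ← integral_add i2 (i3.const_mul _)]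
    refine integral_mono i1 (i2.add (i3.const_mul _)) ?_
    intro y
    simp only [Pi.add_apply]
    by_cases hy : y ∈ D.Ω
    · have := mul_le_mul_of_nonneg_left (hcmp x x' y ρ hρ0 hdρ) (h0 y hy)
      linarith
    · rw [teta_zero hρ0 (x := x), teta_zero hρ0 (x := x'), teta_zero (by linarith : 0 < 4 * ρ) (x := x')]
      · simp
      · by_contra h; exact hy (hsub4 (by simpa using h))
      · by_contra h; exact hy (hsub1 (by simpa using h))
      · by_contra h; exact hy (hsub (by simpa using h))
  have hf0 := h0 x' hx'
  have h7 : K * (dist x x' / ρ) ≤ ε / 4 := by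
    calc K * (dist x x' / ρ) ≤ K * (ε / (4 * K)) := by gcongr
      _ = ε / 4 := by field_simp
  have h8 : 0 ≤ K * (dist x x' / ρ) := by positivity
  have h9 : K * (dist x x' / ρ) * Mav f x' (4 * ρ) ≤ ε / 4 * (2 * f x') := by
    refine mul_le_mul h7 (m3.trans ?_) ?_ (by positivity)
    · nlinarith
    · refine setIntegral_nonneg measurableSet_closedBall ?_
      intro ξ hξ
      exact mul_nonneg (h0 _ (hsub4 (mem_cb (by linarith) le_rfl hξ))) (et_nonneg _)
  have : (1 + 8 * τ) * f x' ≤ (1 + ε / 2) * f x' := by gcongr; linarith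
  linarith
end Dom
end

section
lemma cd_dir {N : ℕ} {f : ES N → ℝ} (hf : ContDiff ℝ (⊤ : ℕ∞) f) (v : ES N) :
    ContDiff ℝ (⊤ : ℕ∞) (fun x => fderiv ℝ f x v) :=
  (hf.fderiv_right (m := (⊤ : ℕ∞)) (by simp)).clm_apply contDiff_const

lemma ibp1 {N : ℕ} {f φ : ES N → ℝ} (hf : ContDiff ℝ (⊤ : ℕ∞) f) (hφ : ContDiff ℝ (⊤ : ℕ∞) φ)
    (hc : HasCompactSupport φ) (v : ES N) :
    ∫ x, f x * fderiv ℝ φ x v = - ∫ x, fderiv ℝ f x v * φ x := by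
  apply integral_mul_fderiv_eq_neg_fderiv_mul_of_integrable
  · exact ((cd_dir hf v).continuous.mul hφ.continuous).integrable_of_hasCompactSupport hc.mul_left
  · exact (hf.continuous.mul (cd_dir hφ v).continuous).integrable_of_hasCompactSupport (hc.fderiv_apply ℝ v).mul_left
  · exact (hf.continuous.mul hφ.continuous).integrable_of_hasCompactSupport hc.mul_left
  · intro x _; exact hf.differentiable (by simp) x
  · intro x _; exact hφ.differentiable (by simp) x

lemma lap_cont {N : ℕ} {f : ES N → ℝ} (hf : ContDiff ℝ (⊤ : ℕ∞) f) : Continuous (lap f) := by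
  unfold lap
  exact continuous_finsetSum _ fun i _ => (cd_dir (cd_dir hf _) _).continuous

lemma lap_zero_off {N : ℕ} {φ : ES N → ℝ} {x : ES N} (hx : x ∉ tsupport φ) : lap φ x = 0 := by
  unfold lap
  refine Finset.sum_eq_zero fun i _ => ?_
  by_contra h
  apply hx
  apply tsupport_fderiv_apply_subset ℝ (EuclideanSpace.single i (1:ℝ))
  apply tsupport_fderiv_apply_subset ℝ (EuclideanSpace.single i (1:ℝ))
  exact subset_tsupport _ h

lemma ibp {N : ℕ} {f φ : ES N → ℝ} (hf : ContDiff ℝ (⊤ : ℕ∞) f) (hφ : ContDiff ℝ (⊤ : ℕ∞) φ)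
    (hc : HasCompactSupport φ) : ∫ x, f x * lap φ x = ∫ x, lap f x * φ x := by
  unfold lap
  simp only [Finset.mul_sum, Finset.sum_mul]
  rw [integral_finsetSum, integral_finsetSum]
  · refine Finset.sum_congr rfl fun i _ => ?_
    rw [ibp1 hf (cd_dir hφ _) (hc.fderiv_apply ℝ _), ibp1 (cd_dir hf _) hφ hc]
    have h := ibp1 (cd_dir hf (EuclideanSpace.single i 1)) hφ hc (EuclideanSpace.single i 1)
    simp [h]
  · intro i _
    exact ((cd_dir (cd_dir hf _) _).continuous.mul hφ.continuous).integrable_of_hasCompactSupport hc.mul_left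
  · intro i _
    exact (hf.continuous.mul (cd_dir (cd_dir hφ _) _).continuous).integrable_of_hasCompactSupport
      ((hc.fderiv_apply ℝ _).fderiv_apply ℝ _).mul_left

namespace Dom
variable {N : ℕ} {D : Dom N}

lemma V_bdd_compact {C : Set (ES N)} (hC : IsCompact C) (hCΩ : C ⊆ D.Ω) : ∃ B, ∀ x ∈ C, |D.V x| ≤ B := by
  rcases C.eq_empty_or_nonempty with rfl | hne
  · exact ⟨0, by simp⟩
  obtain ⟨x0, h0, hmin⟩ := hC.exists_isMinOn hne D.d_cont.continuousOn
  have hd := D.d_pos (hCΩ h0)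
  refine ⟨D.a / D.d x0 ^ 2, fun x hx => ?_⟩
  have h1 := D.hV.2 x (hCΩ hx)
  rw [abs_of_nonneg h1.1, le_div_iff₀ (by positivity)]
  refine le_trans ?_ h1.2
  have : D.d x0 ≤ D.d x := hmin hx
  exact mul_le_mul_of_nonneg_left (pow_le_pow_left₀ hd.le this 2) h1.1

lemma Weak_of_smooth {f : ES N → ℝ} {c : ℝ} (hf : ContDiff ℝ (⊤ : ℕ∞) f) (h0 : ∀ x ∈ D.Ω, 0 ≤ f x)
    (hl : ∀ x ∈ D.Ω, lap f x ≤ -c) : D.Weak f c := by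
  intro φ hφ hφ0
  have hz : ∀ x, x ∉ D.Ω → φ x = 0 := fun x hx => by
    by_contra h; exact hx (hφ.2.2 (subset_tsupport _ h))
  have hz' : ∀ x, x ∉ D.Ω → lap φ x = 0 := fun x hx => lap_zero_off fun h => hx (hφ.2.2 h)
  have e1 : ∫ x in D.Ω, f x * lap φ x = ∫ x in D.Ω, lap f x * φ x := by
    rw [setIntegral_eq_integral_of_forall_compl_eq_zero, setIntegral_eq_integral_of_forall_compl_eq_zero,
      ibp hf hφ.1 hφ.2.1]
    · intro x hx; rw [hz x hx, mul_zero]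
    · intro x hx; rw [hz' x hx, mul_zero]
  rw [e1]
  have hi : Integrable (fun x => lap f x * φ x) :=
    ((lap_cont hf).mul hφ.1.continuous).integrable_of_hasCompactSupport (HasCompactSupport.mul_left hφ.2.1)
  have hi2 : Integrable (fun x => (D.V x * f x - c) * φ x) := by
    obtain ⟨B, hB⟩ := V_bdd_compact hφ.2.1 hφ.2.2
    have i1 : Integrable (fun x => f x * φ x) := 
      (hf.continuous.mul hφ.1.continuous).integrable_of_hasCompactSupport (HasCompactSupport.mul_left hφ.2.1)
    have i2 : Integrable (fun x => c * φ x) := 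
      (continuous_const.mul hφ.1.continuous).integrable_of_hasCompactSupport (HasCompactSupport.mul_left hφ.2.1)
    have i3 : Integrable (fun x => D.V x * (f x * φ x)) := by
      refine (i1.norm.const_mul B).mono' (D.hV.1.mul (hf.continuous.mul hφ.1.continuous).measurable).aestronglyMeasurable ?_
      refine ae_of_all _ fun x => ?_
      by_cases hx : x ∈ tsupport φ
      · rw [norm_mul]; exact mul_le_mul_of_nonneg_right (hB x hx) (norm_nonneg _)
      · rw [image_eq_zero_of_notMem_tsupport hx]; simp
    refine (i3.sub i2).congr (ae_of_all _ fun x => ?_)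
    simp only [Pi.sub_apply]; ring
  refine setIntegral_mono_on hi.integrableOn hi2.integrableOn D.isOpen.measurableSet fun x hx => ?_
  refine mul_le_mul_of_nonneg_right ?_ (hφ0 x)
  have := mul_nonneg (D.V_nonneg hx) (h0 x hx)
  linarith [hl x hx]

lemma P_smooth {f : ES N → ℝ} {c : ℝ} (hf : ContDiff ℝ (⊤ : ℕ∞) f) (h0 : ∀ x ∈ D.Ω, 0 ≤ f x)
    (hl : ∀ x ∈ D.Ω, lap f x ≤ -c) {x : ES N} (hx : x ∈ D.Ω) :
    D.P f x + c * (D.rr x) ^ 2 * (cph N / 4) ≤ f x :=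
  P_weak hf.continuous.measurable hf.continuous.continuousOn (Weak_of_smooth hf h0 hl) hx

lemma P_one {x : ES N} (hx : x ∈ D.Ω) : D.P (fun _ => 1) x ≤ 1 := by
  have := P_smooth (D := D) (f := fun _ => 1) (c := 0) contDiff_const (by simp) (by intro x _; simp [lap]) hx
  linarith

lemma P_const {x : ES N} (hx : x ∈ D.Ω) {c : ℝ} (hc : 0 ≤ c) : D.P (fun _ => c) x ≤ c := by
  have := P_const_mul (D := D) (f := fun _ => 1) (x := x) c
  have h1 := P_one hx
  simp only [mul_one] at this
  rw [this]; nlinarith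

/-- a function that is strictly superharmonic, between positive bounds. -/
lemma P_strict : ∃ (e : ES N → ℝ) (c : ℝ) (E : ℝ), 0 < c ∧ Continuous e ∧ (∀ x ∈ D.Ω, 1 ≤ e x ∧ e x ≤ E) ∧
    ∀ x ∈ D.Ω, D.P e x + c * D.d x ^ 2 ≤ e x := by
  obtain ⟨R, hR⟩ := D.hbd.subset_closedBall (0 : ES N)
  have hR' : ∀ x ∈ D.Ω, ‖x‖ ^ 2 ≤ R ^ 2 := fun x hx => by
    have := hR hx
    rw [mem_closedBall, dist_zero_right] at this
    exact pow_le_pow_left₀ (norm_nonneg _) this 2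
  have hs : ContDiff ℝ (⊤ : ℕ∞) (fun x : ES N => (R ^ 2 + 1) - ‖x - 0‖ ^ 2) :=
    contDiff_const.sub ((contDiff_id.sub contDiff_const).norm_sq ℝ)
  have hb : ∀ x ∈ D.Ω, 1 ≤ (R ^ 2 + 1) - ‖x - 0‖ ^ 2 := fun x hx => by
    rw [sub_zero]; linarith [hR' x hx]
  have hN : (0:ℝ) < N := by have := D.hN; positivity
  refine ⟨fun x => (R ^ 2 + 1) - ‖x - 0‖ ^ 2, 2 * N * D.lam ^ 2 * (cph N / 4), R ^ 2 + 1, ?_, hs.continuous, ?_, ?_⟩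
  · have := D.lam_pos; have := cph_pos (N := N); positivity
  · intro x hx; exact ⟨hb x hx, by have := sq_nonneg ‖x - 0‖; linarith⟩
  · intro x hx
    have := P_smooth (D := D) (c := 2 * N) hs (fun x hx => by linarith [hb x hx]) (fun x hx => ?_) hx
    · refine le_trans (le_of_eq ?_) this
      unfold rr; ring
    · rw [lap_radial (fun s => (R ^ 2 + 1) - s) (fun _ => -1) (fun _ => 0)]
      · simp
      · intro s; simpa using (hasDerivAt_id s).const_sub (R ^ 2 + 1)
      · intro s; exact hasDerivAt_const _ _

/-- barrier -/
lemma P_barrier (z0 : ES N) {α c : ℝ} (hα : 0 < α) (hc : 0 ≤ c) (hαc : N ≤ 2 * α * c ^ 2)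
    (hz : ∀ x ∈ D.Ω, c ≤ dist x z0) {x : ES N} (hx : x ∈ D.Ω) :
    D.P (fun x => 1 - Real.exp (- α * (‖x - z0‖ ^ 2 - c ^ 2))) x ≤ 1 - Real.exp (- α * (‖x - z0‖ ^ 2 - c ^ 2)) := by
  have hs : ContDiff ℝ (⊤ : ℕ∞) (fun x : ES N => 1 - Real.exp (- α * (‖x - z0‖ ^ 2 - c ^ 2))) :=
    contDiff_const.sub (Real.contDiff_exp.comp (contDiff_const.mul (((contDiff_id.sub contDiff_const).norm_sq ℝ).sub contDiff_const)))
  have hz' : ∀ x ∈ D.Ω, c ^ 2 ≤ ‖x - z0‖ ^ 2 := fun x hx => by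
    have := hz x hx
    rw [dist_eq_norm] at this
    exact pow_le_pow_left₀ hc this 2
  have := P_smooth (D := D) (c := 0) hs (fun x hx => ?_) (fun x hx => ?_) hx
  · linarith
  · have : Real.exp (- α * (‖x - z0‖ ^ 2 - c ^ 2)) ≤ 1 := by
      rw [Real.exp_le_one_iff]; nlinarith [hz' x hx]
    linarith
  · rw [lap_radial (fun s => 1 - Real.exp (- α * (s - c ^ 2))) (fun s => α * Real.exp (- α * (s - c ^ 2)))
      (fun s => - α ^ 2 * Real.exp (- α * (s - c ^ 2)))]
    · have h1 := Real.exp_pos (- α * (‖x - z0‖ ^ 2 - c ^ 2))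
      set w := Real.exp (- α * (‖x - z0‖ ^ 2 - c ^ 2))
      have h2 : (N:ℝ) ≤ 2 * α * ‖x - z0‖ ^ 2 := hαc.trans (by have := hz' x hx; gcongr)
      have : 4 * ‖x - z0‖ ^ 2 * (-α ^ 2 * w) + 2 * N * (α * w) = 2 * α * w * (N - 2 * α * ‖x - z0‖ ^ 2) := by ring
      rw [this, neg_zero]
      exact mul_nonpos_of_nonneg_of_nonpos (by positivity) (by linarith)
    · intro s
      have h := (((hasDerivAt_id s).sub_const (c ^ 2)).const_mul (-α)).exp.const_sub 1
      exact h.congr_deriv (by simp; ring)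
    · intro s
      have h := (((hasDerivAt_id s).sub_const (c ^ 2)).const_mul (-α)).exp.const_mul α
      exact h.congr_deriv (by simp; ring)
end Dom
end

section
namespace Dom
variable {N : ℕ} {D : Dom N}

/-- uniform vanishing at the boundary of the positive part of `F`, inside `S` -/
def UVan (D : Dom N) (F : ES N → ℝ) (S : Set (ES N)) : Prop :=
  ∀ ε > 0, ∃ ε' > 0, ∀ x ∈ D.Ω, x ∈ S → ε ≤ F x → ε' ≤ D.d x

lemma UVan.mono {F G : ES N → ℝ} {S T : Set (ES N)} (h : D.UVan F S) (hT : T ⊆ S)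
    (hG : ∀ x ∈ D.Ω, x ∈ T → G x ≤ F x) : D.UVan G T := by
  intro ε hε
  obtain ⟨ε', h1, h2⟩ := h ε hε
  exact ⟨ε', h1, fun x hx hxT h3 => h2 x hx (hT hxT) (h3.trans (hG x hx hxT))⟩

lemma MPL {F : ES N → ℝ} (hF : D.Lc F) {S : Set (ES N)} (hS : S ⊆ D.Ω) (hsub : ∀ x ∈ S, F x ≤ D.P F x)
    (hoff : ∀ x ∈ S, ∀ y ∈ closedBall x (D.d x / 4), y ∉ S → F y ≤ 0) {B : ℝ} (hB : ∀ x ∈ S, F x ≤ B)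
    (huv : D.UVan F S) : ∀ x ∈ S, F x ≤ 0 := by
  by_contra hcon
  push Not at hcon
  obtain ⟨x1, hx1, hF1⟩ := hcon
  obtain ⟨e, c, E, hc, hec, heb, hPe⟩ := P_strict (D := D)
  have hB0 : 0 < B := hF1.trans_le (hB x1 hx1)
  set T : Set ℝ := (fun x => F x / e x) '' S with hT
  have hTb : BddAbove T := by
    refine ⟨B, ?_⟩
    rintro _ ⟨x, hx, rfl⟩
    have h1 := (heb x (hS hx)).1
    show F x / e x ≤ B
    rw [div_le_iff₀ (by linarith)]
    have := hB x hx
    nlinarith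
  set t := sSup T with ht
  have hle : ∀ x ∈ S, F x ≤ t * e x := fun x hx => by
    rw [← div_le_iff₀ (by linarith [(heb x (hS hx)).1])]
    exact le_csSup hTb ⟨x, hx, rfl⟩
  have ht0 : 0 < t := by
    have := hle x1 hx1
    by_contra h
    have h1 := (heb x1 (hS hx1)).1
    nlinarith
  have hE : 0 < E := by have := heb x1 (hS hx1); linarith [this.1, this.2]
  obtain ⟨ε', hε', hd⟩ := huv (t / 2) (by linarith)
  set η := min (t / 2) (t * c * ε' ^ 2 / (2 * E)) with hη
  have hη0 : 0 < η := by positivity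
  have hη1 : η ≤ t / 2 := min_le_left _ _
  have hη2 : η * (2 * E) ≤ t * c * ε' ^ 2 := by
    rw [← le_div_iff₀ (by positivity)]; exact min_le_right _ _
  obtain ⟨_, ⟨x, hx, rfl⟩, hxt⟩ := exists_lt_of_lt_csSup (s := T) ⟨_, ⟨x1, hx1, rfl⟩⟩ (show t - η < sSup T by linarith)
  have hxΩ := hS hx
  have hex := heb x hxΩ
  replace hxt : (t - η) * e x < F x := by
    rwa [lt_div_iff₀ (by linarith)] at hxt
  have hdx : ε' ≤ D.d x := hd x hxΩ hx (by nlinarith)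
  have hLe : D.Lc (fun x => t * e x) := (Lc.of_contOn hec.measurable hec.continuousOn).const_mul t
  have hP : D.P F x ≤ t * D.P e x := by
    rw [← P_const_mul]
    refine P_mono hF hLe hxΩ fun y hy => ?_
    by_cases hyS : y ∈ S
    · exact hle y hyS
    · have := hoff x hx y hy hyS
      have := heb y (D.cb_sub hxΩ hy)
      nlinarith
  have h1 := hPe x hxΩ
  have h2 := hsub x hx
  have h3 : t * (D.P e x + c * D.d x ^ 2) ≤ t * e x := mul_le_mul_of_nonneg_left h1 ht0.le
  have h4 : ε' ^ 2 ≤ D.d x ^ 2 := pow_le_pow_left₀ hε'.le hdx 2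
  have h5 : t * c * ε' ^ 2 ≤ t * c * D.d x ^ 2 := mul_le_mul_of_nonneg_left h4 (by positivity)
  have h6 : η * e x ≤ η * E := mul_le_mul_of_nonneg_left hex.2 hη0.le
  have h7 : 0 < η * E := by positivity
  nlinarith

/-! geometry -/

lemma frontier_notMem {y : ES N} (hy : y ∈ frontier D.Ω) : y ∉ D.Ω := by
  have := D.isOpen.inter_frontier_eq
  intro h
  have h2 : y ∈ D.Ω ∩ frontier D.Ω := ⟨h, hy⟩
  rw [this] at h2; exact h2

lemma frontier_compact : IsCompact (frontier D.Ω) :=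
  Metric.isCompact_of_isClosed_isBounded isClosed_frontier
    (D.hbd.closure.subset frontier_subset_closure)

lemma geom (D : Dom N) : ∃ r0 > 0, ∃ c0 > 0, c0 ≤ 1 / 2 ∧ ∀ y ∈ frontier D.Ω, ∃ e : ES N, ‖e‖ = 1 ∧
    ∀ x ∈ D.Ω, dist x y < r0 → ∀ t, 0 < t → t < r0 → ∀ w : ES N, ‖w - t • e‖ ≤ c0 * t → x + w ∈ D.Ω := by
  refine frontier_compact.induction_on (p := fun S => ∃ r0 > 0, ∃ c0 > 0, c0 ≤ 1 / 2 ∧ ∀ y ∈ S, ∃ e : ES N, ‖e‖ = 1 ∧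
    ∀ x ∈ D.Ω, dist x y < r0 → ∀ t, 0 < t → t < r0 → ∀ w : ES N, ‖w - t • e‖ ≤ c0 * t → x + w ∈ D.Ω) ?_ ?_ ?_ ?_
  · exact ⟨1, one_pos, 1/2, by norm_num, le_rfl, by simp⟩
  · rintro s t hst ⟨r0, h1, c0, h2, h3, h4⟩
    exact ⟨r0, h1, c0, h2, h3, fun y hy => h4 y (hst hy)⟩
  · rintro s t ⟨r0, h1, c0, h2, h3, h4⟩ ⟨r0', h1', c0', h2', h3', h4'⟩
    refine ⟨min r0 r0', lt_min h1 h1', min c0 c0', lt_min h2 h2', (min_le_left _ _).trans h3, ?_⟩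
    rintro y (hy | hy)
    · obtain ⟨e, he, hh⟩ := h4 y hy
      refine ⟨e, he, fun x hx hxy t ht0 ht w hw => hh x hx (hxy.trans_le (min_le_left _ _)) t ht0 (ht.trans_le (min_le_left _ _)) w (hw.trans ?_)⟩
      exact mul_le_mul_of_nonneg_right (min_le_left _ _) ht0.le
    · obtain ⟨e, he, hh⟩ := h4' y hy
      refine ⟨e, he, fun x hx hxy t ht0 ht w hw => hh x hx (hxy.trans_le (min_le_right _ _)) t ht0 (ht.trans_le (min_le_right _ _)) w (hw.trans ?_)⟩
      exact mul_le_mul_of_nonneg_right (min_le_right _ _) ht0.le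
  · intro z hz
    obtain ⟨g, i, f, L, ε, hε, hf, hfi, hchart⟩ := D.hΩ.2.2 z hz
    refine ⟨ball z (ε / 8), mem_nhdsWithin_of_mem_nhds (ball_mem_nhds _ (by positivity)), ε / 8, by positivity,
      1 / (2 * (1 + L)), by positivity, ?_, ?_⟩
    · rw [div_le_div_iff₀ (by positivity) (by norm_num)]
      have : (0:ℝ) ≤ L := L.2
      linarith
    intro y hy
    refine ⟨g.symm (EuclideanSpace.single i 1), by simp, ?_⟩
    intro x hx hxy t ht0 ht w hw
    have hL : (0:ℝ) ≤ L := L.2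
    set c0 : ℝ := 1 / (2 * (1 + L)) with hc0
    have hc : c0 * (1 + L) = 1 / 2 := by rw [hc0]; field_simp
    have hcp : 0 < c0 := by positivity
    have hc1 : c0 ≤ 1 / 2 := by nlinarith
    have hxz : dist x z < ε / 4 := by
      have := dist_triangle x y z
      rw [mem_ball] at hy; linarith
    have hwn : ‖w‖ ≤ 2 * t := by
      have h1 : ‖w‖ ≤ ‖w - t • g.symm (EuclideanSpace.single i (1:ℝ))‖ + ‖t • g.symm (EuclideanSpace.single i (1:ℝ))‖ := by
        have := norm_add_le (w - t • g.symm (EuclideanSpace.single i (1:ℝ))) (t • g.symm (EuclideanSpace.single i (1:ℝ)))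
        simpa using this
      have h2 : ‖t • g.symm (EuclideanSpace.single i (1:ℝ))‖ = t := by
        rw [norm_smul, Real.norm_eq_abs, abs_of_pos ht0]; simp
      nlinarith
    have hgw : ‖g w - t • EuclideanSpace.single i (1:ℝ)‖ ≤ c0 * t := by
      rw [← g.norm_map] at hw
      simpa [map_sub, map_smul] using hw
    have hin : x + w ∈ ball z ε := by
      rw [mem_ball, dist_eq_norm]
      have : x + w - z = (x - z) + w := by abel
      rw [this]
      refine (norm_add_le _ _).trans_lt ?_
      rw [← dist_eq_norm]; linarith
    rw [hchart _ hin]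
    have hx1 := (hchart x (by rw [mem_ball]; linarith)).1 hx
    have e1 : f (g (x + w)) = f (g x + (g w - t • EuclideanSpace.single i (1:ℝ))) := by
      apply hfi
      intro j hj
      simp [hj]
    have e2 := hf.dist_le_mul (g x + (g w - t • EuclideanSpace.single i (1:ℝ))) (g x)
    have e3 : dist (g x + (g w - t • EuclideanSpace.single i (1:ℝ))) (g x) = ‖g w - t • EuclideanSpace.single i (1:ℝ)‖ := by
      rw [dist_eq_norm]; congr 1; abel
    rw [e3, Real.dist_eq] at e2
    have e4 := (abs_le.1 e2).2
    have e5 : |(g w - t • EuclideanSpace.single i (1:ℝ)) i| ≤ ‖g w - t • EuclideanSpace.single i (1:ℝ)‖ := by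
      have := PiLp.norm_apply_le (g w - t • EuclideanSpace.single i (1:ℝ)) i
      simpa using this
    have e6 : (g w - t • EuclideanSpace.single i (1:ℝ)) i = g w i - t := by simp
    rw [e6] at e5
    have e7 := (abs_le.1 (e5.trans hgw)).1
    have e8 : g (x + w) i = g x i + g w i := by simp [map_add]
    rw [e1, e8]
    have e9 : L * ‖g w - t • EuclideanSpace.single i (1:ℝ)‖ ≤ L * (c0 * t) := by gcongr
    nlinarith

def r0 (D : Dom N) : ℝ := (geom D).choose
lemma r0_pos : 0 < D.r0 := (geom D).choose_spec.1
def c0 (D : Dom N) : ℝ := (geom D).choose_spec.2.choose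
lemma c0_pos : 0 < D.c0 := (geom D).choose_spec.2.choose_spec.1
lemma c0_le : D.c0 ≤ 1 / 2 := (geom D).choose_spec.2.choose_spec.2.1
open Classical in
def ev (D : Dom N) (y : ES N) : ES N :=
  if hy : y ∈ frontier D.Ω then ((geom D).choose_spec.2.choose_spec.2.2 y hy).choose else 0
lemma ev_spec {y : ES N} (hy : y ∈ frontier D.Ω) : ‖D.ev y‖ = 1 ∧
    ∀ x ∈ D.Ω, dist x y < D.r0 → ∀ t, 0 < t → t < D.r0 → ∀ w : ES N, ‖w - t • D.ev y‖ ≤ D.c0 * t → x + w ∈ D.Ω := by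
  unfold ev
  rw [dif_pos hy]
  exact ((geom D).choose_spec.2.choose_spec.2.2 y hy).choose_spec
lemma ev_norm {y : ES N} (hy : y ∈ frontier D.Ω) : ‖D.ev y‖ = 1 := (ev_spec hy).1

lemma dist_ev {y : ES N} (hy : y ∈ frontier D.Ω) (x : ES N) {t : ℝ} (ht : 0 ≤ t) : dist (x + t • D.ev y) x = t := by
  rw [dist_eq_norm, add_sub_cancel_left, norm_smul, ev_norm hy, Real.norm_eq_abs, abs_of_nonneg ht, mul_one]

lemma d_up {y : ES N} (hy : y ∈ frontier D.Ω) {x : ES N} (hx : x ∈ D.Ω) (hxy : dist x y < D.r0) {t : ℝ} (ht0 : 0 ≤ t)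
    (ht : t < D.r0) : D.c0 * t ≤ D.d (x + t • D.ev y) := by
  rcases ht0.eq_or_lt with rfl | ht0
  · simpa using D.d_nonneg _
  unfold d dista
  rw [le_infDist D.compl_nonempty]
  intro z hz
  by_contra h
  push Not at h
  apply hz
  have := (ev_spec hy).2 x hx hxy t ht0 ht (z - x) (by
    rw [dist_comm, dist_eq_norm] at h
    have e : z - x - t • D.ev y = z - (x + t • D.ev y) := by abel
    rw [e]; exact h.le)
  simpa using this

lemma d_up2 {y : ES N} (hy : y ∈ frontier D.Ω) {x : ES N} (hx : x ∈ D.Ω) (hxy : dist x y < D.r0) {t : ℝ} (ht0 : 0 ≤ t)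
    (ht : t < D.r0) : D.c0 / 2 * D.d x ≤ D.d (x + t • D.ev y) := by
  have h1 := d_up hy hx hxy ht0 ht
  have h2 := D.d_lip x (x + t • D.ev y)
  rw [dist_comm, dist_ev hy x ht0] at h2
  have := D.c0_pos; have := D.c0_le
  have := D.d_nonneg x
  by_cases h : D.d x / 2 ≤ t
  · nlinarith
  · nlinarith

lemma d_up_frontier {y z : ES N} (hy : y ∈ frontier D.Ω) (hz : z ∈ frontier D.Ω) (hzy : dist z y < D.r0) {t : ℝ} (ht0 : 0 ≤ t)
    (ht : t < D.r0) : D.c0 * t ≤ D.d (z + t • D.ev y) := by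
  have hz' : z ∈ closure D.Ω := frontier_subset_closure hz
  have hne : (𝓝[D.Ω] z).NeBot := mem_closure_iff_nhdsWithin_neBot.1 hz'
  have hc : Tendsto (fun x => D.d (x + t • D.ev y)) (𝓝[D.Ω] z) (𝓝 (D.d (z + t • D.ev y))) :=
    ((D.d_cont.comp (continuous_id.add continuous_const)).tendsto z).mono_left nhdsWithin_le_nhds
  refine ge_of_tendsto hc ?_
  have h2 : ∀ᶠ x in 𝓝[D.Ω] z, dist x y < D.r0 :=
    nhdsWithin_le_nhds ((continuous_id.dist continuous_const).tendsto z |>.eventually (gt_mem_nhds hzy))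
  filter_upwards [h2, self_mem_nhdsWithin] with x h3 h4
  exact d_up hy h4 h3 ht0 ht

lemma ext_ball {y : ES N} (hy : y ∈ frontier D.Ω) {t : ℝ} (ht0 : 0 < t) (ht : t < D.r0 / 2) {x : ES N} (hx : x ∈ D.Ω) :
    D.c0 * t ≤ dist x (y - t • D.ev y) := by
  by_contra h
  push Not at h
  apply frontier_notMem hy
  have hc := D.c0_le
  have h1 : dist x y < D.r0 := by
    have h2 := dist_triangle x (y - t • D.ev y) y
    have h3 : dist (y - t • D.ev y) y = t := by
      rw [dist_eq_norm, sub_sub_cancel_left, norm_neg, norm_smul, ev_norm hy, Real.norm_eq_abs, abs_of_nonneg ht0.le, mul_one]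
    nlinarith
  have := (ev_spec hy).2 x hx h1 t ht0 (by linarith) (y - x) (by
    rw [dist_comm, dist_eq_norm] at h
    have e : y - x - t • D.ev y = y - t • D.ev y - x := by abel
    rw [e]; exact h.le)
  simpa using this

lemma UVan_of_tendsto {v : ES N → ℝ} {C : Set (ES N)} (hC : IsCompact C)
    (hv : ∀ z ∈ frontier D.Ω, z ∈ C → Tendsto v (𝓝[D.Ω] z) (𝓝 0)) : D.UVan v C := by
  intro ε hε
  refine hC.induction_on (p := fun S => ∃ ε' > 0, ∀ x ∈ D.Ω, x ∈ S → ε ≤ v x → ε' ≤ D.d x) ⟨1, one_pos, by simp⟩ ?_ ?_ ?_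
  · rintro s t hst ⟨ε', h1, h2⟩
    exact ⟨ε', h1, fun x hx hxs => h2 x hx (hst hxs)⟩
  · rintro s t ⟨ε', h1, h2⟩ ⟨ε'', h1', h2'⟩
    refine ⟨min ε' ε'', lt_min h1 h1', ?_⟩
    rintro x hx (h | h) h3
    · exact (min_le_left _ _).trans (h2 x hx h h3)
    · exact (min_le_right _ _).trans (h2' x hx h h3)
  · intro z hz
    by_cases hzΩ : z ∈ D.Ω
    · have hd := D.d_pos hzΩ
      refine ⟨{x | D.d z / 2 < D.d x}, mem_nhdsWithin_of_mem_nhds ((D.d_cont.tendsto z).eventually (lt_mem_nhds (by linarith))), D.d z / 2, by linarith, ?_⟩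
      intro x _ hx _; exact le_of_lt hx
    by_cases hzc : z ∈ closure D.Ω
    · have hzf : z ∈ frontier D.Ω := ⟨hzc, by rwa [D.isOpen.interior_eq]⟩
      have := (hv z hzf hz).eventually (gt_mem_nhds hε)
      rw [eventually_nhdsWithin_iff] at this
      refine ⟨_, mem_nhdsWithin_of_mem_nhds this, 1, one_pos, ?_⟩
      intro x hx h1 h2
      exact absurd (h1 hx) (not_lt.2 h2)
    · refine ⟨(closure D.Ω)ᶜ, mem_nhdsWithin_of_mem_nhds (isClosed_closure.isOpen_compl.mem_nhds hzc), 1, one_pos, ?_⟩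
      intro x hx h1 h2
      exact absurd (subset_closure hx) h1

lemma bdd_of_tendsto {v : ES N → ℝ} {C : Set (ES N)} (hC : IsCompact C) (hc : ContinuousOn v D.Ω)
    (hv : ∀ z ∈ frontier D.Ω, z ∈ C → Tendsto v (𝓝[D.Ω] z) (𝓝 0)) : ∃ B, ∀ x ∈ D.Ω, x ∈ C → v x ≤ B := by
  refine hC.induction_on (p := fun S => ∃ B, ∀ x ∈ D.Ω, x ∈ S → v x ≤ B) ⟨1, by simp⟩ ?_ ?_ ?_
  · rintro s t hst ⟨ε', h2⟩
    exact ⟨ε', fun x hx hxs => h2 x hx (hst hxs)⟩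
  · rintro s t ⟨ε', h2⟩ ⟨ε'', h2'⟩
    refine ⟨max ε' ε'', ?_⟩
    rintro x hx (h | h)
    · exact (h2 x hx h).trans (le_max_left _ _)
    · exact (h2' x hx h).trans (le_max_right _ _)
  · intro z hz
    by_cases hzΩ : z ∈ D.Ω
    · have := (hc.continuousAt (D.isOpen.mem_nhds hzΩ)).tendsto.eventually (gt_mem_nhds (lt_add_one (v z)))
      refine ⟨_, mem_nhdsWithin_of_mem_nhds this, v z + 1, ?_⟩
      intro x _ hx; exact le_of_lt hx
    by_cases hzc : z ∈ closure D.Ω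
    · have hzf : z ∈ frontier D.Ω := ⟨hzc, by rwa [D.isOpen.interior_eq]⟩
      have := (hv z hzf hz).eventually (gt_mem_nhds one_pos)
      rw [eventually_nhdsWithin_iff] at this
      refine ⟨_, mem_nhdsWithin_of_mem_nhds this, 1, ?_⟩
      intro x hx h1
      exact (h1 hx).le
    · refine ⟨(closure D.Ω)ᶜ, mem_nhdsWithin_of_mem_nhds (isClosed_closure.isOpen_compl.mem_nhds hzc), 1, ?_⟩
      intro x hx h1
      exact absurd (subset_closure hx) h1

/-- decay -/
lemma decay1 (D : Dom N) : ∃ q : ℝ, 0 < q ∧ q < 1 ∧ ∀ y ∈ frontier D.Ω, ∀ R, 0 < R → R ≤ D.r0 → ∀ (F : ES N → ℝ) (A : ℝ), 0 ≤ A →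
    D.Lc F → (∀ x ∈ D.Ω, dist x y < R → F x ≤ D.P F x ∧ F x ≤ A) → D.UVan F (ball y R) →
    ∀ x ∈ D.Ω, dist x y ≤ R / 16 → F x ≤ q * A := by
  have hc := D.c0_pos
  have hc2 := D.c0_le
  have hN : (0:ℝ) < N := by have := D.hN; positivity
  set κ : ℝ := N / (2 * D.c0 ^ 2) with hκ
  have hκ0 : 0 < κ := by positivity
  set β1 := 1 - Real.exp (- κ * (4 - D.c0 ^ 2)) with hβ1
  set β2 := 1 - Real.exp (- κ * (9/4 - D.c0 ^ 2)) with hβ2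
  have hcc : D.c0 ^ 2 ≤ 1 := by nlinarith
  have h2 : 0 < β2 := by
    rw [hβ2, sub_pos, Real.exp_lt_one_iff]; nlinarith
  have h12 : β2 < β1 := by
    rw [hβ1, hβ2]
    have : Real.exp (- κ * (4 - D.c0 ^ 2)) < Real.exp (- κ * (9/4 - D.c0 ^ 2)) := by
      rw [Real.exp_lt_exp]; nlinarith
    linarith
  have h1 : 0 < β1 := h2.trans h12
  refine ⟨β2 / β1, by positivity, (div_lt_one h1).2 h12, ?_⟩
  intro y hy R hR hR0 F A hA hF hFP hUV x hx hxy
  set t := R / 8 with ht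
  have ht0 : 0 < t := by positivity
  have htr : t < D.r0 / 2 := by linarith
  set z0 := y - t • D.ev y with hz0
  have hz0y : dist z0 y = t := by
    rw [hz0, dist_eq_norm, sub_sub_cancel_left, norm_neg, norm_smul, ev_norm hy, Real.norm_eq_abs, abs_of_nonneg ht0.le, mul_one]
  set α := κ / t ^ 2 with hα
  have hα0 : 0 < α := by positivity
  have hαt : α * t ^ 2 = κ := by rw [hα]; field_simp
  set b : ES N → ℝ := fun x => 1 - Real.exp (- α * (‖x - z0‖ ^ 2 - (D.c0 * t) ^ 2)) with hb
  have hbP : ∀ x ∈ D.Ω, D.P b x ≤ b x := fun x hx => by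
    refine P_barrier z0 hα0 (by positivity) (le_of_eq ?_) (fun x hx => ext_ball hy ht0 htr hx) hx
    calc (N:ℝ) = 2 * D.c0 ^ 2 * κ := by rw [hκ]; field_simp
      _ = 2 * α * (D.c0 * t) ^ 2 := by rw [← hαt]; ring
  have hbc : Continuous b := by rw [hb]; fun_prop
  have hbl : D.Lc b := Lc.of_contOn hbc.measurable hbc.continuousOn
  have hb_ge : ∀ x, 2 * t ≤ dist x z0 → β1 ≤ b x := fun x hx => by
    rw [hβ1, hb]
    simp only
    have h3 : (2 * t) ^ 2 ≤ ‖x - z0‖ ^ 2 := by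
      rw [← dist_eq_norm]; exact pow_le_pow_left₀ (by positivity) hx 2
    have : Real.exp (- α * (‖x - z0‖ ^ 2 - (D.c0 * t) ^ 2)) ≤ Real.exp (- κ * (4 - D.c0 ^ 2)) := by
      rw [Real.exp_le_exp, ← hαt]; nlinarith
    linarith
  have hb_le : ∀ x, dist x z0 ≤ 3 / 2 * t → b x ≤ β2 := fun x hx => by
    rw [hβ2, hb]
    simp only
    have h3 : ‖x - z0‖ ^ 2 ≤ (3 / 2 * t) ^ 2 := by
      rw [← dist_eq_norm]; exact pow_le_pow_left₀ dist_nonneg hx 2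
    have : Real.exp (- κ * (9/4 - D.c0 ^ 2)) ≤ Real.exp (- α * (‖x - z0‖ ^ 2 - (D.c0 * t) ^ 2)) := by
      rw [Real.exp_le_exp, ← hαt]; nlinarith
    linarith
  have hb0 : ∀ x ∈ D.Ω, 0 ≤ b x := fun x hx => by
    rw [hb]
    simp only
    have h4 := ext_ball hy ht0 htr hx
    have h3 : (D.c0 * t) ^ 2 ≤ ‖x - z0‖ ^ 2 := by
      rw [← dist_eq_norm]; exact pow_le_pow_left₀ (by positivity) h4 2
    have : Real.exp (- α * (‖x - z0‖ ^ 2 - (D.c0 * t) ^ 2)) ≤ 1 := by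
      rw [Real.exp_le_one_iff]; nlinarith
    linarith
  set S : Set (ES N) := D.Ω ∩ ball z0 (2 * t) with hS
  have hSy : ∀ x ∈ S, dist x y < 3 * t := fun x hx => by
    have h3 := dist_triangle x z0 y
    have : dist x z0 < 2 * t := hx.2
    linarith
  have hSd : ∀ x ∈ S, D.d x < 3 * t := fun x hx => (D.d_le (frontier_notMem hy)).trans_lt (hSy x hx)
  have hcoef : 0 ≤ A / β1 := by positivity
  have key := MPL (F := fun x => F x - A / β1 * b x) (S := S) (B := A) (hF.sub (hbl.const_mul _)) inter_subset_left ?_ ?_ ?_ ?_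
  · have h5 : dist x z0 ≤ 3 / 2 * t := by
      have := dist_triangle x y z0
      rw [dist_comm y z0] at this
      linarith
    have h6 := key x ⟨hx, by rw [mem_ball]; linarith⟩
    have h7 := hb_le x h5
    have h8 : A / β1 * b x ≤ A / β1 * β2 := mul_le_mul_of_nonneg_left h7 hcoef
    have h9 : A / β1 * β2 = β2 / β1 * A := by ring
    linarith
  · intro x hx
    rw [P_sub hF (hbl.const_mul _) hx.1, P_const_mul]
    have h3 := (hFP x hx.1 (by linarith [hSy x hx])).1
    have h4 := mul_le_mul_of_nonneg_left (hbP x hx.1) hcoef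
    linarith
  · intro x hx z hz hzS
    have hzΩ := D.cb_sub hx.1 hz
    have h3 : 2 * t ≤ dist z z0 := by
      by_contra h; push Not at h; exact hzS ⟨hzΩ, h⟩
    have h4 : dist z y < R := by
      have := dist_triangle z x y
      have := hSd x hx; have := hSy x hx
      rw [mem_closedBall] at hz
      linarith
    have h5 := (hFP z hzΩ h4).2
    have h6 := mul_le_mul_of_nonneg_left (hb_ge z h3) hcoef
    have h7 : A / β1 * β1 = A := by field_simp
    linarith
  · intro x hx
    have h5 := (hFP x hx.1 (by linarith [hSy x hx])).2
    have := mul_nonneg hcoef (hb0 x hx.1)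
    linarith
  · refine hUV.mono (fun x hx => ?_) (fun x hx _ => ?_)
    · rw [mem_ball]; linarith [hSy x hx]
    · have := mul_nonneg hcoef (hb0 x hx)
      linarith

def qd (D : Dom N) : ℝ := (decay1 D).choose
lemma qd_pos : 0 < D.qd := (decay1 D).choose_spec.1
lemma qd_lt : D.qd < 1 := (decay1 D).choose_spec.2.1

lemma decay {y : ES N} (hy : y ∈ frontier D.Ω) {R : ℝ} (hR : 0 < R) (hR0 : R ≤ D.r0) {F : ES N → ℝ} {A : ℝ} (hA : 0 ≤ A)
    (hF : D.Lc F) (hFP : ∀ x ∈ D.Ω, dist x y < R → F x ≤ D.P F x ∧ F x ≤ A) (hUV : D.UVan F (ball y R)) (k : ℕ) :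
    ∀ x ∈ D.Ω, dist x y < R / 16 ^ k / 16 → F x ≤ D.qd ^ (k + 1) * A := by
  have hq := D.qd_pos
  induction k with
  | zero =>
    intro x hx hxy
    simp only [pow_zero, div_one] at hxy
    have := (decay1 D).choose_spec.2.2 y hy R hR hR0 F A hA hF hFP hUV x hx hxy.le
    show F x ≤ D.qd ^ (0+1) * A
    rw [zero_add, pow_one]; exact this
  | succ k ih =>
    intro x hx hxy
    have h16 : (1:ℝ) ≤ 16 ^ (k+1) := one_le_pow₀ (by norm_num)
    have hR' : R / 16 ^ (k + 1) ≤ R := div_le_self hR.le h16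
    have e : R / 16 ^ (k + 1) = R / 16 ^ k / 16 := by rw [pow_succ]; field_simp
    have := (decay1 D).choose_spec.2.2 y hy (R / 16 ^ (k+1)) (by positivity) (hR'.trans hR0) F (D.qd ^ (k+1) * A) (by positivity) hF
      (fun x hx hxy => ⟨(hFP x hx (hxy.trans_le hR')).1, ih x hx (by rwa [← e])⟩)
      (hUV.mono (ball_subset_ball hR') (fun _ _ _ => le_rfl)) x hx hxy.le
    refine this.trans (le_of_eq ?_)
    show D.qd * _ = _
    ring
end Dom
end

section
namespace Dom
variable {N : ℕ} {D : Dom N}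

open Classical in
def sg (D : Dom N) (ε : ℝ) : ℝ := if h : ε > 0 then (HP (D := D) ε h).choose else 1
lemma sg_pos (ε : ℝ) : 0 < D.sg ε := by
  unfold sg
  split_ifs with h
  · exact (HP (D := D) ε h).choose_spec.1
  · exact one_pos

/-- nonnegative harmonic functions -/
structure Hp (D : Dom N) (f : ES N → ℝ) : Prop where
  meas : Measurable f
  nn : ∀ x ∈ D.Ω, 0 ≤ f x
  har : ∀ x ∈ D.Ω, D.P f x = f x
  hp : ∀ ε > 0, ∀ x ∈ D.Ω, ∀ x' : ES N, dist x x' ≤ D.sg ε * D.d x → f x ≤ (1 + ε) * f x'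

lemma LVHarmonic_congr {f g : ES N → ℝ} (hf : LVHarmonic D.Ω D.V f) (h : ∀ x ∈ D.Ω, f x = g x) : LVHarmonic D.Ω D.V g := by
  have hm := D.isOpen.measurableSet
  have key : ∀ F G : ES N → ℝ, (∀ x ∈ D.Ω, F x = G x) → LocallyIntegrableOn F D.Ω → LocallyIntegrableOn G D.Ω := by
    intro F G hFG hF x hx
    obtain ⟨t, ht, hi⟩ := hF x hx
    refine ⟨t ∩ D.Ω, inter_mem ht self_mem_nhdsWithin, ?_⟩
    refine (hi.mono_set inter_subset_left).congr ?_
    have : ∀ᵐ x ∂(volume.restrict D.Ω), F x = G x := (ae_restrict_iff' hm).2 (ae_of_all _ hFG)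
    exact ae_mono (Measure.restrict_mono inter_subset_right le_rfl) this
  refine ⟨hf.1.congr fun x hx => (h x hx).symm, key _ _ h hf.2.1, key _ _ (fun x hx => by rw [h x hx]) hf.2.2.1, ?_⟩
  intro φ hφ
  have e1 : ∫ x in D.Ω, g x * lap φ x = ∫ x in D.Ω, f x * lap φ x :=
    setIntegral_congr_fun hm fun x hx => by rw [h x hx]
  have e2 : ∫ x in D.Ω, D.V x * g x * φ x = ∫ x in D.Ω, D.V x * f x * φ x :=
    setIntegral_congr_fun hm fun x hx => by rw [h x hx]
  rw [e1, e2]; exact hf.2.2.2 φ hφ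

lemma meas_ind {f : ES N → ℝ} (hf : ContinuousOn f D.Ω) : Measurable (D.Ω.indicator f) := by
  classical
  have := hf.measurable_piecewise (g := fun _ => (0:ℝ)) continuousOn_const D.isOpen.measurableSet
  have e : D.Ω.piecewise f (fun _ => (0:ℝ)) = D.Ω.indicator f := Set.piecewise_eq_indicator
  rwa [e] at this

lemma Hp.of_harm {f : ES N → ℝ} (hf : LVHarmonic D.Ω D.V f) (h0 : ∀ x ∈ D.Ω, 0 ≤ f x) : D.Hp (D.Ω.indicator f) := by
  have hm := meas_ind hf.1
  have he : ∀ x ∈ D.Ω, f x = D.Ω.indicator f x := fun x hx => (indicator_of_mem hx f).symm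
  have hf' := LVHarmonic_congr hf he
  have h0' : ∀ x ∈ D.Ω, 0 ≤ D.Ω.indicator f x := fun x hx => by rw [← he x hx]; exact h0 x hx
  refine ⟨hm, h0', fun x hx => P_harm hm hf' hx, ?_⟩
  intro ε hε x hx x' hxx
  unfold sg at hxx
  rw [dif_pos hε] at hxx
  exact (HP (D := D) ε hε).choose_spec.2 _ hm hf' h0' x hx x' hxx

lemma Hp.cont {f : ES N → ℝ} (hf : D.Hp f) : ContinuousOn f D.Ω := by
  intro x hx
  apply ContinuousAt.continuousWithinAt
  have hd := D.d_pos hx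
  have h0 := hf.nn x hx
  rw [ContinuousAt, tendsto_order]
  have ev : ∀ ε > 0, ∀ᶠ x' in 𝓝 x, f x ≤ (1 + ε) * f x' ∧ f x' ≤ (1 + ε) * f x := by
    intro ε hε
    have hs := D.sg_pos ε
    have h1 : ∀ᶠ x' in 𝓝 x, dist x x' < D.sg ε * (D.d x / 2) := by
      filter_upwards [ball_mem_nhds x (show 0 < D.sg ε * (D.d x / 2) by positivity)] with x' h
      rwa [mem_ball, dist_comm] at h
    have h2 : ∀ᶠ x' in 𝓝 x, D.d x / 2 < D.d x' := (D.d_cont.tendsto x).eventually (lt_mem_nhds (by linarith))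
    filter_upwards [h1, h2] with x' h1 h2
    refine ⟨hf.hp ε hε x hx x' (by nlinarith), hf.hp ε hε x' (D.mem_of_pos (by linarith)) x ?_⟩
    rw [dist_comm]; nlinarith
  constructor
  · intro b hb
    by_cases hb0 : b < 0
    · filter_upwards [D.isOpen.mem_nhds hx] with x' hx'
      exact hb0.trans_le (hf.nn x' hx')
    push Not at hb0
    have hfx : 0 < f x := hb0.trans_lt hb
    set ε := (f x - b) / (b + f x) with hε
    have hε0 : 0 < ε := by apply div_pos <;> linarith
    filter_upwards [ev ε hε0] with x' h
    by_contra hcon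
    push Not at hcon
    have h1 : f x ≤ (1 + ε) * b := h.1.trans (by gcongr)
    have h2 : ε * (b + f x) = f x - b := by rw [hε]; field_simp
    nlinarith
  · intro b hb
    set ε := (b - f x) / (2 * (f x + 1)) with hε
    have hε0 : 0 < ε := by apply div_pos <;> linarith
    filter_upwards [ev ε hε0] with x' h
    have h2 : ε * (2 * (f x + 1)) = b - f x := by rw [hε]; field_simp
    nlinarith

lemma Hp.lc {f : ES N → ℝ} (hf : D.Hp f) : D.Lc f := Lc.of_contOn hf.meas hf.cont

def st (D : Dom N) : ℝ := min (D.sg 1) (D.lam / 16)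
lemma st_pos : 0 < D.st := lt_min (sg_pos 1) (by have := D.lam_pos; positivity)
lemma st_le : D.st ≤ D.lam / 16 := min_le_right _ _
lemma st_lt : D.st < 1 / 64 := by have := D.st_le; have := D.lam_lt; linarith
def ch (D : Dom N) : ℝ := min (1 / 2) (P_lower (D := D) (half_pos D.st_pos)).choose
lemma ch_pos : 0 < D.ch := lt_min (by norm_num) (P_lower (D := D) (half_pos D.st_pos)).choose_spec.1
lemma ch_le : D.ch ≤ 1 / 2 := min_le_left _ _

def Step (D : Dom N) (Q : ES N → ℝ → Prop) (T : Set (ES N)) : Prop :=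
  ∀ x ∈ T, ∀ x' ∈ T, dist x x' ≤ D.st * D.d x → ∀ b, 0 ≤ b → Q x b → Q x' (D.ch * b)

lemma Step.mono {Q : ES N → ℝ → Prop} {S T : Set (ES N)} (h : D.Step Q T) (hST : S ⊆ T) : D.Step Q S :=
  fun x hx x' hx' => h x (hST hx) x' (hST hx')

lemma step_hp {f : ES N → ℝ} (hf : D.Hp f) : D.Step (fun x b => b ≤ f x) D.Ω := by
  intro x hx x' hx' hd b hb h
  have h1 := hf.hp 1 one_pos x hx x' (hd.trans (mul_le_mul_of_nonneg_right (min_le_left _ _) (D.d_nonneg x)))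
  have := D.ch_le
  show D.ch * b ≤ f x'
  nlinarith

lemma step_super {q : ES N → ℝ} (hq : D.Lc q) {T : Set (ES N)} (hT : T ⊆ D.Ω)
    (h : ∀ x ∈ T, ∀ p ∈ ball x (D.st * D.d x), D.P q p ≤ q p ∧ ∀ z ∈ closedBall p (D.d p / 4), 0 ≤ q z) :
    D.Step (fun x b => ∀ p ∈ ball x (D.st * D.d x), b ≤ q p) T := by
  intro x hx x' hx' hd b hb hb2 p hp
  have hs := D.st_pos; have hs2 := D.st_lt; have hsl := D.st_le
  have dx := D.d_pos (hT hx)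
  have dx' := D.d_pos (hT hx')
  rw [mem_ball] at hp
  have l1 := D.d_lip x x'
  have l2 := D.d_lip x' x
  have l3 := D.d_lip p x'
  have l4 := D.d_lip x' p
  rw [dist_comm x' x] at l2
  rw [dist_comm x' p] at l4
  have a1 : D.d x' ≤ 65/64 * D.d x := by nlinarith
  have a2 : D.d x ≤ 64/63 * D.d x' := by nlinarith
  have a3 : D.d p ≤ 65/64 * D.d x' := by nlinarith
  have a4 : D.d x' ≤ 64/63 * D.d p := by nlinarith
  have hpΩ : p ∈ D.Ω := D.mem_of_pos (by linarith)
  have hh := h x' hx' p hp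
  have := (P_lower (D := D) (half_pos D.st_pos)).choose_spec.2 q hq p hpΩ x (by
    have := dist_triangle x x' p
    rw [dist_comm x' p] at this
    unfold rr
    have e1 : D.st * D.d x ≤ D.lam / 16 * (2 * D.d p) := by
      refine mul_le_mul hsl ?_ dx.le ?_
      · linarith
      · linarith
    have e2 : D.st * D.d x' ≤ D.lam / 16 * (2 * D.d p) := by
      refine mul_le_mul hsl ?_ dx'.le ?_
      · linarith
      · linarith
    linarith) b hb hh.2 (fun y hy => hb2 y (ball_subset_ball (by nlinarith) hy))
  refine le_trans ?_ (this.trans hh.1)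
  exact mul_le_mul_of_nonneg_right (min_le_right _ _) hb

lemma chain_seg {Q : ES N → ℝ → Prop} {T : Set (ES N)} (hQ : D.Step Q T) {x x' : ES N} {m : ℝ} {n : ℕ} (hn : 0 < n)
    (hseg : ∀ t ∈ Icc (0:ℝ) 1, x + t • (x' - x) ∈ T ∧ m ≤ D.d (x + t • (x' - x))) (hd : dist x x' ≤ n * (D.st * m))
    {b : ℝ} (hb : 0 ≤ b) (h : Q x b) : Q x' (D.ch ^ n * b) := by
  have hn' : (0:ℝ) < n := by exact_mod_cast hn
  have key : ∀ k : ℕ, k ≤ n → Q (x + ((k:ℝ)/n) • (x' - x)) (D.ch ^ k * b) := by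
    intro k
    induction k with
    | zero => intro _; simpa using h
    | succ k ih =>
      intro hk
      have h1 := ih (by omega)
      have hk1 : (k:ℝ) / n ∈ Icc (0:ℝ) 1 := ⟨by positivity, by rw [div_le_one hn']; exact_mod_cast (by omega : k ≤ n)⟩
      have hk2 : ((k+1:ℕ):ℝ) / n ∈ Icc (0:ℝ) 1 := ⟨by positivity, by rw [div_le_one hn']; exact_mod_cast hk⟩
      have h2 := hQ _ (hseg _ hk1).1 _ (hseg _ hk2).1 ?_ _ (by have := D.ch_pos; positivity) h1
      · rw [pow_succ', mul_assoc]; exact h2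
      · have e : dist (x + ((k:ℝ)/n) • (x' - x)) (x + (((k+1:ℕ):ℝ)/n) • (x' - x)) = dist x x' / n := by
          rw [dist_add_left, dist_eq_norm, ← sub_smul, norm_smul, ← dist_eq_norm x' x, dist_comm x' x]
          push_cast
          have : (k:ℝ) / n - (k + 1) / n = - (1 / n) := by ring
          rw [this, norm_neg, Real.norm_eq_abs, abs_of_pos (by positivity)]; ring
        rw [e, div_le_iff₀ hn']
        have := mul_le_mul_of_nonneg_left (hseg _ hk1).2 D.st_pos.le
        nlinarith
  have := key n le_rfl
  rw [div_self hn'.ne', one_smul] at this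
  simpa using this
end Dom
end

section
namespace Dom
variable {N : ℕ} {D : Dom N}

def Rch (D : Dom N) (n : ℕ) (x A : ES N) : Prop :=
  ∀ Q : ES N → ℝ → Prop, D.Step Q D.Ω → ∀ b : ℝ, 0 ≤ b → Q x b → Q A (D.ch ^ n * b)

lemma Rch.trans {n m : ℕ} {x y z : ES N} (h1 : D.Rch n x y) (h2 : D.Rch m y z) : D.Rch (n + m) x z := by
  intro Q hQ b hb h
  have := h2 Q hQ _ (by have := D.ch_pos; positivity) (h1 Q hQ b hb h)
  rw [← mul_assoc, ← pow_add, add_comm m n] at this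
  exact this

lemma Rch.refl (x : ES N) : D.Rch 0 x x := by intro Q _ b _ h; simpa using h

lemma Rch.step {x x' : ES N} (hx : x ∈ D.Ω) (hx' : x' ∈ D.Ω) (h : dist x x' ≤ D.st * D.d x) : D.Rch 1 x x' := by
  intro Q hQ b hb h1
  simpa using hQ x hx x' hx' h b hb h1

lemma Rch.mono {n m : ℕ} {x y : ES N} (hy : y ∈ D.Ω) (h1 : D.Rch n x y) (hnm : n ≤ m) : D.Rch m x y := by
  induction m, hnm using Nat.le_induction with
  | base => exact h1
  | succ m _ ih =>
    exact ih.trans (Rch.step hy hy (by simpa using mul_nonneg D.st_pos.le (D.d_nonneg y)))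

lemma Rch.seg {x x' : ES N} {m : ℝ} {n : ℕ} (hn : 0 < n) (hm : 0 < m)
    (hseg : ∀ t ∈ Icc (0:ℝ) 1, m ≤ D.d (x + t • (x' - x))) (hd : dist x x' ≤ n * (D.st * m)) : D.Rch n x x' := by
  intro Q hQ b hb h
  exact chain_seg hQ hn (fun t ht => ⟨D.mem_of_pos (hm.trans_le (hseg t ht)), hseg t ht⟩) hd hb h

lemma Rch_exists {x y : ES N} (hx : x ∈ D.Ω) (hy : y ∈ D.Ω) : ∃ n, D.Rch n x y ∧ D.Rch n y x := by
  refine D.hΩ.2.1.isPreconnected.induction₂ (fun x y => x ∈ D.Ω → y ∈ D.Ω → ∃ n, D.Rch n x y ∧ D.Rch n y x) ?_ ?_ ?_ hx hy hx hy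
  · intro x hx
    have hd := D.d_pos hx
    have hs := D.st_pos
    have h1 : ∀ᶠ x' in 𝓝 x, dist x x' < D.st * (D.d x / 2) := by
      filter_upwards [ball_mem_nhds x (show 0 < D.st * (D.d x / 2) by positivity)] with x' h
      rwa [mem_ball, dist_comm] at h
    have h2 : ∀ᶠ x' in 𝓝 x, D.d x / 2 < D.d x' := (D.d_cont.tendsto x).eventually (lt_mem_nhds (by linarith))
    apply nhdsWithin_le_nhds
    filter_upwards [h1, h2] with x' h1 h2 hx hx'
    refine ⟨1, Rch.step hx hx' (by nlinarith), Rch.step hx' hx ?_⟩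
    rw [dist_comm]; nlinarith
  · intro x y z hx hy hz h1 h2 _ _
    obtain ⟨n, h3, h4⟩ := h1 hx hy
    obtain ⟨m, h5, h6⟩ := h2 hy hz
    refine ⟨n + m, h3.trans h5, ?_⟩
    rw [add_comm]; exact h6.trans h4
  · intro x y hx hy h _ _
    obtain ⟨n, h3, h4⟩ := h hx hy
    exact ⟨n, h4, h3⟩

lemma Rch_compact (D : Dom N) {m : ℝ} (hm : 0 < m) : ∃ n, ∀ x A : ES N, m ≤ D.d x → m ≤ D.d A → D.Rch n x A := by
  obtain ⟨x1, hx1⟩ := D.hΩ.2.1.nonempty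
  have hC : IsCompact {x | m ≤ D.d x} :=
    Metric.isCompact_of_isClosed_isBounded (isClosed_le continuous_const D.d_cont)
      (D.hbd.subset fun x hx => D.mem_of_pos (hm.trans_le hx))
  obtain ⟨n, hn⟩ := hC.induction_on (p := fun S => ∃ n, ∀ A ∈ S, A ∈ D.Ω → D.Rch n x1 A ∧ D.Rch n A x1) ⟨0, by simp⟩
    (fun s t hst ⟨n, h⟩ => ⟨n, fun A hA => h A (hst hA)⟩)
    (by
      rintro s t ⟨n, h⟩ ⟨n', h'⟩
      refine ⟨max n n', ?_⟩
      rintro A (hA | hA) hAΩ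
      · exact ⟨(h A hA hAΩ).1.mono hAΩ (le_max_left _ _), (h A hA hAΩ).2.mono hx1 (le_max_left _ _)⟩
      · exact ⟨(h' A hA hAΩ).1.mono hAΩ (le_max_right _ _), (h' A hA hAΩ).2.mono hx1 (le_max_right _ _)⟩)
    (by
      intro x hx
      have hxm : m ≤ D.d x := hx
      have hxΩ := D.mem_of_pos (hm.trans_le hxm)
      obtain ⟨n, h3, h4⟩ := Rch_exists hx1 hxΩ
      have hs := D.st_pos
      refine ⟨{x' | dist x' x < D.st * m} ∩ {x | m ≤ D.d x}, ?_, n + 1, ?_⟩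
      · refine inter_mem (mem_nhdsWithin_of_mem_nhds (ball_mem_nhds x (by positivity))) self_mem_nhdsWithin
      · rintro A ⟨hA, hAm⟩ hAΩ
        simp only [mem_setOf_eq] at hA hAm
        refine ⟨h3.trans (Rch.step hxΩ hAΩ ?_), ?_⟩
        · rw [dist_comm]; nlinarith
        · rw [add_comm]; exact (Rch.step hAΩ hxΩ (by nlinarith)).trans h4)
  refine ⟨n + n, fun x A hx hA => ?_⟩
  exact ((hn x hx (D.mem_of_pos (hm.trans_le hx))).2).trans ((hn A hA (D.mem_of_pos (hm.trans_le hA))).1)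

lemma Rch_glob (D : Dom N) {K ε : ℝ} (hK : 1 ≤ K) (hε : 0 < ε) (hε1 : ε ≤ 1) : ∃ n, ∀ y ∈ frontier D.Ω, ∀ ρ > 0, ∀ x A : ES N,
    dist x y ≤ K * ρ → dist A y ≤ K * ρ → ε * ρ ≤ D.d x → ε * ρ ≤ D.d A → D.Rch n x A := by
  have hc := D.c0_pos; have hc2 := D.c0_le; have hr := D.r0_pos; have hs := D.st_pos
  set ρ0 := D.r0 * D.c0 / (2 * (2 * K + 1)) with hρ0
  have hρ0p : 0 < ρ0 := by positivity
  obtain ⟨n1, hn1⟩ := Rch_compact D (m := ε * ρ0) (by positivity)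
  obtain ⟨n2, hn2⟩ := exists_nat_gt (((2 * K + 1) / D.c0) / (D.st * (D.c0 / 2 * ε)))
  have hn2p : (0:ℝ) < n2 := lt_of_le_of_lt (by positivity) hn2
  have hn2' : 0 < n2 := by exact_mod_cast hn2p
  rw [div_lt_iff₀ (by positivity)] at hn2
  refine ⟨max n1 (n2 + n2 + n2), ?_⟩
  intro y hy ρ hρ x A hx hA hdx hdA
  have hxΩ : x ∈ D.Ω := D.mem_of_pos (lt_of_lt_of_le (by positivity) hdx)
  have hAΩ : A ∈ D.Ω := D.mem_of_pos (lt_of_lt_of_le (by positivity) hdA)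
  by_cases hcase : ρ0 ≤ ρ
  · refine (hn1 x A ?_ ?_).mono hAΩ (le_max_left _ _)
    · nlinarith
    · nlinarith
  push Not at hcase
  refine Rch.mono hAΩ ?_ (le_max_right _ _)
  set T := (2 * K + 1) * ρ / D.c0 with hT
  have hTp : 0 < T := by positivity
  have hTc : D.c0 * T = (2 * K + 1) * ρ := by rw [hT]; field_simp
  have hTr : T < D.r0 := by
    have : ρ0 * (2 * (2 * K + 1)) = D.r0 * D.c0 := by rw [hρ0]; field_simp
    have : D.c0 * T < D.c0 * D.r0 := by
      rw [hTc]; nlinarith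
    exact lt_of_mul_lt_mul_left this hc.le
  have hKρ : K * ρ < D.r0 := by nlinarith
  set m := D.c0 / 2 * ε * ρ with hm
  have hmp : 0 < m := by positivity
  have hlen : T ≤ n2 * (D.st * m) := by
    have e1 : T = (2 * K + 1) / D.c0 * ρ := by rw [hT]; ring
    rw [e1, hm]
    have := mul_le_mul_of_nonneg_right hn2.le hρ.le
    linarith
  have up : ∀ p : ES N, dist p y ≤ K * ρ → ε * ρ ≤ D.d p → D.Rch n2 p (p + T • D.ev y) ∧ D.Rch n2 (p + T • D.ev y) p := by
    intro p hp hdp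
    have hpΩ : p ∈ D.Ω := D.mem_of_pos (lt_of_lt_of_le (by positivity) hdp)
    have hge : ∀ t ∈ Icc (0:ℝ) 1, m ≤ D.d (p + (t * T) • D.ev y) := by
      intro t ht
      have := d_up2 hy hpΩ (hp.trans_lt hKρ) (t := t * T) (mul_nonneg ht.1 hTp.le) (by nlinarith [ht.2])
      refine le_trans ?_ this
      rw [hm]; nlinarith
    constructor
    · refine Rch.seg hn2' hmp (fun t ht => ?_) ?_
      · have e : p + t • (p + T • D.ev y - p) = p + (t * T) • D.ev y := by rw [add_sub_cancel_left, smul_smul]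
        rw [e]; exact hge t ht
      · rw [dist_comm, dist_ev hy p hTp.le]; exact hlen
    · refine Rch.seg hn2' hmp (fun t ht => ?_) ?_
      · have e : p + T • D.ev y + t • (p - (p + T • D.ev y)) = p + ((1 - t) * T) • D.ev y := by
          rw [sub_add_cancel_left, smul_neg, smul_smul, sub_mul, one_mul, sub_smul]; abel
        rw [e]; exact hge (1 - t) ⟨by linarith [ht.2], by linarith [ht.1]⟩
      · rw [dist_ev hy p hTp.le]; exact hlen
  have across : D.Rch n2 (x + T • D.ev y) (A + T • D.ev y) := by
    have hxA : dist x A ≤ 2 * K * ρ := by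
      have := dist_triangle x y A
      rw [dist_comm y A] at this; linarith
    have hmρ : m ≤ ρ := by
      rw [hm]
      have : D.c0 / 2 * ε ≤ 1 := by nlinarith
      nlinarith
    refine Rch.seg hn2' hmp (fun t ht => ?_) ?_
    · have h1 := d_up hy hxΩ (hx.trans_lt hKρ) hTp.le hTr
      have h2 := D.d_lip (x + T • D.ev y) (x + T • D.ev y + t • (A + T • D.ev y - (x + T • D.ev y)))
      have h3 : dist (x + T • D.ev y) (x + T • D.ev y + t • (A + T • D.ev y - (x + T • D.ev y))) ≤ dist x A := by
        rw [dist_comm, dist_eq_norm, add_sub_cancel_left, add_sub_add_right_eq_sub, norm_smul, Real.norm_eq_abs,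
          abs_of_nonneg ht.1, dist_comm x A, dist_eq_norm]
        nlinarith [ht.2, norm_nonneg (A - x)]
      linarith
    · rw [dist_add_right]
      refine le_trans ?_ hlen
      refine hxA.trans ?_
      have hk : 0 ≤ K * ρ := by positivity
      have : D.c0 * (2 * K * ρ) ≤ D.c0 * T := by rw [hTc]; nlinarith
      exact le_of_mul_le_mul_left this hc
  exact ((up x hx hdx).1.trans across).trans (up A hA hdA).2

lemma Hp.rch {f : ES N → ℝ} (hf : D.Hp f) {n : ℕ} {x A : ES N} (h : D.Rch n x A) (hx : x ∈ D.Ω) : D.ch ^ n * f x ≤ f A :=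
  h _ (step_hp hf) (f x) (hf.nn x hx) le_rfl

/-- positive superharmonic functions -/
structure Sp (D : Dom N) (q : ES N → ℝ) : Prop where
  lc : D.Lc q
  nn : ∀ x ∈ D.Ω, 0 ≤ q x
  sup : ∀ x ∈ D.Ω, D.P q x ≤ q x

lemma Hp.sp {f : ES N → ℝ} (hf : D.Hp f) : D.Sp f := ⟨hf.lc, hf.nn, fun x hx => (hf.har x hx).le⟩

lemma ball_st_sub {x p : ES N} (hx : x ∈ D.Ω) (hp : p ∈ ball x (D.st * D.d x)) : p ∈ D.Ω := by
  refine D.cb_sub hx (mem_closedBall.2 ?_)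
  have := D.st_lt; have := D.d_pos hx
  rw [mem_ball] at hp; nlinarith

lemma Sp.rch {q : ES N → ℝ} (hq : D.Sp q) {n : ℕ} {x A : ES N} (h : D.Rch n A x) (hx : x ∈ D.Ω) {b : ℝ} (hb : 0 ≤ b)
    (hA : ∀ p ∈ ball A (D.st * D.d A), b ≤ q p) : D.ch ^ n * b ≤ q x := by
  have hstep := step_super hq.lc (T := D.Ω) le_rfl fun x hx p hp =>
    ⟨hq.sup p (ball_st_sub hx hp), fun z hz => hq.nn z (D.cb_sub (ball_st_sub hx hp) hz)⟩
  have := h _ hstep b hb hA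
  exact this x (mem_ball_self (mul_pos D.st_pos (D.d_pos hx)))
end Dom
end

section
namespace Dom
variable {N : ℕ} {D : Dom N}

lemma d_le_dist {y : ES N} (hy : y ∈ frontier D.Ω) (x : ES N) : D.d x ≤ dist x y := D.d_le (frontier_notMem hy)

set_option maxHeartbeats 1000000 in
lemma BHstep (D : Dom N) : ∃ θ a' M : ℝ, 0 < θ ∧ θ < 1/4 ∧ 0 < a' ∧ a' < 1 ∧ 0 < M ∧ ∀ y ∈ frontier D.Ω, ∀ r, 0 < r → r ≤ D.r0 / 2 →
    ∀ (w : ES N → ℝ) (A : ℝ), D.Lc w → 0 ≤ A → (∀ x ∈ D.Ω, dist x y < r → D.P w x ≤ w x ∧ -A ≤ w x ∧ (θ * r ≤ D.d x → A * M ≤ w x)) →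
    D.UVan (fun x => - w x) (ball y r) →
    ∀ x ∈ D.Ω, dist x y < r / 2 → -(a' * A) ≤ w x ∧ (θ * (r / 2) ≤ D.d x → a' * A * M ≤ w x) := by
  have hc := D.c0_pos; have hc2 := D.c0_le; have hr0 := D.r0_pos; have hs := D.st_pos; have hs2 := D.st_lt
  obtain ⟨n, hn⟩ := exists_nat_gt (8 / (D.c0 ^ 2 * D.st))
  have hnp : (0:ℝ) < n := lt_of_le_of_lt (by positivity) hn
  have hn' : 0 < n := by exact_mod_cast hnp
  rw [div_lt_iff₀ (by positivity)] at hn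
  set cH := D.ch ^ n with hcH
  have hcHp : 0 < cH := pow_pos D.ch_pos n
  have hcH1 : cH ≤ 1 := pow_le_one₀ D.ch_pos.le (by linarith [D.ch_le])
  obtain ⟨k, hk⟩ := exists_pow_lt_of_lt_one (show (0:ℝ) < cH / 2 by positivity) D.qd_lt
  set θ := min (1 / (4 * 16 ^ (k+1))) (D.c0 / 16) with hθ
  have hθp : 0 < θ := by rw [hθ]; exact lt_min (by positivity) (by positivity)
  have hθ1 : θ ≤ 1 / (4 * 16 ^ (k+1)) := min_le_left _ _
  have hθ2 : θ ≤ D.c0 / 16 := min_le_right _ _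
  refine ⟨θ, cH / 2, 2 / cH, hθp, by linarith, by positivity, by linarith, by positivity, ?_⟩
  intro y hy r hr hrr w A hw hA h huv x hx hxy
  have hM : cH * (2 / cH) = 2 := by field_simp
  set M := 2 / cH with hMdef
  have hMp : 0 < M := by positivity
  constructor
  · by_cases hdx : θ * r ≤ D.d x
    · have := (h x hx (by linarith)).2.2 hdx
      have h1 : 0 ≤ A * M := by positivity
      have h2 : 0 ≤ cH / 2 * A := by positivity
      linarith
    · push Not at hdx
      obtain ⟨z, hz, hxz⟩ := D.d_exists_frontier x hx
      have hzy : dist z y < 3 / 4 * r := by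
        have := dist_triangle z x y
        rw [dist_comm z x, hxz] at this
        have h3 : θ * r ≤ 1/4 * r := by nlinarith
        linarith
      have hsub : ∀ p, dist p z < r / 4 → dist p y < r := fun p hp => by
        have := dist_triangle p z y; linarith
      have := decay hz (R := r / 4) (by positivity) (by linarith) hA (F := fun x => - w x) hw.neg ?_ ?_ k x hx ?_
      · have hk' : D.qd ^ (k+1) ≤ cH / 2 := by
          rw [pow_succ]; have := D.qd_lt; have := D.qd_pos
          have := pow_pos D.qd_pos k
          nlinarith
        have := mul_le_mul_of_nonneg_right hk' hA
        linarith
      · intro p hp hpz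
        have h4 := h p hp (hsub p hpz)
        rw [P_neg]
        exact ⟨by linarith, by linarith⟩
      · exact huv.mono (fun p hp => hsub p hp) (fun _ _ _ => le_rfl)
      · rw [hxz]
        refine hdx.trans_le ?_
        have e : r / 4 / 16 ^ k / 16 = 1 / (4 * 16 ^ (k+1)) * r := by rw [pow_succ]; field_simp
        rw [e]
        exact mul_le_mul_of_nonneg_right hθ1 hr.le
  · intro hdx
    set t := 2 * θ * r / D.c0 with ht
    have htp : 0 < t := by positivity
    have htc : D.c0 * t = 2 * θ * r := by rw [ht]; field_simp
    have htr : t ≤ r / 8 := by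
      have : D.c0 * t ≤ D.c0 * (r / 8) := by rw [htc]; nlinarith
      exact le_of_mul_le_mul_left this hc
    set p := x + t • D.ev y with hp
    have hdp : 2 * θ * r ≤ D.d p := by rw [← htc]; exact d_up hy hx (by linarith) htp.le (by linarith)
    have hpx : dist p x = t := dist_ev hy x htp.le
    set T : Set (ES N) := {q | q ∈ D.Ω ∧ dist q y < 5 / 8 * r} with hT
    have hnear : ∀ q ∈ T, ∀ p' ∈ ball q (D.st * D.d q), p' ∈ D.Ω ∧ dist p' y < 41 / 64 * r := by
      intro q hq p' hp'
      refine ⟨ball_st_sub hq.1 hp', ?_⟩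
      have h1 := D.d_le_dist hy q
      have h2 := dist_triangle p' q y
      have h3 := hq.2
      have h4 : dist p' q < D.st * D.d q := hp'
      have h5 := D.d_pos hq.1
      nlinarith
    have hlcA : D.Lc (fun q => w q + A) := hw.add (Lc.const A)
    have hstep : D.Step (fun q b => ∀ p' ∈ ball q (D.st * D.d q), b ≤ w p' + A) T := by
      refine step_super hlcA (fun q hq => hq.1) ?_
      intro q hq p' hp'
      obtain ⟨h1, h2⟩ := hnear q hq p' hp'
      constructor
      · have h3 := (h p' h1 (by linarith)).1
        have h4 := P_const (D := D) h1 hA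
        have h5 : D.P (fun q => w q + A) p' = D.P w p' + D.P (fun _ => A) p' := P_add hw (Lc.const A) h1
        rw [h5]; linarith
      · intro z hz
        have h3 := D.d_le_dist hy p'
        have h4 := dist_triangle z p' y
        have h5 : dist z p' ≤ D.d p' / 4 := hz
        have := (h z (D.cb_sub h1 hz) (by linarith)).2.1
        linarith
    have hpy : dist p y < 5 / 8 * r := by
      have := dist_triangle p x y; linarith
    have hpΩ : p ∈ D.Ω := D.mem_of_pos (lt_of_lt_of_le (by positivity) hdp)
    have := chain_seg hstep (x := p) (x' := x) (m := D.c0 / 4 * θ * r) hn' ?_ ?_ (b := A * M + A) (by positivity) ?_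
    · have h1 := this x (mem_ball_self (mul_pos hs (D.d_pos hx)))
      have e : cH * (A * M + A) = 2 * A + cH * A := by rw [mul_add, mul_left_comm, hM]; ring
      have e2 : cH / 2 * A * M = A := by
        have : cH / 2 * A * M = A * (cH * M) / 2 := by ring
        rw [this, hM]; ring
      rw [e2]
      have h2 : 0 ≤ cH * A := by positivity
      have h1' : cH * (A * M + A) ≤ w x + A := h1
      linarith
    · intro s hs1
      have e : p + s • (x - p) = x + ((1 - s) * t) • D.ev y := by
        rw [hp, sub_add_cancel_left, smul_neg, smul_smul, sub_mul, one_mul, sub_smul]; abel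
      rw [e]
      have h0 : 0 ≤ (1 - s) * t := mul_nonneg (by linarith [hs1.2]) htp.le
      have h01 : (1 - s) * t ≤ t := by nlinarith [hs1.1]
      have h1 := d_up2 hy hx (by linarith) h0 (by linarith)
      have h2 : D.c0 / 4 * θ * r ≤ D.c0 / 2 * D.d x := by nlinarith
      refine ⟨⟨D.mem_of_pos (lt_of_lt_of_le (by positivity) (h2.trans h1)), ?_⟩, h2.trans h1⟩
      have h3 := dist_triangle (x + ((1 - s) * t) • D.ev y) x y
      rw [dist_ev hy x h0] at h3
      linarith
    · rw [hpx]
      have : D.c0 * t ≤ D.c0 * (n * (D.st * (D.c0 / 4 * θ * r))) := by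
        rw [htc]
        have h1 : 8 * (θ * r) ≤ n * (D.c0 ^ 2 * D.st) * (θ * r) := mul_le_mul_of_nonneg_right hn.le (by positivity)
        have e : D.c0 * (n * (D.st * (D.c0 / 4 * θ * r))) = n * (D.c0 ^ 2 * D.st) * (θ * r) / 4 := by ring
        rw [e]; linarith
      exact le_of_mul_le_mul_left this hc
    · intro p' hp'
      obtain ⟨h1, h2⟩ := hnear p ⟨hpΩ, hpy⟩ p' hp'
      have h3 : dist p' p < D.st * D.d p := hp'
      have h4 := D.d_lip p p'
      rw [dist_comm] at h4
      have h6 := D.d_pos hpΩ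
      have h5 : θ * r ≤ D.d p' := by nlinarith
      have := (h p' h1 (by linarith)).2.2 h5
      linarith

lemma BHcore (D : Dom N) : ∃ θ M : ℝ, 0 < θ ∧ θ < 1/4 ∧ 0 < M ∧ ∀ y ∈ frontier D.Ω, ∀ r, 0 < r → r ≤ D.r0 →
    ∀ (w : ES N → ℝ) (A : ℝ), D.Lc w → 0 ≤ A → (∀ x ∈ D.Ω, dist x y < r → D.P w x ≤ w x ∧ -A ≤ w x ∧ (θ * r ≤ D.d x → A * M ≤ w x)) →
    D.UVan (fun x => - w x) (ball y r) → ∀ x ∈ D.Ω, dist x y < r / 4 → 0 ≤ w x := by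
  obtain ⟨θ, a', M, hθ, hθ4, ha, ha1, hM, H⟩ := BHstep D
  refine ⟨θ / 2, M, by positivity, by linarith, hM, ?_⟩
  intro y hy r hr hrr w A hw hA h huv x hx hxy
  obtain ⟨z, hz, hxz⟩ := D.d_exists_frontier x hx
  have hdx := D.d_pos hx
  have hd4 : D.d x < r / 4 := (D.d_le_dist hy x).trans_lt hxy
  have hzy : dist z y < r / 2 := by
    have := dist_triangle z x y
    rw [dist_comm z x, hxz] at this; linarith
  have hsub : ∀ p, dist p z < r / 2 → dist p y < r := fun p hp => by
    have := dist_triangle p z y; linarith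
  have hrk : ∀ k : ℕ, 0 < r / 2 / 2 ^ k ∧ r / 2 / 2 ^ k ≤ r / 2 := fun k =>
    ⟨by positivity, div_le_self (by positivity) (one_le_pow₀ (by norm_num))⟩
  have key : ∀ k : ℕ, ∀ p ∈ D.Ω, dist p z < r / 2 / 2 ^ k → D.P w p ≤ w p ∧ -(a' ^ k * A) ≤ w p ∧
      (θ * (r / 2 / 2 ^ k) ≤ D.d p → a' ^ k * A * M ≤ w p) := by
    intro k
    induction k with
    | zero =>
      intro p hp hpz
      simp only [pow_zero, div_one, one_mul] at hpz ⊢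
      obtain ⟨h1, h2, h3⟩ := h p hp (hsub p hpz)
      exact ⟨h1, h2, fun h4 => h3 (by linarith)⟩
    | succ k ih =>
      intro p hp hpz
      have e : r / 2 / 2 ^ (k+1) = r / 2 / 2 ^ k / 2 := by rw [pow_succ]; field_simp
      rw [e] at hpz ⊢
      have := H z hz _ (hrk k).1 (by linarith [(hrk k).2]) w (a' ^ k * A) hw (by positivity) ih
        (huv.mono (fun q hq => hsub q (lt_of_lt_of_le hq (hrk k).2)) (fun _ _ _ => le_rfl)) p hp hpz
      have e2 : a' ^ (k+1) * A = a' * (a' ^ k * A) := by rw [pow_succ]; ring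
      rw [e2]
      exact ⟨(ih p hp (by linarith [(hrk k).1])).1, this⟩
  have hex : ∃ k : ℕ, r / 2 / 2 ^ k ≤ D.d x := by
    obtain ⟨k, hk⟩ := exists_pow_lt_of_lt_one (show (0:ℝ) < D.d x / (r / 2) by positivity) (show (1/2:ℝ) < 1 by norm_num)
    refine ⟨k, ?_⟩
    rw [lt_div_iff₀ (by positivity)] at hk
    have e : r / 2 / 2 ^ k = (1/2) ^ k * (r / 2) := by rw [one_div, inv_pow]; field_simp
    rw [e]; exact hk.le
  classical
  have hk := Nat.find_spec hex
  have hmin := fun m => Nat.find_min hex (m := m)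
  set k := Nat.find hex
  rcases hk0 : k with _ | j
  · rw [hk0] at hk; simp at hk; linarith
  · have h1 := hmin j (by omega)
    push Not at h1
    rw [hk0] at hk
    have e : r / 2 / 2 ^ (j+1) = r / 2 / 2 ^ j / 2 := by rw [pow_succ]; field_simp
    rw [e] at hk
    have := (key j x hx (by rw [hxz]; exact h1)).2.2 (by nlinarith [(hrk j).1])
    exact le_trans (by positivity) this
end Dom
end

section
namespace Dom
variable {N : ℕ} {D : Dom N}

lemma Hp.const_mul {f : ES N → ℝ} (hf : D.Hp f) {c : ℝ} (hc : 0 ≤ c) : D.Hp (fun x => c * f x) := by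
  refine ⟨hf.meas.const_mul c, fun x hx => mul_nonneg hc (hf.nn x hx), fun x hx => ?_, ?_⟩
  · rw [P_const_mul, hf.har x hx]
  · intro ε hε x hx x' hd
    have := mul_le_mul_of_nonneg_left (hf.hp ε hε x hx x' hd) hc
    linarith

lemma growth (D : Dom N) {K ε : ℝ} (hK : 1 ≤ K) (hε : 0 < ε) (hε1 : ε ≤ 1) : ∃ (C : ℝ) (γ : ℕ), 0 < C ∧ ∀ y ∈ frontier D.Ω, ∀ ρ > 0,
    2 * ρ < D.r0 → ∀ v, D.Hp v → ∀ A, dist A y ≤ K * ρ → ε * ρ ≤ D.d A → ∀ x ∈ D.Ω, dist x y < 2 * ρ →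
    v x * D.d x ^ γ ≤ C * ρ ^ γ * v A := by
  have hc := D.c0_pos; have hc2 := D.c0_le; have hr0 := D.r0_pos; have hchp := D.ch_pos
  obtain ⟨n1, hn1⟩ := Rch_glob D (K := 3) (ε := D.c0) (by norm_num) hc (by linarith)
  obtain ⟨n2, hn2⟩ := Rch_glob D (K := max K 4) (ε := min ε D.c0) (hK.trans (le_max_left _ _)) (lt_min hε hc) ((min_le_left _ _).trans hε1)
  obtain ⟨γ, hγ⟩ := pow_unbounded_of_one_lt (1 / D.ch ^ n1) (show (1:ℝ) < 2 by norm_num)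
  refine ⟨4 ^ γ / D.ch ^ n2, γ, by positivity, ?_⟩
  intro y hy ρ hρ hρr v hv A hA hdA x hx hxy
  obtain ⟨z, hz, hxz⟩ := D.d_exists_frontier x hx
  have hd := D.d_pos hx
  have hxr : dist x z < D.r0 := by rw [hxz]; linarith [D.d_le_dist hy x]
  set X : ℕ → ES N := fun k => x + (2 ^ k * D.d x) • D.ev z with hX
  have hXd : ∀ k, 2 ^ k * D.d x < D.r0 → D.c0 * (2 ^ k * D.d x) ≤ D.d (X k) := fun k hk => d_up hz hx hxr (by positivity) hk
  have hXx : ∀ k, dist (X k) x = 2 ^ k * D.d x := fun k => dist_ev hz x (by positivity)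
  have hXz : ∀ k, dist (X k) z ≤ 2 ^ k * D.d x + D.d x := fun k => by
    have := dist_triangle (X k) x z; rw [hXx, hxz] at this; exact this
  have hone : ∀ k : ℕ, (1:ℝ) ≤ 2 ^ k := fun k => one_le_pow₀ (by norm_num)
  have chain : ∀ k, 2 ^ k * D.d x < D.r0 → D.Rch (n1 * (k + 1)) x (X k) := by
    intro k
    induction k with
    | zero =>
      intro h
      refine (hn1 z hz (D.d x) hd x (X 0) ?_ ?_ ?_ ?_).mono (D.mem_of_pos ?_) (by simp)
      · rw [hxz]; linarith
      · have := hXz 0; simp at this; linarith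
      · nlinarith
      · have := hXd 0 h; simpa using this
      · exact lt_of_lt_of_le (by positivity) (hXd 0 h)
    | succ k ih =>
      intro h
      have h2 : 2 ^ (k+1) * D.d x = 2 * (2 ^ k * D.d x) := by rw [pow_succ]; ring
      have hp : 0 < 2 ^ k * D.d x := by positivity
      have h3 : D.d x ≤ 2 ^ k * D.d x := by nlinarith [hone k]
      have h4 : 2 ^ k * D.d x < D.r0 := by linarith
      have e : n1 * (k + 1 + 1) = n1 * (k+1) + n1 := by ring
      rw [e]
      refine (ih h4).trans (hn1 z hz (2 ^ k * D.d x) hp _ _ ?_ ?_ (hXd k h4) ?_)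
      · have := hXz k; linarith
      · have := hXz (k+1); rw [h2] at this; linarith
      · have := hXd (k+1) h; rw [h2] at this; nlinarith
  have hdρ : D.d x < 2 * ρ := (D.d_le_dist hy x).trans_lt hxy
  obtain ⟨k, hk1, hk2⟩ := exists_nat_pow_near (show 1 ≤ 2 * ρ / D.d x by rw [le_div_iff₀ hd]; linarith) (show (1:ℝ) < 2 by norm_num)
  rw [le_div_iff₀ hd] at hk1
  rw [div_lt_iff₀ hd, pow_succ] at hk2
  have hkr : 2 ^ k * D.d x < D.r0 := by linarith
  have hXk := hXd k hkr
  have hXΩ : X k ∈ D.Ω := D.mem_of_pos (lt_of_lt_of_le (by positivity) hXk)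
  have hAΩ : A ∈ D.Ω := D.mem_of_pos (lt_of_lt_of_le (by positivity) hdA)
  have hfin : D.Rch (n1 * (k+1) + n2) x A := by
    refine (chain k hkr).trans (hn2 y hy ρ hρ _ _ ?_ ?_ ?_ ?_)
    · have h1 := dist_triangle (X k) x y
      rw [hXx] at h1
      have : 4 * ρ ≤ max K 4 * ρ := mul_le_mul_of_nonneg_right (le_max_right _ _) hρ.le
      linarith
    · exact hA.trans (mul_le_mul_of_nonneg_right (le_max_left _ _) hρ.le)
    · refine le_trans ?_ hXk
      have : min ε D.c0 ≤ D.c0 := min_le_right _ _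
      calc min ε D.c0 * ρ ≤ D.c0 * ρ := mul_le_mul_of_nonneg_right this hρ.le
        _ ≤ _ := mul_le_mul_of_nonneg_left (by linarith) hc.le
    · exact (mul_le_mul_of_nonneg_right (min_le_left _ _) hρ.le).trans hdA
  have h1 := hv.rch hfin hx
  have hvA := hv.nn A hAΩ
  have hvx := hv.nn x hx
  set H := D.ch ^ n1 with hH
  have hHp : 0 < H := by positivity
  rw [pow_add, pow_mul] at h1
  have hHγ : 1 ≤ H * 2 ^ γ := by
    rw [div_lt_iff₀ hHp] at hγ; linarith
  have h2 : 1 ≤ (H * 2 ^ γ) ^ (k+1) := one_le_pow₀ hHγ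
  have h3 : (H * 2 ^ γ) ^ (k+1) * D.d x ^ γ ≤ H ^ (k+1) * (4 * ρ) ^ γ := by
    have e0 : ((2:ℝ) ^ γ) ^ (k+1) = (2 ^ (k+1)) ^ γ := by rw [← pow_mul, ← pow_mul, mul_comm]
    rw [mul_pow, e0, mul_assoc, ← mul_pow]
    refine mul_le_mul_of_nonneg_left (pow_le_pow_left₀ (by positivity) ?_ _) (by positivity)
    rw [pow_succ]; linarith
  have h4 : D.d x ^ γ ≤ H ^ (k+1) * (4 * ρ) ^ γ := by
    have := mul_le_mul_of_nonneg_right h2 (pow_nonneg hd.le γ)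
    linarith
  calc v x * D.d x ^ γ ≤ v x * (H ^ (k+1) * (4 * ρ) ^ γ) := mul_le_mul_of_nonneg_left h4 hvx
    _ = (H ^ (k+1) * D.ch ^ n2 * v x) * ((4 * ρ) ^ γ / D.ch ^ n2) := by field_simp
    _ ≤ v A * ((4 * ρ) ^ γ / D.ch ^ n2) := mul_le_mul_of_nonneg_right h1 (by positivity)
    _ = _ := by rw [mul_pow]; ring

set_option maxHeartbeats 1000000 in
lemma carleson (D : Dom N) {K ε : ℝ} (hK : 1 ≤ K) (hε : 0 < ε) (hε1 : ε ≤ 1) : ∃ C : ℝ, 0 < C ∧ ∀ y ∈ frontier D.Ω, ∀ ρ > 0,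
    2 * ρ < D.r0 → ∀ v, D.Hp v → (∀ z ∈ frontier D.Ω, dist z y ≤ 2 * ρ → Tendsto v (𝓝[D.Ω] z) (𝓝 0)) →
    ∀ A, dist A y ≤ K * ρ → ε * ρ ≤ D.d A → ∀ x ∈ D.Ω, dist x y < ρ → v x ≤ C * v A := by
  obtain ⟨C, γ, hC, hg⟩ := growth D hK hε hε1
  have hq := D.qd_pos; have hq1 := D.qd_lt
  obtain ⟨k, hk⟩ := exists_pow_lt_of_lt_one (show (0:ℝ) < 1 / (2 * 2 ^ γ) by positivity) hq1
  set η : ℝ := 1 / (4 * 16 ^ (k+1)) with hη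
  have hηp : 0 < η := by positivity
  have hη4 : η ≤ 1 / 4 := by
    rw [hη]; apply one_div_le_one_div_of_le (by norm_num)
    have : (1:ℝ) ≤ 16 ^ (k+1) := one_le_pow₀ (by norm_num)
    linarith
  refine ⟨C / η ^ γ, by positivity, ?_⟩
  intro y hy ρ hρ hρr v hv hvan A hA hdA x0 hx0 hxy0
  have hAΩ : A ∈ D.Ω := D.mem_of_pos (lt_of_lt_of_le (by positivity) hdA)
  have hvA := hv.nn A hAΩ
  have hcomp := isCompact_closedBall y (2 * ρ)
  obtain ⟨B, hB⟩ := bdd_of_tendsto hcomp hv.cont hvan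
  have hUV := UVan_of_tendsto (D := D) hcomp hvan
  set W : ES N → ℝ := fun x => v x * (2 * ρ - dist x y) ^ γ with hW
  set S : Set ℝ := W '' {x | x ∈ D.Ω ∧ dist x y < 2 * ρ} with hS
  have hWnn : ∀ x ∈ D.Ω, dist x y < 2 * ρ → 0 ≤ W x := fun x hx hxy => mul_nonneg (hv.nn x hx) (pow_nonneg (by linarith) _)
  have hbdd : BddAbove S := by
    refine ⟨B * (2 * ρ) ^ γ, ?_⟩
    rintro _ ⟨x, ⟨hx, hxy⟩, rfl⟩
    have h1 := hB x hx (mem_closedBall.2 hxy.le)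
    have h2 : 0 ≤ B := (hv.nn x hx).trans h1
    exact mul_le_mul h1 (pow_le_pow_left₀ (by linarith) (by linarith [dist_nonneg (x := x) (y := y)]) _) (pow_nonneg (by linarith) _) h2
  set m := sSup S with hm
  have hle : ∀ x ∈ D.Ω, dist x y < 2 * ρ → W x ≤ m := fun x hx hxy => le_csSup hbdd ⟨x, ⟨hx, hxy⟩, rfl⟩
  have hm0 : 0 ≤ m := (hWnn x0 hx0 (by linarith)).trans (hle x0 hx0 (by linarith))
  set Q := C / η ^ γ * ρ ^ γ * v A with hQ
  have hQ0 : 0 ≤ Q := by positivity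
  have key : ∀ x ∈ D.Ω, dist x y < 2 * ρ → W x ≤ max (m / 2) Q := by
    intro x hx hxy
    set d := 2 * ρ - dist x y with hd
    have hdp : 0 < d := by linarith
    by_cases hcase : η * d ≤ D.d x
    · refine le_trans ?_ (le_max_right _ _)
      have h1 := hg y hy ρ hρ hρr v hv A hA hdA x hx hxy
      have h2 : (η * d) ^ γ ≤ D.d x ^ γ := pow_le_pow_left₀ (by positivity) hcase _
      have h3 := (mul_le_mul_of_nonneg_left h2 (hv.nn x hx)).trans h1
      rw [mul_pow] at h3
      have hp : 0 < η ^ γ := by positivity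
      have e : Q = C * ρ ^ γ * v A / η ^ γ := by rw [hQ]; ring
      rw [e, le_div_iff₀ hp]
      show v x * d ^ γ * η ^ γ ≤ _
      linarith
    · push Not at hcase
      refine le_trans ?_ (le_max_left _ _)
      obtain ⟨z, hz, hxz⟩ := D.d_exists_frontier x hx
      have hdist0 := dist_nonneg (x := x) (y := y)
      have hηd : η * d ≤ d / 4 := by nlinarith
      have hp : ∀ p, dist p z < d / 4 → dist p y < dist x y + d / 2 := by
        intro p hp
        have h1 := dist_triangle p z y
        have h2 := dist_triangle z x y
        rw [dist_comm z x, hxz] at h2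
        linarith
      have := decay hz (R := d / 4) (by positivity) (by linarith) (F := v) (A := m * (2 / d) ^ γ) (by positivity) hv.lc ?_ ?_ k x hx ?_
      · have hk' : D.qd ^ (k+1) ≤ 1 / (2 * 2 ^ γ) := by
          have := pow_pos hq k
          rw [pow_succ]; nlinarith
        have h5 : v x ≤ 1 / (2 * 2 ^ γ) * (m * (2 / d) ^ γ) := this.trans (mul_le_mul_of_nonneg_right hk' (by positivity))
        have e : 1 / (2 * 2 ^ γ) * (m * (2 / d) ^ γ) = m / 2 / d ^ γ := by rw [div_pow]; field_simp
        rw [e, le_div_iff₀ (by positivity)] at h5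
        exact h5
      · intro p hpΩ hpz
        refine ⟨(hv.har p hpΩ).ge, ?_⟩
        have h1 := hp p hpz
        have h2 := hle p hpΩ (by linarith)
        have h3 : (d / 2) ^ γ ≤ (2 * ρ - dist p y) ^ γ := pow_le_pow_left₀ (by positivity) (by linarith) _
        have h4 := (mul_le_mul_of_nonneg_left h3 (hv.nn p hpΩ)).trans h2
        rw [← le_div_iff₀ (by positivity)] at h4
        refine h4.trans (le_of_eq ?_)
        rw [div_pow, div_pow]; field_simp
      · refine hUV.mono (fun p hpz => ?_) (fun _ _ _ => le_rfl)
        have := hp p hpz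
        rw [mem_closedBall]; linarith
      · rw [hxz]
        refine hcase.trans_le (le_of_eq ?_)
        rw [hη, pow_succ]; field_simp
  have hmQ : m ≤ Q := by
    have h1 : m ≤ max (m / 2) Q := by
      refine csSup_le ⟨_, x0, ⟨hx0, by linarith⟩, rfl⟩ ?_
      rintro _ ⟨x, ⟨hx, hxy⟩, rfl⟩
      exact key x hx hxy
    rcases le_max_iff.1 h1 with h | h
    · linarith
    · exact h
  have h1 := (hle x0 hx0 (by linarith)).trans hmQ
  have h2 : ρ ^ γ ≤ (2 * ρ - dist x0 y) ^ γ := pow_le_pow_left₀ hρ.le (by linarith) _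
  have h3 := (mul_le_mul_of_nonneg_left h2 (hv.nn x0 hx0)).trans h1
  have hp : 0 < ρ ^ γ := by positivity
  refine le_of_mul_le_mul_right ?_ hp
  rw [hQ] at h3; linarith
end Dom
end

section
namespace Dom
variable {N : ℕ} {D : Dom N}

lemma BH (D : Dom N) {K ε : ℝ} (hK : 1 ≤ K) (hε : 0 < ε) (hε1 : ε ≤ 1) : ∃ c : ℝ, 0 < c ∧ ∀ y ∈ frontier D.Ω, ∀ ρ > 0,
    ρ < D.r0 → ∀ v, D.Hp v → (∀ z ∈ frontier D.Ω, dist z y ≤ ρ → Tendsto v (𝓝[D.Ω] z) (𝓝 0)) →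
    ∀ A, dist A y ≤ K * ρ → ε * ρ ≤ D.d A → ∀ q, D.Sp q → (∀ p ∈ ball A (D.st * D.d A), v A ≤ q p) →
    ∀ x ∈ D.Ω, dist x y < ρ / 8 → c * v x ≤ q x := by
  obtain ⟨C, hC, hcar⟩ := carleson D (K := 2 * K) (by linarith) hε hε1
  obtain ⟨θ, M, hθ, hθ4, hM, hcore⟩ := BHcore D
  have hmin : 0 < min ε (θ / 2) := lt_min hε (by positivity)
  obtain ⟨n, hn⟩ := Rch_glob D hK hmin ((min_le_left _ _).trans hε1)
  have hchp := D.ch_pos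
  set cH := D.ch ^ n with hcH
  have hcHp : 0 < cH := by positivity
  set B1 := C * (M + 1) / cH with hB1
  have hB1p : 0 < B1 := by positivity
  refine ⟨1 / B1, by positivity, ?_⟩
  intro y hy ρ hρ hρr v hv hvan A hA hdA q hq hqA x hx hxy
  have hAΩ : A ∈ D.Ω := D.mem_of_pos (lt_of_lt_of_le (by positivity) hdA)
  have hvA := hv.nn A hAΩ
  have hcar' : ∀ x ∈ D.Ω, dist x y < ρ / 2 → v x ≤ C * v A :=
    hcar y hy (ρ / 2) (by positivity) (by linarith) v hv (fun z hz hzy => hvan z hz (by linarith)) A (by linarith) (by nlinarith)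
  have := hcore y hy (ρ / 2) (by positivity) (by linarith) (fun x => B1 * q x - v x) (C * v A) ((hq.lc.const_mul B1).sub hv.lc)
    (by positivity) ?_ ?_ x hx (by linarith)
  · rw [one_div, inv_mul_le_iff₀ hB1p]; linarith
  · intro p hp hpy
    refine ⟨?_, ?_, ?_⟩
    · have h1 := P_sub (hq.lc.const_mul B1) hv.lc hp
      rw [h1, P_const_mul, hv.har p hp]
      have := mul_le_mul_of_nonneg_left (hq.sup p hp) hB1p.le
      linarith
    · have := hcar' p hp hpy
      have h2 := mul_nonneg hB1p.le (hq.nn p hp)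
      show _ ≤ B1 * q p - v p
      linarith
    · intro hdp
      have h1 : D.Rch n A p := by
        refine hn y hy ρ hρ A p hA (by nlinarith) ?_ ?_
        · exact (mul_le_mul_of_nonneg_right (min_le_left _ _) hρ.le).trans hdA
        · exact (mul_le_mul_of_nonneg_right (min_le_right _ _) hρ.le).trans (by linarith)
      have h2 := hq.rch h1 hp hvA hqA
      have h3 := hcar' p hp hpy
      have h4 : C * (M + 1) * v A ≤ B1 * q p := by
        have := mul_le_mul_of_nonneg_left h2 hB1p.le
        have e : B1 * (cH * v A) = C * (M + 1) * v A := by rw [hB1]; field_simp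
        linarith
      show _ ≤ B1 * q p - v p
      nlinarith
  · have h1 := UVan_of_tendsto (D := D) (isCompact_closedBall y ρ) hvan
    refine h1.mono (fun p hp => ?_) (fun p hp _ => ?_)
    · rw [mem_ball] at hp; rw [mem_closedBall]; linarith
    · have := mul_nonneg hB1p.le (hq.nn p hp)
      linarith

lemma shell (D : Dom N) {K ε : ℝ} (hK : 1 ≤ K) (hε : 0 < ε) (hε1 : ε ≤ 1) : ∃ c : ℝ, 0 < c ∧ ∀ y ∈ frontier D.Ω, ∀ ρ > 0,
    ρ < D.r0 → ∀ v, D.Hp v → (∀ z ∈ frontier D.Ω, ρ < dist z y → Tendsto v (𝓝[D.Ω] z) (𝓝 0)) →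
    ∀ A, dist A y ≤ K * ρ → ε * ρ ≤ D.d A → ∀ q, D.Sp q → (∀ p ∈ ball A (D.st * D.d A), v A ≤ q p) →
    ∀ x ∈ D.Ω, 3 * ρ ≤ dist x y → c * v x ≤ q x := by
  obtain ⟨c1, hc1, hBH⟩ := BH D (K := K + 5) (by linarith) hε hε1
  have hmin : 0 < min ε (1 / 8 : ℝ) := lt_min hε (by positivity)
  obtain ⟨n, hn⟩ := Rch_glob D (K := K + 5) (by linarith) hmin ((min_le_left _ _).trans hε1)
  have hchp := D.ch_pos
  set cH := D.ch ^ n with hcH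
  have hcHp : 0 < cH := by positivity
  set c := min c1 (cH * cH) with hc
  have hcp : 0 < c := lt_min hc1 (by positivity)
  refine ⟨c, hcp, ?_⟩
  intro y hy ρ hρ hρr v hv hvan A hA hdA q hq hqA
  have hAΩ : A ∈ D.Ω := D.mem_of_pos (lt_of_lt_of_le (by positivity) hdA)
  have hvA := hv.nn A hAΩ
  have near : ∀ x ∈ D.Ω, 3 * ρ ≤ dist x y → dist x y ≤ 4 * ρ → c * v x ≤ q x := by
    intro x hx h3 h4
    by_cases hcase : ρ / 8 ≤ D.d x
    · have hm1 : min ε (1 / 8 : ℝ) * ρ ≤ D.d A := (mul_le_mul_of_nonneg_right (min_le_left _ _) hρ.le).trans hdA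
      have hm2 : min ε (1 / 8 : ℝ) * ρ ≤ D.d x := (mul_le_mul_of_nonneg_right (min_le_right _ _) hρ.le).trans (by linarith)
      have h1 := hq.rch (hn y hy ρ hρ A x (by nlinarith) (by nlinarith) hm1 hm2) hx hvA hqA
      have h2 := hv.rch (hn y hy ρ hρ x A (by nlinarith) (by nlinarith) hm2 hm1) hx
      have h5 := mul_le_mul_of_nonneg_left h2 hcHp.le
      have h6 : c * v x ≤ cH * cH * v x := mul_le_mul_of_nonneg_right (min_le_right _ _) (hv.nn x hx)
      have : cH * (cH * v x) = cH * cH * v x := by ring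
      linarith
    · push Not at hcase
      obtain ⟨z, hz, hxz⟩ := D.d_exists_frontier x hx
      have t1 := dist_triangle x z y
      have t2 := dist_triangle z x y
      rw [dist_comm z x] at t2
      have h1 := hBH z hz ρ hρ hρr v hv (fun z' hz' hzz => hvan z' hz' (by
        have := dist_triangle z z' y
        rw [dist_comm z z'] at this; linarith)) A (by
          have := dist_triangle A y z
          rw [dist_comm y z] at this; linarith) hdA q hq hqA x hx (by linarith)
      exact (mul_le_mul_of_nonneg_right (min_le_left _ _) (hv.nn x hx)).trans h1
  intro x hx h3
  by_cases h4 : dist x y ≤ 4 * ρ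
  · exact near x hx h3 h4
  push Not at h4
  set S : Set (ES N) := {x | x ∈ D.Ω ∧ 4 * ρ < dist x y} with hS
  have hcomp : IsCompact (closure D.Ω ∩ {x | 4 * ρ ≤ dist x y}) :=
    D.hbd.isCompact_closure.inter_right (isClosed_le continuous_const (continuous_id.dist continuous_const))
  have hvan' : ∀ z ∈ frontier D.Ω, z ∈ (closure D.Ω ∩ {x | 4 * ρ ≤ dist x y}) → Tendsto v (𝓝[D.Ω] z) (𝓝 0) := by
    rintro z hz ⟨_, hz2⟩
    have : 4 * ρ ≤ dist z y := hz2
    exact hvan z hz (by linarith)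
  obtain ⟨B, hB⟩ := bdd_of_tendsto hcomp hv.cont hvan'
  have hUV := UVan_of_tendsto (D := D) hcomp hvan'
  have hSC : ∀ x ∈ S, x ∈ (closure D.Ω ∩ {x | 4 * ρ ≤ dist x y}) := fun x hx => ⟨subset_closure hx.1, hx.2.le⟩
  have := MPL (D := D) (F := fun x => c * v x - q x) ((hv.lc.const_mul c).sub hq.lc) (S := S) (fun x hx => hx.1) ?_ ?_
    (B := c * B) ?_ ?_ x ⟨hx, h4⟩
  · linarith
  · intro p hp
    have h1 := P_sub (hv.lc.const_mul c) hq.lc hp.1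
    rw [h1, P_const_mul, hv.har p hp.1]
    have := hq.sup p hp.1
    linarith
  · intro p hp p' hp' hpS
    have hp'Ω := D.cb_sub hp.1 hp'
    have h5 : dist p' y ≤ 4 * ρ := by
      by_contra h; push Not at h; exact hpS ⟨hp'Ω, h⟩
    have h6 := dist_triangle p p' y
    have h7 : dist p' p ≤ D.d p / 4 := hp'
    have h8 := D.d_le_dist hy p
    have h9 : 4 * ρ < dist p y := hp.2
    rw [dist_comm p p'] at h6
    have := near p' hp'Ω (by linarith) h5
    linarith
  · intro p hp
    have h1 := mul_le_mul_of_nonneg_left (hB p hp.1 (hSC p hp)) hcp.le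
    have h2 := hq.nn p hp.1
    show c * v p - q p ≤ _
    linarith
  · intro e he
    obtain ⟨e', he', h⟩ := hUV (e / c) (by positivity)
    refine ⟨e', he', fun p hp hpS h1 => h p hp (hSC p hpS) ?_⟩
    rw [div_le_iff₀ hcp]
    have := hq.nn p hp
    have h2 : e ≤ c * v p - q p := h1
    linarith

/-- positive harmonic functions vanishing off `z` -/
structure MK (D : Dom N) (z : ES N) (f : ES N → ℝ) : Prop where
  hp : D.Hp f
  pos : ∀ x ∈ D.Ω, 0 < f x
  van : ∀ z' ∈ frontier D.Ω, z' ≠ z → Tendsto f (𝓝[D.Ω] z') (𝓝 0)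

lemma Hp.ball_le {f : ES N → ℝ} (hf : D.Hp f) {A p : ES N} (hA : A ∈ D.Ω) (hp : p ∈ ball A (D.st * D.d A)) : D.ch * f A ≤ f p := by
  refine step_hp hf A hA p (ball_st_sub hA hp) ?_ (f A) (hf.nn A hA) le_rfl
  rw [dist_comm]; exact (mem_ball.1 hp).le

/-- shell comparison of two harmonic functions, at a corkscrew point `A` and a far point `x` -/
lemma shell2 (D : Dom N) {K ε : ℝ} (hK : 1 ≤ K) (hε : 0 < ε) (hε1 : ε ≤ 1) : ∃ c : ℝ, 0 < c ∧ ∀ y ∈ frontier D.Ω, ∀ ρ > 0,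
    ρ < D.r0 → ∀ v w, D.Hp v → D.Hp w → (∀ z ∈ frontier D.Ω, ρ < dist z y → Tendsto v (𝓝[D.Ω] z) (𝓝 0)) →
    ∀ A, dist A y ≤ K * ρ → ε * ρ ≤ D.d A →
    ∀ x ∈ D.Ω, 3 * ρ ≤ dist x y → c * (v x * w A) ≤ w x * v A := by
  obtain ⟨c, hc, h⟩ := shell D hK hε hε1
  have hchp := D.ch_pos
  refine ⟨c * D.ch, by positivity, ?_⟩
  intro y hy ρ hρ hρr v w hv hw hvan A hA hdA x hx hxy
  have hAΩ : A ∈ D.Ω := D.mem_of_pos (lt_of_lt_of_le (by positivity) hdA)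
  have hvA := hv.nn A hAΩ
  have hwA := hw.nn A hAΩ
  have h0 : (0:ℝ) ≤ D.ch * w A := by positivity
  have := h y hy ρ hρ hρr (fun x => (D.ch * w A) * v x) (hv.const_mul h0) ?_ A hA hdA (fun x => v A * w x) (hw.const_mul hvA).sp ?_ x hx hxy
  · have e : c * (D.ch * w A * v x) = c * D.ch * (v x * w A) := by ring
    linarith
  · intro z hz hzy
    have := (hvan z hz hzy).const_mul (D.ch * w A)
    simpa using this
  · intro p hp
    have := mul_le_mul_of_nonneg_left (hw.ball_le hAΩ hp) hvA
    linarith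

lemma MK.van' {z y : ES N} {f : ES N → ℝ} {ρ : ℝ} (hf : D.MK z f) (hz : dist z y ≤ ρ) :
    ∀ z' ∈ frontier D.Ω, ρ < dist z' y → Tendsto f (𝓝[D.Ω] z') (𝓝 0) := by
  intro z' hz' h
  refine hf.van z' hz' ?_
  rintro rfl; linarith

/-- BH3 -/
lemma BH3 (D : Dom N) {K ε : ℝ} (hK : 1 ≤ K) (hε : 0 < ε) (hε1 : ε ≤ 1) : ∃ C : ℝ, 0 < C ∧ ∀ y ∈ frontier D.Ω, ∀ ρ > 0,
    ρ < D.r0 → ∀ z v w, D.MK z v → D.Hp w → dist z y ≤ ρ →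
    ∀ x, dist x y ≤ K * ρ → ε * ρ ≤ D.d x →
    ∀ x0 ∈ D.Ω, 3 * ρ ≤ dist x0 y → w x * v x0 ≤ C * (w x0 * v x) := by
  obtain ⟨c, hc, h⟩ := shell2 D hK hε hε1
  refine ⟨1 / c, by positivity, ?_⟩
  intro y hy ρ hρ hρr z v w hv hw hz x hx hdx x0 hx0 hx0y
  have := h y hy ρ hρ hρr v w hv.hp hw (hv.van' hz) x hx hdx x0 hx0 hx0y
  rw [one_div, ← div_eq_inv_mul, le_div_iff₀ hc]; linarith

lemma cork {y : ES N} (hy : y ∈ frontier D.Ω) {ρ : ℝ} (hρ : 0 < ρ) (hρr : ρ < D.r0) :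
    dist (y + ρ • D.ev y) y ≤ 1 * ρ ∧ D.c0 * ρ ≤ D.d (y + ρ • D.ev y) := by
  refine ⟨by rw [dist_ev hy y hρ.le, one_mul], ?_⟩
  exact d_up_frontier hy hy (by rw [dist_self]; exact D.r0_pos) hρ.le hρr

lemma BH2 (D : Dom N) : ∃ C : ℝ, 0 < C ∧ ∀ y ∈ frontier D.Ω, ∀ ρ > 0,
    ρ < D.r0 → ∀ z1 z2 v1 v2, D.MK z1 v1 → D.MK z2 v2 → dist z1 y ≤ ρ → dist z2 y ≤ ρ →
    ∀ x ∈ D.Ω, 3 * ρ ≤ dist x y → ∀ x0 ∈ D.Ω, 3 * ρ ≤ dist x0 y → v1 x * v2 x0 ≤ C * (v1 x0 * v2 x) := by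
  obtain ⟨c, hc, h⟩ := shell2 D (K := 1) (ε := D.c0) le_rfl D.c0_pos (by linarith [D.c0_le])
  refine ⟨1 / c ^ 2, by positivity, ?_⟩
  intro y hy ρ hρ hρr z1 z2 v1 v2 h1 h2 hz1 hz2 x hx hxy x0 hx0 hx0y
  obtain ⟨hA, hdA⟩ := cork hy hρ hρr
  set A := y + ρ • D.ev y
  have hAΩ : A ∈ D.Ω := D.mem_of_pos (lt_of_lt_of_le (mul_pos D.c0_pos hρ) hdA)
  have e1 := h y hy ρ hρ hρr v1 v2 h1.hp h2.hp (h1.van' hz1) A hA hdA x hx hxy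
  have e2 := h y hy ρ hρ hρr v2 v1 h2.hp h1.hp (h2.van' hz2) A hA hdA x0 hx0 hx0y
  have p1 := h1.pos A hAΩ
  have p2 := h2.pos A hAΩ
  have q1 := h1.pos x hx
  have q2 := h2.pos x hx
  have q3 := h2.pos x0 hx0
  have q4 := h1.pos x0 hx0
  have := mul_le_mul e1 e2 (by positivity) (by positivity)
  have h3 : c ^ 2 * (v1 x * v2 x0) * (v1 A * v2 A) ≤ (v1 x0 * v2 x) * (v1 A * v2 A) := by
    calc _ = c * (v1 x * v2 A) * (c * (v2 x0 * v1 A)) := by ring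
      _ ≤ _ := this
      _ = _ := by ring
  have h4 := le_of_mul_le_mul_right h3 (by positivity)
  rw [one_div, ← div_eq_inv_mul, le_div_iff₀ (by positivity)]; linarith

/-- kernels with farther poles are smaller nontangentially -/
lemma star (D : Dom N) {κ : ℝ} (hκ : 1 ≤ κ) : ∃ C : ℝ, 0 < C ∧ ∀ y ∈ frontier D.Ω, ∀ z z' f f', D.MK z f → D.MK z' f' →
    dist z' y ≤ dist z y → 0 < dist z y → dist z y < D.r0 → ∀ x0 ∈ D.Ω, 3 * dist z y ≤ dist x0 y → ∀ x ∈ D.Ω, dist x y ≤ κ * D.d x →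
    f x * f' x0 ≤ C * (f x0 * f' x) := by
  have hc0 := D.c0_pos; have hc02 := D.c0_le; have hch := D.ch_pos
  obtain ⟨C2, hC2, h2⟩ := BH2 D
  obtain ⟨C3, hC3, h3⟩ := BH3 D (K := 3) (ε := 1 / (32 * κ)) (by norm_num) (by positivity)
    (by rw [div_le_one (by positivity)]; linarith)
  obtain ⟨C4, hC4, h4⟩ := BH3 D (K := 1) (ε := D.c0) le_rfl D.c0_pos (by linarith)
  obtain ⟨c5, hc5, h5⟩ := BH D (K := 2) (ε := D.c0) (by norm_num) D.c0_pos (by linarith)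
  refine ⟨C2 + C3 + C4 / (c5 * D.ch), by positivity, ?_⟩
  intro y hy z z' f f' hf hf' hzz ht htr x0 hx0 hx0y x hx hxκ
  set t := dist z y with htd
  have hpos := mul_pos (hf.pos x0 hx0) (hf'.pos x hx)
  have hd := D.d_pos hx
  suffices hs : f x * f' x0 ≤ C2 * (f x0 * f' x) ∨ f x * f' x0 ≤ C3 * (f x0 * f' x) ∨ f x * f' x0 ≤ C4 / (c5 * D.ch) * (f x0 * f' x) by
    have a2 := mul_pos hC2 hpos
    have a3 := mul_pos hC3 hpos
    have a4 := mul_pos (show 0 < C4 / (c5 * D.ch) by positivity) hpos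
    rw [add_mul, add_mul]
    rcases hs with hs | hs | hs <;> linarith
  by_cases hc1 : 3 * t ≤ dist x y
  · exact Or.inl (h2 y hy t ht htr z z' f f' hf hf' le_rfl hzz x hx hc1 x0 hx0 hx0y)
  push Not at hc1
  right
  by_cases hc2 : t / 32 ≤ dist x y
  · left
    refine (h3 y hy t ht htr z' f' f hf' hf.hp hzz x hc1.le ?_ x0 hx0 hx0y)
    have : 1 / (32 * κ) * t = (t / 32) / κ := by field_simp
    rw [this, div_le_iff₀ (by linarith)]
    linarith
  · right
    push Not at hc2
    obtain ⟨hA, hdA⟩ := cork hy ht htr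
    set A := y + t • D.ev y with hAdef
    have hAΩ : A ∈ D.Ω := D.mem_of_pos (lt_of_lt_of_le (mul_pos D.c0_pos ht) hdA)
    have e1 := h4 y hy t ht htr z' f' f hf' hf.hp hzz A hA hdA x0 hx0 hx0y
    have pA := hf.pos A hAΩ
    have pA' := hf'.pos A hAΩ
    have px0 := hf.pos x0 hx0
    have px0' := hf'.pos x0 hx0
    have h0 : (0:ℝ) ≤ D.ch * f' A := by positivity
    have e2 := h5 y hy (t / 2) (by positivity) (by linarith) (fun x => (D.ch * f' A) * f x) (hf.hp.const_mul h0) (fun w hw hwy => by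
      have hwz : w ≠ z := by rintro rfl; linarith
      simpa using (hf.van w hw hwz).const_mul (D.ch * f' A)) A (by linarith) (by nlinarith) (fun x => f A * f' x)
      (hf'.hp.const_mul pA.le).sp (fun p hp => by
        have := mul_le_mul_of_nonneg_left (hf'.hp.ball_le hAΩ hp) pA.le
        linarith) x hx (by linarith)
    have e3 : c5 * D.ch * (f x * f' A) ≤ f A * f' x := by
      have : c5 * (D.ch * f' A * f x) = c5 * D.ch * (f x * f' A) := by ring
      linarith
    rw [div_mul_eq_mul_div, le_div_iff₀ (by positivity)]
    have px := hf.pos x hx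
    have px' := hf'.pos x hx
    have := mul_le_mul e1 e3 (by positivity) (by positivity)
    refine le_of_mul_le_mul_right ?_ (mul_pos pA pA')
    calc _ = f A * f' x0 * (c5 * D.ch * (f x * f' A)) := by ring
      _ ≤ _ := this
      _ = _ := by ring
end Dom
end

section
namespace Dom
variable {N : ℕ} {D : Dom N}

def psi (D : Dom N) (φ : ES N → ℝ) (x : ES N) : ℝ := lap φ x - D.V x * φ x

lemma psi_zero {φ : ES N → ℝ} {x : ES N} (hx : x ∉ tsupport φ) : D.psi φ x = 0 := by
  unfold psi; rw [lap_zero_off hx, image_eq_zero_of_notMem_tsupport hx]; ring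

lemma V_meas (D : Dom N) : Measurable D.V := D.hV.1

lemma V_int_compact {C : Set (ES N)} (hC : IsCompact C) (hCΩ : C ⊆ D.Ω) : IntegrableOn D.V C := by
  obtain ⟨B, hB⟩ := V_bdd_compact hC hCΩ
  refine Measure.integrableOn_of_bounded (M := B) hC.measure_lt_top.ne D.V_meas.aestronglyMeasurable ?_
  exact (ae_restrict_iff' hC.measurableSet).2 (ae_of_all _ fun x hx => by rw [Real.norm_eq_abs]; exact hB x hx)

lemma psi_intK {φ : ES N → ℝ} (hφ : IsTestFun D.Ω φ) : IntegrableOn (D.psi φ) (tsupport φ) := by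
  have h1 : IntegrableOn (lap φ) (tsupport φ) := (lap_cont hφ.1).continuousOn.integrableOn_compact hφ.2.1
  have h2 : IntegrableOn (fun x => D.V x * φ x) (tsupport φ) :=
    (V_int_compact hφ.2.1 hφ.2.2).mul_continuousOn hφ.1.continuous.continuousOn hφ.2.1
  exact h1.sub h2

lemma int_of_K {φ F : ES N → ℝ} (hφ : IsTestFun D.Ω φ) (h : IntegrableOn F (tsupport φ)) (h0 : ∀ x, x ∉ tsupport φ → F x = 0) :
    IntegrableOn F D.Ω := h.of_forall_sdiff_eq_zero D.isOpen.measurableSet fun x hx => h0 x hx.2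

lemma psi_int {φ u : ES N → ℝ} (hφ : IsTestFun D.Ω φ) (hu : ContinuousOn u D.Ω) : IntegrableOn (fun x => u x * D.psi φ x) D.Ω :=
  int_of_K hφ ((psi_intK hφ).continuousOn_mul (hu.mono hφ.2.2) hφ.2.1) fun x hx => by rw [psi_zero hx, mul_zero]

lemma psi_abs_int {φ : ES N → ℝ} (hφ : IsTestFun D.Ω φ) : IntegrableOn (fun x => |D.psi φ x|) D.Ω :=
  int_of_K hφ (psi_intK hφ).abs fun x hx => by rw [psi_zero hx, abs_zero]

lemma harm_iff {u : ES N → ℝ} (hu : ContinuousOn u D.Ω) :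
    LVHarmonic D.Ω D.V u ↔ ∀ φ, IsTestFun D.Ω φ → ∫ x in D.Ω, u x * D.psi φ x = 0 := by
  have key : ∀ φ, IsTestFun D.Ω φ → ∫ x in D.Ω, u x * D.psi φ x = (∫ x in D.Ω, u x * lap φ x) - ∫ x in D.Ω, D.V x * u x * φ x := by
    intro φ hφ
    have i1 : IntegrableOn (fun x => u x * lap φ x) D.Ω := int_of_K hφ
      (((lap_cont hφ.1).continuousOn.integrableOn_compact hφ.2.1).continuousOn_mul (hu.mono hφ.2.2) hφ.2.1)
      fun x hx => by rw [lap_zero_off hx, mul_zero]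
    have i2 : IntegrableOn (fun x => D.V x * u x * φ x) D.Ω := int_of_K hφ
      (((V_int_compact hφ.2.1 hφ.2.2).mul_continuousOn (hu.mono hφ.2.2) hφ.2.1).mul_continuousOn hφ.1.continuous.continuousOn hφ.2.1)
      fun x hx => by rw [image_eq_zero_of_notMem_tsupport hx, mul_zero]
    rw [← integral_sub i1 i2]
    refine integral_congr_ae (ae_of_all _ fun x => ?_)
    simp only [psi]; ring
  constructor
  · intro h φ hφ
    rw [key φ hφ, h.2.2.2 φ hφ, sub_self]
  · intro h
    refine ⟨hu, hu.locallyIntegrableOn D.isOpen.measurableSet, ?_, fun φ hφ => ?_⟩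
    · intro x hx
      obtain ⟨K, hK, hKx, hKΩ⟩ := exists_compact_subset D.isOpen hx
      refine ⟨K, mem_nhdsWithin_of_mem_nhds (mem_interior_iff_mem_nhds.1 hKx), ?_⟩
      exact (V_int_compact hK hKΩ).mul_continuousOn (hu.mono hKΩ) hK
    · have := h φ hφ
      rw [key φ hφ] at this; linarith

lemma harm_lin {f g : ES N → ℝ} (hf : LVHarmonic D.Ω D.V f) (hg : LVHarmonic D.Ω D.V g) (a b : ℝ) :
    LVHarmonic D.Ω D.V (fun x => a * f x + b * g x) := by
  have hcont : ContinuousOn (fun x => a * f x + b * g x) D.Ω := (continuousOn_const.mul hf.1).add (continuousOn_const.mul hg.1)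
  rw [harm_iff hcont]
  intro φ hφ
  have h1 := (harm_iff hf.1).1 hf φ hφ
  have h2 := (harm_iff hg.1).1 hg φ hφ
  have e : ∀ x, (a * f x + b * g x) * D.psi φ x = a * (f x * D.psi φ x) + b * (g x * D.psi φ x) := fun x => by ring
  simp_rw [e]
  rw [integral_add ((psi_int hφ hf.1).const_mul a) ((psi_int hφ hg.1).const_mul b), integral_const_mul, integral_const_mul, h1, h2]
  ring

/-- nonnegative with the uniform Harnack inequality -/
structure HH (D : Dom N) (f : ES N → ℝ) : Prop where
  nn : ∀ x ∈ D.Ω, 0 ≤ f x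
  hp : ∀ ε > 0, ∀ x ∈ D.Ω, ∀ x' ∈ D.Ω, dist x x' ≤ D.sg ε * D.d x → f x ≤ (1 + ε) * f x'

lemma HH.of_harm {f : ES N → ℝ} (hf : LVHarmonic D.Ω D.V f) (h0 : ∀ x ∈ D.Ω, 0 ≤ f x) : D.HH f := by
  have h := Hp.of_harm hf h0
  refine ⟨h0, fun ε hε x hx x' hx' hd => ?_⟩
  have := h.hp ε hε x hx x' hd
  rwa [indicator_of_mem hx, indicator_of_mem hx'] at this

def tt (D : Dom N) (ε : ℝ) : ℝ := min (D.sg ε / 2) (1 / 2)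
lemma tt_pos (ε : ℝ) : 0 < D.tt ε := lt_min (half_pos (D.sg_pos ε)) (by norm_num)

lemma HH.diff {f : ES N → ℝ} (hf : D.HH f) {ε : ℝ} (hε : 0 < ε) (hε1 : ε ≤ 1) {x x' : ES N} (hx : x ∈ D.Ω)
    (hd : dist x x' < D.tt ε * D.d x) : x' ∈ D.Ω ∧ |f x' - f x| ≤ 2 * ε * f x := by
  have hdx := D.d_pos hx
  have hs := D.sg_pos ε
  have h1 : D.tt ε ≤ D.sg ε / 2 := min_le_left _ _
  have h2 : D.tt ε ≤ 1 / 2 := min_le_right _ _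
  have hl := D.d_lip x x'
  have hdx' : D.d x / 2 ≤ D.d x' := by nlinarith
  have hx' : x' ∈ D.Ω := D.mem_of_pos (by linarith)
  have e1 := hf.hp ε hε x hx x' hx' (by nlinarith)
  have e2 := hf.hp ε hε x' hx' x hx (by rw [dist_comm]; nlinarith)
  have := hf.nn x hx
  have := hf.nn x' hx'
  refine ⟨hx', ?_⟩
  rw [abs_le]; constructor
  · nlinarith
  · nlinarith

lemma HH.cont {f : ES N → ℝ} (hf : D.HH f) : ContinuousOn f D.Ω := by
  intro x hx
  apply ContinuousAt.continuousWithinAt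
  rw [Metric.continuousAt_iff]
  intro e he
  have hdx := D.d_pos hx
  have h0 := hf.nn x hx
  set ε := min 1 (e / (4 * (f x + 1))) with hε
  have hεp : 0 < ε := lt_min one_pos (by positivity)
  have hε2 : ε ≤ e / (4 * (f x + 1)) := min_le_right _ _
  rw [le_div_iff₀ (by positivity)] at hε2
  refine ⟨D.tt ε * D.d x, mul_pos (D.tt_pos ε) hdx, fun x' hx' => ?_⟩
  rw [dist_comm] at hx'
  have := (hf.diff hεp (min_le_left _ _) hx hx').2
  rw [Real.dist_eq]; nlinarith

lemma harm_lim {ι : Type*} {F : Filter ι} [F.NeBot] {u : ι → ES N → ℝ} {g : ES N → ℝ}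
    (hu : ∀ᶠ i in F, LVHarmonic D.Ω D.V (u i) ∧ ∀ x ∈ D.Ω, 0 ≤ u i x) (hg : ∀ x ∈ D.Ω, Tendsto (fun i => u i x) F (𝓝 (g x))) :
    LVHarmonic D.Ω D.V g ∧ ∀ x ∈ D.Ω, 0 ≤ g x := by
  have hHH : ∀ᶠ i in F, D.HH (u i) := hu.mono fun i hi => HH.of_harm hi.1 hi.2
  have hgH : D.HH g := by
    refine ⟨fun x hx => ge_of_tendsto (hg x hx) (hu.mono fun i hi => hi.2 x hx), fun ε hε x hx x' hx' hd => ?_⟩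
    exact le_of_tendsto_of_tendsto (hg x hx) ((hg x' hx').const_mul (1 + ε)) (hHH.mono fun i hi => hi.hp ε hε x hx x' hx' hd)
  refine ⟨?_, hgH.nn⟩
  rw [harm_iff hgH.cont]
  intro φ hφ
  have unif : ∀ e > 0, ∀ᶠ i in F, ∀ x ∈ tsupport φ, |u i x - g x| ≤ e := by
    intro e he
    refine hφ.2.1.induction_on (p := fun S => ∀ᶠ i in F, ∀ x ∈ S, |u i x - g x| ≤ e) (by simp) ?_ ?_ ?_
    · intro s t hst h; exact h.mono fun i hi x hx => hi x (hst hx)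
    · intro s t h1 h2
      filter_upwards [h1, h2] with i h1 h2 x hx
      rcases hx with hx | hx
      · exact h1 x hx
      · exact h2 x hx
    · intro x hxK
      have hx := hφ.2.2 hxK
      have hdx := D.d_pos hx
      have h0 := hgH.nn x hx
      set ε := min 1 (e / (8 * (g x + 1))) with hε
      have hεp : 0 < ε := lt_min one_pos (by positivity)
      have hε2 : ε ≤ e / (8 * (g x + 1)) := min_le_right _ _
      rw [le_div_iff₀ (by positivity)] at hε2
      refine ⟨ball x (D.tt ε * D.d x), mem_nhdsWithin_of_mem_nhds (ball_mem_nhds _ (mul_pos (D.tt_pos ε) hdx)), ?_⟩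
      have hclose : ∀ᶠ i in F, |u i x - g x| < min (e / 4) 1 := by
        have := (Metric.tendsto_nhds.1 (hg x hx)) (min (e/4) 1) (by positivity)
        simpa [Real.dist_eq] using this
      filter_upwards [hHH, hclose] with i hi hc x' hx'
      rw [mem_ball, dist_comm] at hx'
      have a1 := (hi.diff hεp (min_le_left _ _) hx hx').2
      have a2 := (hgH.diff hεp (min_le_left _ _) hx hx').2
      have hc1 : |u i x - g x| < e / 4 := hc.trans_le (min_le_left _ _)
      have hc2 : |u i x - g x| < 1 := hc.trans_le (min_le_right _ _)
      have hux : u i x ≤ g x + 1 := by have := (abs_lt.1 hc2).2; linarith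
      have b1 : 2 * ε * u i x ≤ e / 4 := by nlinarith
      have b2 : 2 * ε * g x ≤ e / 4 := by nlinarith
      rw [abs_le] at a1 a2 ⊢
      rw [abs_lt] at hc1
      constructor <;> linarith [a1.1, a1.2, a2.1, a2.2, hc1.1, hc1.2]
  set J := ∫ x in D.Ω, |D.psi φ x| with hJ
  have hJ0 : 0 ≤ J := integral_nonneg fun x => abs_nonneg _
  by_contra hne
  have hpos : 0 < |∫ x in D.Ω, g x * D.psi φ x| := abs_pos.2 hne
  set I := |∫ x in D.Ω, g x * D.psi φ x| with hI
  obtain ⟨i, hi, hi2⟩ := ((unif (I / (2 * (J + 1))) (by positivity)).and hu).exists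
  have hz := (harm_iff hi2.1.1).1 hi2.1 φ hφ
  have e1 : ∫ x in D.Ω, g x * D.psi φ x = - ∫ x in D.Ω, (u i x - g x) * D.psi φ x := by
    have : ∀ x, (u i x - g x) * D.psi φ x = u i x * D.psi φ x - g x * D.psi φ x := fun x => by ring
    simp_rw [this]
    rw [integral_sub (psi_int hφ hi2.1.1) (psi_int hφ hgH.cont), hz]; ring
  have e2 : I ≤ I / (2 * (J + 1)) * J := by
    have e3 : I = |∫ x in D.Ω, (u i x - g x) * D.psi φ x| := by rw [hI, e1, abs_neg]
    refine e3.le.trans ?_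
    refine (abs_integral_le_integral_abs).trans ?_
    rw [hJ, ← integral_const_mul]
    refine integral_mono_ae ?_ ((psi_abs_int hφ).const_mul _) (ae_of_all _ fun x => ?_)
    · have := (psi_int hφ (hi2.1.1.sub hgH.cont)).abs
      exact this
    · simp only
      rw [abs_mul]
      by_cases hx : x ∈ tsupport φ
      · exact mul_le_mul_of_nonneg_right (hi x hx) (abs_nonneg _)
      · rw [psi_zero hx, abs_zero, mul_zero, mul_zero]
  rw [div_mul_eq_mul_div, le_div_iff₀ (by positivity)] at e2
  nlinarith
end Dom
end

section
namespace Dom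
variable {N : ℕ} {D : Dom N}

/-- harmonic version of `MK`, not normalized -/
structure ML (D : Dom N) (z : ES N) (f : ES N → ℝ) : Prop where
  har : LVHarmonic D.Ω D.V f
  pos : ∀ x ∈ D.Ω, 0 < f x
  van : ∀ z' ∈ frontier D.Ω, z' ≠ z → Tendsto f (𝓝[D.Ω] z') (𝓝 0)

lemma tendsto_ind {f : ES N → ℝ} {z : ES N} (h : Tendsto f (𝓝[D.Ω] z) (𝓝 0)) : Tendsto (D.Ω.indicator f) (𝓝[D.Ω] z) (𝓝 0) := by
  refine h.congr' ?_
  filter_upwards [self_mem_nhdsWithin] with x hx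
  rw [indicator_of_mem hx]

lemma ML.mk' {z : ES N} {f : ES N → ℝ} (h : D.ML z f) : D.MK z (D.Ω.indicator f) := by
  refine ⟨Hp.of_harm h.har fun x hx => (h.pos x hx).le, fun x hx => ?_, fun z' hz' hne => tendsto_ind (h.van z' hz' hne)⟩
  rw [indicator_of_mem hx]; exact h.pos x hx

lemma ML.cmp (D : Dom N) : ∃ C : ℝ, 1 ≤ C ∧ ∀ z ∈ frontier D.Ω, ∀ f g, D.ML z f → D.ML z g → ∀ x ∈ D.Ω, ∀ x0 ∈ D.Ω,
    f x * g x0 ≤ C * (f x0 * g x) := by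
  obtain ⟨C, hC, h⟩ := BH2 D
  refine ⟨max C 1, le_max_right _ _, ?_⟩
  intro z hz f g hf hg x hx x0 hx0
  have hr := D.r0_pos
  have p1 : 0 < dist x z := lt_of_lt_of_le (D.d_pos hx) (D.d_le_dist hz x)
  have p2 : 0 < dist x0 z := lt_of_lt_of_le (D.d_pos hx0) (D.d_le_dist hz x0)
  set ρ := min (D.r0 / 2) (min (dist x z / 3) (dist x0 z / 3)) with hρ
  have hρp : 0 < ρ := by positivity
  have q1 : ρ ≤ D.r0 / 2 := min_le_left _ _
  have q2 : ρ ≤ dist x z / 3 := (min_le_right _ _).trans (min_le_left _ _)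
  have q3 : ρ ≤ dist x0 z / 3 := (min_le_right _ _).trans (min_le_right _ _)
  have := h z hz ρ hρp (by linarith) z z _ _ hf.mk' hg.mk' (by rw [dist_self]; exact hρp.le) (by rw [dist_self]; exact hρp.le)
    x hx (by linarith) x0 hx0 (by linarith)
  simp only [indicator_of_mem hx, indicator_of_mem hx0] at this
  refine this.trans (mul_le_mul_of_nonneg_right (le_max_left _ _) ?_)
  exact (mul_pos (hf.pos x0 hx0) (hg.pos x hx)).le

lemma harm_pos {f : ES N → ℝ} (hf : LVHarmonic D.Ω D.V f) (h0 : ∀ x ∈ D.Ω, 0 ≤ f x) {x0 : ES N} (hx0 : x0 ∈ D.Ω) (hp : 0 < f x0) :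
    ∀ x ∈ D.Ω, 0 < f x := by
  intro x hx
  obtain ⟨n, h1, _⟩ := Rch_exists hx0 hx
  have := (Hp.of_harm hf h0).rch h1 hx0
  rw [indicator_of_mem hx, indicator_of_mem hx0] at this
  exact lt_of_lt_of_le (mul_pos (pow_pos D.ch_pos n) hp) this

lemma ML.le {z x0 : ES N} (hz : z ∈ frontier D.Ω) (hx0 : x0 ∈ D.Ω) {f g : ES N → ℝ} (hf : D.ML z f) (hg : D.ML z g) (hf1 : f x0 = 1)
    (hg1 : g x0 = 1) : ∀ x ∈ D.Ω, f x ≤ g x := by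
  obtain ⟨C, hC, hcmp⟩ := ML.cmp D
  set S : Set ℝ := {c | 0 ≤ c ∧ ∀ x ∈ D.Ω, c * f x ≤ g x} with hS
  have h0S : (0:ℝ) ∈ S := ⟨le_rfl, fun x hx => by rw [zero_mul]; exact (hg.pos x hx).le⟩
  have hb : BddAbove S := ⟨1, fun c hc => by have := hc.2 x0 hx0; rw [hf1, hg1] at this; linarith⟩
  set c := sSup S with hc
  have hc0 : 0 ≤ c := le_csSup hb h0S
  have hcS : ∀ x ∈ D.Ω, c * f x ≤ g x := by
    intro x hx
    have hfx := hf.pos x hx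
    rw [← le_div_iff₀ hfx]
    exact csSup_le ⟨0, h0S⟩ fun c' hc' => by rw [le_div_iff₀ hfx]; exact hc'.2 x hx
  by_cases h1 : 1 ≤ c
  · intro x hx
    have := hcS x hx
    nlinarith [hf.pos x hx]
  push Not at h1
  exfalso
  set h : ES N → ℝ := fun x => 1 * g x + (-c) * f x with hh
  have hhar : LVHarmonic D.Ω D.V h := harm_lin hg.har hf.har 1 (-c)
  have hnn : ∀ x ∈ D.Ω, 0 ≤ h x := fun x hx => by have := hcS x hx; simp only [hh]; linarith
  have hx0v : h x0 = 1 - c := by simp only [hh]; rw [hf1, hg1]; ring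
  have hML : D.ML z h := by
    refine ⟨hhar, harm_pos hhar hnn hx0 (by rw [hx0v]; linarith), fun z' hz' hne => ?_⟩
    have := ((hg.van z' hz' hne).const_mul 1).add ((hf.van z' hz' hne).const_mul (-c))
    rw [mul_zero, mul_zero, add_zero] at this
    exact this
  have hmem : c + (1 - c) / C ∈ S := by
    refine ⟨by have : 0 ≤ (1 - c) / C := div_nonneg (by linarith) (by linarith)
               linarith, fun x hx => ?_⟩
    have := hcmp z hz f h hf hML x hx x0 hx0
    rw [hf1, hx0v] at this
    have h2 : f x * (1 - c) / C ≤ h x := by rw [div_le_iff₀ (by linarith)]; linarith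
    simp only [hh] at h2
    have e : (c + (1 - c) / C) * f x = c * f x + f x * (1 - c) / C := by ring
    rw [e]; linarith
  have := le_csSup hb hmem
  have h3 : 0 < (1 - c) / C := div_pos (by linarith) (by linarith)
  linarith

/-- the family of Martin kernels -/
structure Kers (D : Dom N) (x0 : ES N) (K : ES N → ES N → ℝ) : Prop where
  mem : x0 ∈ D.Ω
  ml : ∀ z ∈ frontier D.Ω, D.ML z (K z)
  one : ∀ z ∈ frontier D.Ω, K z x0 = 1

variable {x0 : ES N} {K : ES N → ES N → ℝ}

lemma Kers.bound (hK : D.Kers x0 K) {p : ES N} (hp : p ∈ D.Ω) : ∃ b B : ℝ, 0 < b ∧ 0 < B ∧ ∀ z ∈ frontier D.Ω, b ≤ K z p ∧ K z p ≤ B := by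
  obtain ⟨n, h1, h2⟩ := Rch_exists hK.mem hp
  have hch := D.ch_pos
  refine ⟨D.ch ^ n, 1 / D.ch ^ n, by positivity, by positivity, fun z hz => ?_⟩
  have e1 := (hK.ml z hz).mk'.hp.rch h1 hK.mem
  have e2 := (hK.ml z hz).mk'.hp.rch h2 hp
  rw [indicator_of_mem hp, indicator_of_mem hK.mem, hK.one z hz] at e1 e2
  refine ⟨by linarith, ?_⟩
  rw [le_div_iff₀ (by positivity)]; linarith

lemma Kers.unifvan (hK : D.Kers x0 K) {z w : ES N} (hw : w ∈ frontier D.Ω) (hne : w ≠ z) : ∀ e > 0, ∃ s > 0,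
    ∀ z' ∈ frontier D.Ω, dist z' z < s → ∀ x ∈ D.Ω, dist x w < s → K z' x ≤ e := by
  intro e he
  have hr := D.r0_pos
  have hc0 := D.c0_pos
  have hwz : 0 < dist w z := dist_pos.2 hne
  obtain ⟨C, hC, hcar⟩ := carleson D (K := 1) (ε := D.c0) le_rfl hc0 (by linarith [D.c0_le])
  set ρ := min (D.r0 / 4) (dist w z / 8) with hρ
  have hρp : 0 < ρ := by positivity
  have q1 : ρ ≤ D.r0 / 4 := min_le_left _ _
  have q2 : ρ ≤ dist w z / 8 := min_le_right _ _
  obtain ⟨hA, hdA⟩ := cork hw hρp (by linarith)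
  set A := w + ρ • D.ev w
  have hAΩ : A ∈ D.Ω := D.mem_of_pos (lt_of_lt_of_le (mul_pos D.c0_pos hρp) hdA)
  obtain ⟨b, B, hb, hB, hbB⟩ := hK.bound hAΩ
  obtain ⟨k, hk⟩ := exists_pow_lt_of_lt_one (show (0:ℝ) < e / (C * B) by positivity) D.qd_lt
  refine ⟨min (dist w z / 2) (ρ / 16 ^ k / 16), by positivity, ?_⟩
  intro z' hz' hz'z x hx hxw
  have h1 : dist z' z < dist w z / 2 := hz'z.trans_le (min_le_left _ _)
  have h2 : dist x w < ρ / 16 ^ k / 16 := hxw.trans_le (min_le_right _ _)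
  have hzw : dist w z / 2 < dist w z' := by
    have := dist_triangle w z' z; linarith
  have hMK := (hK.ml z' hz').mk'
  have hvan : ∀ p ∈ frontier D.Ω, dist p w ≤ 2 * ρ → Tendsto (D.Ω.indicator (K z')) (𝓝[D.Ω] p) (𝓝 0) := by
    intro p hp hpw
    refine hMK.van p hp ?_
    rintro rfl
    rw [dist_comm] at hpw; linarith
  have hbd := hcar w hw ρ hρp (by linarith) _ hMK.hp hvan A hA hdA
  rw [indicator_of_mem hAΩ] at hbd
  have hBK := (hbB z' hz').2
  have := decay hw hρp (by linarith) (F := D.Ω.indicator (K z')) (A := C * B) (by positivity) hMK.hp.lc (fun p hp hpw =>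
    ⟨(hMK.hp.har p hp).ge, (hbd p hp hpw).trans (mul_le_mul_of_nonneg_left hBK hC.le)⟩)
    ((UVan_of_tendsto (D := D) (isCompact_closedBall w (2 * ρ)) (fun p hp hpw => hvan p hp hpw)).mono
      (fun p hp => by rw [mem_ball] at hp; rw [mem_closedBall]; linarith) (fun _ _ _ => le_rfl)) k x hx h2
  rw [indicator_of_mem hx] at this
  have hk' : D.qd ^ (k+1) ≤ e / (C * B) := by
    have := pow_pos D.qd_pos k
    rw [pow_succ]; nlinarith [D.qd_pos, D.qd_lt]
  rw [le_div_iff₀ (by positivity)] at hk'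
  linarith

lemma Kers.cont (hK : D.Kers x0 K) {x : ES N} (hx : x ∈ D.Ω) : ContinuousOn (fun z => K z x) (frontier D.Ω) := by
  intro z hz
  rw [ContinuousWithinAt, tendsto_iff_ultrafilter]
  intro U hU
  have hUf : ∀ᶠ z' in (U : Filter (ES N)), z' ∈ frontier D.Ω := hU self_mem_nhdsWithin
  have hex : ∀ p, ∃ g : ℝ, p ∈ D.Ω → Tendsto (fun z' => K z' p) U (𝓝 g) := by
    intro p
    by_cases hp : p ∈ D.Ω
    · obtain ⟨b, B, hb, hB, hbB⟩ := hK.bound hp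
      obtain ⟨g, _, hg⟩ := isCompact_Icc.ultrafilter_le_nhds (U.map fun z' => K z' p) (s := Icc b B) (by
        rw [le_principal_iff]
        exact hUf.mono fun z' hz' => ⟨(hbB z' hz').1, (hbB z' hz').2⟩)
      exact ⟨g, fun _ => hg⟩
    · exact ⟨0, fun h => absurd h hp⟩
  choose g hg using hex
  obtain ⟨hgh, hg0⟩ := harm_lim (D := D) (F := (U : Filter (ES N))) (u := K) (g := g)
    (hUf.mono fun z' hz' => ⟨(hK.ml z' hz').har, fun p hp => ((hK.ml z' hz').pos p hp).le⟩) hg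
  have hg1 : g x0 = 1 := by
    refine tendsto_nhds_unique (hg x0 hK.mem) ?_
    exact tendsto_const_nhds.congr' (hUf.mono fun z' hz' => (hK.one z' hz').symm)
  have hML : D.ML z g := by
    refine ⟨hgh, harm_pos hgh hg0 hK.mem (by rw [hg1]; exact one_pos), fun w hw hne => ?_⟩
    rw [Metric.tendsto_nhds]
    intro e he
    obtain ⟨s, hs, h⟩ := hK.unifvan hw hne (e / 2) (by positivity)
    filter_upwards [self_mem_nhdsWithin, mem_nhdsWithin_of_mem_nhds (ball_mem_nhds w hs)] with p hp hpw
    have h1 : g p ≤ e / 2 := by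
      refine le_of_tendsto (hg p hp) ?_
      have : ∀ᶠ z' in (U : Filter (ES N)), dist z' z < s := hU (mem_nhdsWithin_of_mem_nhds (ball_mem_nhds z hs))
      filter_upwards [hUf, this] with z' hz' hzs
      exact h z' hz' hzs p hp hpw
    rw [Real.dist_eq, sub_zero, abs_of_nonneg (hg0 p hp)]; linarith
  have e : g x = K z x := le_antisymm (ML.le hz hK.mem hML (hK.ml z hz) hg1 (hK.one z hz) x hx)
    (ML.le hz hK.mem (hK.ml z hz) hML (hK.one z hz) hg1 x hx)
  rw [← e]; exact hg x hx

lemma Kers.hh (hK : D.Kers x0 K) {z : ES N} (hz : z ∈ frontier D.Ω) : D.HH (K z) :=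
  HH.of_harm (hK.ml z hz).har fun p hp => ((hK.ml z hz).pos p hp).le

lemma Kers.jcont (hK : D.Kers x0 K) : ContinuousOn (fun p : ES N × ES N => K p.2 p.1) (D.Ω ×ˢ frontier D.Ω) := by
  rintro ⟨x, z⟩ ⟨hx, hz⟩
  rw [ContinuousWithinAt, Metric.tendsto_nhds]
  intro e he
  simp only at hx hz
  have hdx := D.d_pos hx
  obtain ⟨b, B, hb, hB, hbB⟩ := hK.bound hx
  set ε := min 1 (e / (8 * B)) with hε
  have hεp : 0 < ε := by positivity
  have hε2 : ε ≤ e / (8 * B) := min_le_right _ _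
  rw [le_div_iff₀ (by positivity)] at hε2
  have h1 : ∀ᶠ p : ES N × ES N in 𝓝[D.Ω ×ˢ frontier D.Ω] (x, z), dist (K p.2 x) (K z x) < e / 2 := by
    have hc := hK.cont hx z hz
    have : Tendsto (fun p : ES N × ES N => p.2) (𝓝[D.Ω ×ˢ frontier D.Ω] (x, z)) (𝓝[frontier D.Ω] z) := by
      refine tendsto_nhdsWithin_iff.2 ⟨(continuous_snd.tendsto (x, z)).mono_left nhdsWithin_le_nhds, ?_⟩
      filter_upwards [self_mem_nhdsWithin] with p hp using hp.2
    exact (Metric.tendsto_nhds.1 (hc.tendsto.comp this)) (e / 2) (by positivity)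
  have h2 : ∀ᶠ p : ES N × ES N in 𝓝[D.Ω ×ˢ frontier D.Ω] (x, z), dist p.1 x < D.tt ε * D.d x :=
    nhdsWithin_le_nhds ((continuous_fst.tendsto (x, z)) (ball_mem_nhds x (mul_pos (D.tt_pos ε) hdx)))
  filter_upwards [h1, h2, self_mem_nhdsWithin] with p h1 h2 hp
  have h3 := ((hK.hh hp.2).diff hεp (min_le_left _ _) hx (by rwa [dist_comm])).2
  have h4 := (hbB p.2 hp.2).2
  rw [Real.dist_eq] at h1 ⊢
  have h5 : 2 * ε * K p.2 x ≤ e / 4 := by nlinarith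
  rw [abs_lt] at h1 ⊢
  rw [abs_le] at h3
  constructor <;> linarith [h1.1, h1.2, h3.1, h3.2]

/-- harmonic function with density the restriction of `μ` to `O` -/
def uO (K : ES N → ES N → ℝ) (μ : Measure (ES N)) (O : Set (ES N)) (x : ES N) : ℝ := ∫ y in O, K y x ∂μ

variable {μ : Measure (ES N)} [IsFiniteMeasure μ]

lemma Kers.int (hK : D.Kers x0 K) {x : ES N} (hx : x ∈ D.Ω) {O : Set (ES N)} (hO : O ⊆ frontier D.Ω) :
    IntegrableOn (fun y => K y x) O μ :=
  ((hK.cont hx).integrableOn_compact D.frontier_compact).mono_set hO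

lemma Kers.uO_nn (hK : D.Kers x0 K) {x : ES N} (hx : x ∈ D.Ω) {O : Set (ES N)} (hOm : MeasurableSet O) (hO : O ⊆ frontier D.Ω) :
    0 ≤ uO K μ O x := setIntegral_nonneg hOm fun y hy => ((hK.ml y (hO hy)).pos x hx).le

lemma Kers.uO_harm (hK : D.Kers x0 K) {O : Set (ES N)} (hOm : MeasurableSet O) (hO : O ⊆ frontier D.Ω) :
    LVHarmonic D.Ω D.V (uO K μ O) := by
  have hHH : D.HH (uO K μ O) := by
    refine ⟨fun x hx => hK.uO_nn hx hOm hO, fun ε hε x hx x' hx' hd => ?_⟩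
    unfold uO
    rw [← integral_const_mul]
    exact setIntegral_mono_on (hK.int hx hO) ((hK.int hx' hO).const_mul _) hOm fun y hy => (hK.hh (hO hy)).hp ε hε x hx x' hx' hd
  rw [harm_iff hHH.cont]
  intro φ hφ
  have hΩm := D.isOpen.measurableSet
  have e1 : ∀ x, uO K μ O x * D.psi φ x = ∫ y in O, K y x * D.psi φ x ∂μ := fun x => by
    unfold uO; rw [integral_mul_const]
  simp_rw [e1]
  rw [integral_integral_swap]
  · rw [setIntegral_congr_fun hOm (g := fun _ => (0:ℝ))]
    · simp
    · intro y hy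
      exact (harm_iff (hK.ml y (hO hy)).har.1).1 (hK.ml y (hO hy)).har φ hφ
  · have hcomp : IsCompact (tsupport φ ×ˢ frontier D.Ω) := hφ.2.1.prod D.frontier_compact
    obtain ⟨B, hB⟩ := hcomp.exists_bound_of_continuousOn (hK.jcont.mono (prod_mono hφ.2.2 le_rfl))
    have hdom : Integrable (fun p : ES N × ES N => |D.psi φ p.1| * B) ((volume.restrict D.Ω).prod (μ.restrict O)) :=
      (psi_abs_int hφ).mul_prod (integrable_const B)
    refine hdom.mono' ?_ ?_
    · have m1 : AEStronglyMeasurable (fun p : ES N × ES N => K p.2 p.1) ((volume.restrict D.Ω).prod (μ.restrict O)) := by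
        rw [Measure.prod_restrict]
        exact (hK.jcont.mono (prod_mono le_rfl hO)).aestronglyMeasurable (hΩm.prod hOm)
      have m2 : AEStronglyMeasurable (D.psi φ) (volume.restrict D.Ω) := by
        have : Measurable (D.psi φ) := (lap_cont hφ.1).measurable.sub (D.V_meas.mul hφ.1.continuous.measurable)
        exact this.aestronglyMeasurable
      exact m1.mul m2.comp_fst
    · rw [Measure.prod_restrict]
      refine (ae_restrict_iff' (hΩm.prod hOm)).2 (ae_of_all _ ?_)
      rintro ⟨x, y⟩ ⟨hx, hy⟩
      simp only [Function.uncurry]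
      rw [norm_mul, Real.norm_eq_abs (D.psi φ x), mul_comm]
      by_cases hxs : x ∈ tsupport φ
      · exact mul_le_mul_of_nonneg_left (hB (x, y) ⟨hxs, hO hy⟩) (abs_nonneg _)
      · rw [psi_zero hxs, abs_zero, zero_mul, zero_mul]

lemma Kers.uO_hp (hK : D.Kers x0 K) {O : Set (ES N)} (hOm : MeasurableSet O) (hO : O ⊆ frontier D.Ω) :
    D.Hp (D.Ω.indicator (uO K μ O)) := Hp.of_harm (hK.uO_harm hOm hO) fun _ hx => hK.uO_nn hx hOm hO
end Dom
end

section
namespace Dom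
variable {N : ℕ} {D : Dom N}

lemma Sp.ball {σ : ℝ} (D : Dom N) (hσ : 0 < σ) : ∃ c > 0, ∀ q, D.Sp q → ∀ A ∈ D.Ω, ∀ b : ℝ, 0 ≤ b →
    (∀ p ∈ ball A (σ * D.d A), b ≤ q p) → ∀ p ∈ ball A (D.st * D.d A), c * b ≤ q p := by
  obtain ⟨c, hc, h⟩ := P_lower (D := D) (σ := σ / 2) (by positivity)
  refine ⟨c, hc, fun q hq A hA b hb hball p hp => ?_⟩
  have hpΩ := ball_st_sub hA hp
  have hdA := D.d_pos hA
  have h1 := D.st_lt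
  have h2 := D.st_pos
  rw [mem_ball] at hp
  have h3 := D.d_lip p A
  have h4 := D.d_lip A p
  rw [dist_comm] at h4
  have h5 : dist p A ≤ D.d A / 64 := by nlinarith
  refine (h q hq.lc p hpΩ A ?_ b hb (fun y hy => hq.nn y (D.cb_sub hpΩ hy)) ?_).trans (hq.sup p hpΩ)
  · rw [dist_comm]; unfold rr
    have hl := D.lam_pos
    have h6 : dist p A ≤ D.lam / 16 * D.d A := hp.le.trans (mul_le_mul_of_nonneg_right D.st_le hdA.le)
    have h7 : D.lam * (D.d A / 2) ≤ D.lam * D.d p := mul_le_mul_of_nonneg_left (by linarith) hl.le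
    have h8 := mul_pos hl hdA
    linarith
  · intro y hy
    refine hball y ?_
    rw [mem_ball] at hy ⊢
    refine hy.trans_le ?_
    nlinarith

/-- iterates towards the reduced function of `w` on `U` -/
def rd (D : Dom N) (U : Set (ES N)) (w : ES N → ℝ) : ℕ → ES N → ℝ
  | 0 => (U ∩ D.Ω).indicator w
  | n+1 => fun x => (U ∩ D.Ω).indicator w x + (D.Ω \ U).indicator (D.P (rd D U w n)) x

lemma rd_on {U : Set (ES N)} {w : ES N → ℝ} {x : ES N} (hx : x ∈ D.Ω) (hU : x ∈ U) (n : ℕ) : D.rd U w n x = w x := by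
  cases n with
  | zero => exact indicator_of_mem (show x ∈ U ∩ D.Ω from ⟨hU, hx⟩) _
  | succ n =>
    simp only [rd]
    rw [indicator_of_mem (show x ∈ U ∩ D.Ω from ⟨hU, hx⟩), indicator_of_notMem (fun h => h.2 hU), add_zero]

lemma rd_off {U : Set (ES N)} {w : ES N → ℝ} {x : ES N} (hx : x ∈ D.Ω) (hU : x ∉ U) (n : ℕ) : D.rd U w (n+1) x = D.P (D.rd U w n) x := by
  simp only [rd]
  rw [indicator_of_notMem (fun h => hU h.1), indicator_of_mem (show x ∈ D.Ω \ U from ⟨hx, hU⟩), zero_add]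

lemma rd_off0 {U : Set (ES N)} {w : ES N → ℝ} {x : ES N} (hU : x ∉ U) : D.rd U w 0 x = 0 :=
  indicator_of_notMem (fun h => hU h.1) _

lemma rd_meas {U : Set (ES N)} (hUm : MeasurableSet U) {w : ES N → ℝ} (hw : D.Hp w) (n : ℕ) : Measurable (D.rd U w n) := by
  have hΩ := D.isOpen.measurableSet
  induction n with
  | zero => exact hw.meas.indicator (hUm.inter hΩ)
  | succ n ih => exact (hw.meas.indicator (hUm.inter hΩ)).add ((P_meas ih).indicator (hΩ.diff hUm))

lemma rd_bd {U : Set (ES N)} (hUm : MeasurableSet U) {w : ES N → ℝ} (hw : D.Hp w) (n : ℕ) : ∀ x ∈ D.Ω, 0 ≤ D.rd U w n x ∧ D.rd U w n x ≤ w x := by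
  induction n with
  | zero =>
    intro x hx
    by_cases h : x ∈ U
    · rw [rd_on hx h]; exact ⟨hw.nn x hx, le_rfl⟩
    · rw [rd_off0 h]; exact ⟨le_rfl, hw.nn x hx⟩
  | succ n ih =>
    intro x hx
    have hlc : D.Lc (D.rd U w n) := Lc.of_le (rd_meas hUm hw n) (fun x hx => (ih x hx).1) (fun x hx => (ih x hx).2) hw.lc
    by_cases h : x ∈ U
    · rw [rd_on hx h]; exact ⟨hw.nn x hx, le_rfl⟩
    · rw [rd_off hx h]
      refine ⟨P_nonneg fun y hy => (ih y (D.cb_sub hx hy)).1, ?_⟩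
      rw [← hw.har x hx]
      exact P_mono hlc hw.lc hx fun y hy => (ih y (D.cb_sub hx hy)).2

lemma rd_lc {U : Set (ES N)} (hUm : MeasurableSet U) {w : ES N → ℝ} (hw : D.Hp w) (n : ℕ) : D.Lc (D.rd U w n) :=
  Lc.of_le (rd_meas hUm hw n) (fun x hx => (rd_bd hUm hw n x hx).1) (fun x hx => (rd_bd hUm hw n x hx).2) hw.lc

lemma rd_mono {U : Set (ES N)} (hUm : MeasurableSet U) {w : ES N → ℝ} (hw : D.Hp w) (n : ℕ) : ∀ x ∈ D.Ω, D.rd U w n x ≤ D.rd U w (n+1) x := by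
  induction n with
  | zero =>
    intro x hx
    by_cases h : x ∈ U
    · rw [rd_on hx h, rd_on hx h]
    · rw [rd_off0 h]; exact (rd_bd hUm hw 1 x hx).1
  | succ n ih =>
    intro x hx
    by_cases h : x ∈ U
    · rw [rd_on hx h, rd_on hx h]
    · rw [rd_off hx h, rd_off hx h]
      exact P_mono (rd_lc hUm hw n) (rd_lc hUm hw _) hx fun y hy => ih y (D.cb_sub hx hy)

lemma rd_lim {U : Set (ES N)} (hUm : MeasurableSet U) {w : ES N → ℝ} (hw : D.Hp w) :
    ∃ G, D.Sp G ∧ (∀ x ∈ D.Ω, Tendsto (fun n => D.rd U w n x) atTop (𝓝 (G x))) ∧ ∀ x ∈ D.Ω, x ∈ U → G x = w x := by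
  set G : ES N → ℝ := D.Ω.indicator (fun x => ⨆ n, D.rd U w n x) with hG
  have ht : ∀ x ∈ D.Ω, Tendsto (fun n => D.rd U w n x) atTop (𝓝 (G x)) := by
    intro x hx
    rw [hG, indicator_of_mem hx]
    refine tendsto_atTop_ciSup (monotone_nat_of_le_succ fun n => rd_mono hUm hw n x hx) ⟨w x, ?_⟩
    rintro _ ⟨n, rfl⟩
    exact (rd_bd hUm hw n x hx).2
  have hon : ∀ x ∈ D.Ω, x ∈ U → G x = w x := fun x hx hU =>
    tendsto_nhds_unique (ht x hx) (by simp_rw [rd_on hx hU]; exact tendsto_const_nhds)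
  have hm : Measurable G := (Measurable.iSup fun n => rd_meas hUm hw n).indicator D.isOpen.measurableSet
  have h0 : ∀ x ∈ D.Ω, 0 ≤ G x := fun x hx => ge_of_tendsto' (ht x hx) fun n => (rd_bd hUm hw n x hx).1
  have h1 : ∀ x ∈ D.Ω, G x ≤ w x := fun x hx => le_of_tendsto' (ht x hx) fun n => (rd_bd hUm hw n x hx).2
  have hlc : D.Lc G := Lc.of_le hm h0 h1 hw.lc
  refine ⟨G, ⟨hlc, h0, fun x hx => ?_⟩, ht, hon⟩
  by_cases hU : x ∈ U
  · rw [hon x hx hU, ← hw.har x hx]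
    exact P_mono hlc hw.lc hx fun y hy => h1 y (D.cb_sub hx hy)
  · have := P_tendsto (rd_lc hUm hw) hw.lc hx (fun n y hy => by
      rw [abs_of_nonneg (rd_bd hUm hw n y hy).1]; exact (rd_bd hUm hw n y hy).2) ht
    simp_rw [← rd_off hx hU] at this
    exact (tendsto_nhds_unique this ((tendsto_add_atTop_iff_nat 1).2 (ht x hx))).le

lemma Lc.sum {ι : Type*} (F : Finset ι) {f : ι → ES N → ℝ} (hf : ∀ i ∈ F, D.Lc (f i)) : D.Lc (fun x => ∑ i ∈ F, f i x) := by
  classical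
  induction F using Finset.induction_on with
  | empty => simpa using Lc.const (D := D) 0
  | insert i F hi ih =>
    simp_rw [Finset.sum_insert hi]
    exact (hf i (Finset.mem_insert_self _ _)).add (ih fun j hj => hf j (Finset.mem_insert_of_mem hj))

lemma P_sum {ι : Type*} (F : Finset ι) {f : ι → ES N → ℝ} (hf : ∀ i ∈ F, D.Lc (f i)) {x : ES N} (hx : x ∈ D.Ω) :
    D.P (fun x => ∑ i ∈ F, f i x) x = ∑ i ∈ F, D.P (f i) x := by
  classical
  induction F using Finset.induction_on with
  | empty => simp [P]
  | insert i F hi ih =>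
    simp_rw [Finset.sum_insert hi]
    have h2 : ∀ j ∈ F, D.Lc (f j) := fun j hj => hf j (Finset.mem_insert_of_mem hj)
    rw [P_add (hf i (Finset.mem_insert_self _ _)) (Lc.sum F h2) hx, ih h2]

lemma rd_sum {ι : Type*} (F : Finset ι) {U : Set (ES N)} (hUm : MeasurableSet U) {w : ι → ES N → ℝ} (hw : ∀ i ∈ F, D.Hp (w i))
    {q : ES N → ℝ} (hq : D.Sp q) (hU : ∀ x ∈ D.Ω, x ∈ U → ∑ i ∈ F, w i x ≤ q x) (n : ℕ) :
    ∀ x ∈ D.Ω, ∑ i ∈ F, D.rd U (w i) n x ≤ q x := by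
  induction n with
  | zero =>
    intro x hx
    by_cases h : x ∈ U
    · simp_rw [rd_on hx h]; exact hU x hx h
    · simp_rw [rd_off0 h]; simpa using hq.nn x hx
  | succ n ih =>
    intro x hx
    by_cases h : x ∈ U
    · simp_rw [rd_on hx h]; exact hU x hx h
    · simp_rw [rd_off hx h]
      have hlc : ∀ i ∈ F, D.Lc (D.rd U (w i) n) := fun i hi => rd_lc hUm (hw i hi) n
      rw [← P_sum F hlc hx]
      exact (P_mono (Lc.sum F hlc) hq.lc hx fun y hy => ih y (D.cb_sub hx hy)).trans (hq.sup x hx)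

section
variable {x0 : ES N} {K : ES N → ES N → ℝ} {μ : Measure (ES N)} [IsFiniteMeasure μ]

lemma Kers.uO_van (hK : D.Kers x0 K) {C O : Set (ES N)} (hC : IsCompact C) (hCf : C ⊆ frontier D.Ω) (hOm : MeasurableSet O) (hO : O ⊆ C)
    {z : ES N} (hz : z ∈ frontier D.Ω) (hzC : z ∉ C) : Tendsto (uO K μ O) (𝓝[D.Ω] z) (𝓝 0) := by
  rw [Metric.tendsto_nhds]
  intro e he
  set m := μ.real O + 1 with hm
  have hmp : 0 < m := by have : 0 ≤ μ.real O := measureReal_nonneg; linarith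
  have key : ∃ s > 0, ∀ z' ∈ frontier D.Ω, z' ∈ C → ∀ x ∈ D.Ω, dist x z < s → K z' x ≤ e / (2 * m) := by
    refine hC.induction_on (p := fun S => ∃ s > 0, ∀ z' ∈ frontier D.Ω, z' ∈ S → ∀ x ∈ D.Ω, dist x z < s → K z' x ≤ e / (2 * m))
      ⟨1, one_pos, by simp⟩ ?_ ?_ ?_
    · rintro S T hST ⟨s, hs, h⟩
      exact ⟨s, hs, fun z' hz' hzS => h z' hz' (hST hzS)⟩
    · rintro S T ⟨s, hs, h⟩ ⟨t, ht, h'⟩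
      refine ⟨min s t, lt_min hs ht, fun z' hz' hzS x hx hxz => ?_⟩
      rcases hzS with h1 | h1
      · exact h z' hz' h1 x hx (hxz.trans_le (min_le_left _ _))
      · exact h' z' hz' h1 x hx (hxz.trans_le (min_le_right _ _))
    · intro p hp
      obtain ⟨s, hs, h⟩ := hK.unifvan hz (fun e : z = p => hzC (e ▸ hp)) (e / (2 * m)) (by positivity)
      exact ⟨ball p s, mem_nhdsWithin_of_mem_nhds (ball_mem_nhds p hs), s, hs, fun z' hz' hzS x hx hxz => h z' hz' hzS x hx hxz⟩
  obtain ⟨s, hs, h⟩ := key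
  filter_upwards [self_mem_nhdsWithin, mem_nhdsWithin_of_mem_nhds (ball_mem_nhds z hs)] with x hx hxz
  have h0 := hK.uO_nn (μ := μ) hx hOm (hO.trans hCf)
  rw [Real.dist_eq, sub_zero, abs_of_nonneg h0]
  have h1 : uO K μ O x ≤ ∫ y in O, e / (2 * m) ∂μ :=
    setIntegral_mono_on (hK.int hx (hO.trans hCf)) (integrable_const _) hOm fun y hy => h y (hCf (hO hy)) (hO hy) x hx hxz
  rw [setIntegral_const, smul_eq_mul] at h1
  have h2 : μ.real O * (e / (2 * m)) ≤ m * (e / (2 * m)) := by gcongr; linarith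
  have h3 : m * (e / (2 * m)) = e / 2 := by field_simp
  linarith
end
end Dom
end

section
namespace Dom
variable {N : ℕ} {D : Dom N}

lemma Sp.const_mul {q : ES N → ℝ} (hq : D.Sp q) {c : ℝ} (hc : 0 ≤ c) : D.Sp (fun x => c * q x) :=
  ⟨hq.lc.const_mul c, fun x hx => mul_nonneg hc (hq.nn x hx), fun x hx => by
    rw [P_const_mul]; exact mul_le_mul_of_nonneg_left (hq.sup x hx) hc⟩

section
variable {x0 : ES N} {K : ES N → ES N → ℝ} {μ : Measure (ES N)} [IsFiniteMeasure μ]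

lemma Kers.uO_mono (hK : D.Kers x0 K) {x : ES N} (hx : x ∈ D.Ω) {O O' : Set (ES N)} (hm : MeasurableSet O') (h : O ⊆ O') (hO' : O' ⊆ frontier D.Ω) :
    uO K μ O x ≤ uO K μ O' x := by
  refine setIntegral_mono_set (hK.int hx hO') ?_ (HasSubset.Subset.eventuallyLE h)
  exact (ae_restrict_iff' hm).2 (ae_of_all _ fun y hy => ((hK.ml y (hO' hy)).pos x hx).le)

lemma cov_fin (hK : D.Kers x0 K) {κ σ : ℝ} (hκ : 1 ≤ κ) (hσ : 0 < σ) : ∃ c : ℝ, 0 < c ∧ ∀ q, D.Sp q → ∀ η : ℝ, 0 < η →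
    ∀ (F : Finset (ES N)) (r : ES N → ℝ) (X : ES N → ES N), (∀ y ∈ F, y ∈ frontier D.Ω ∧ 0 < r y ∧ r y < D.r0 ∧ X y ∈ D.Ω ∧
      dist (X y) y = r y ∧ r y ≤ κ * D.d (X y) ∧ ∀ p ∈ ball (X y) (σ * D.d (X y)), p ∈ D.Ω → η * uO K μ (frontier D.Ω) p ≤ q p) →
    (F : Set (ES N)).PairwiseDisjoint (fun y => closedBall y (r y)) → ∀ x ∈ D.Ω, (∀ y ∈ F, 3 * r y ≤ dist x y) →
    c * η * uO K μ (⋃ y ∈ F, closedBall y (r y) ∩ frontier D.Ω) x ≤ q x := by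
  have hfm : MeasurableSet (frontier D.Ω) := isClosed_frontier.measurableSet
  set σ' := min σ D.st with hσ'
  have hσp : 0 < σ' := lt_min hσ D.st_pos
  obtain ⟨c1, hc1, h1⟩ := Sp.ball D hσp
  obtain ⟨c2, hc2, h2⟩ := shell D (K := 1) (ε := 1 / κ) le_rfl (by positivity) (by rw [div_le_one (by positivity)]; exact hκ)
  have hch := D.ch_pos
  refine ⟨c1 * D.ch * c2, by positivity, ?_⟩
  intro q hq η hη F r X hF hdis x hx hxF
  set O : ES N → Set (ES N) := fun y => closedBall y (r y) ∩ frontier D.Ω with hO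
  have hOm : ∀ y, MeasurableSet (O y) := fun y => isClosed_closedBall.measurableSet.inter hfm
  have hOf : ∀ y, O y ⊆ frontier D.Ω := fun y => inter_subset_right
  set w : ES N → ES N → ℝ := fun y => D.Ω.indicator (uO K μ (O y)) with hw
  have hwp : ∀ y, D.Hp (w y) := fun y => hK.uO_hp (hOm y) (hOf y)
  have hsum : ∀ p ∈ D.Ω, ∑ y ∈ F, w y p = uO K μ (⋃ y ∈ F, O y) p := by
    intro p hp
    unfold uO
    rw [integral_biUnion_finset F (fun y _ => hOm y)]
    · refine Finset.sum_congr rfl fun y _ => ?_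
      simp only [hw]; rw [indicator_of_mem hp]; rfl
    · intro y hy y' hy' hne
      exact (hdis hy hy' hne).mono inter_subset_left inter_subset_left
    · intro y _; exact hK.int hp (hOf y)
  set U : Set (ES N) := ⋃ y ∈ F, Metric.ball (X y) (σ' * D.d (X y)) with hU
  have hUm : MeasurableSet U := (isOpen_biUnion fun y _ => isOpen_ball).measurableSet
  have hq' : D.Sp (fun x => η⁻¹ * q x) := hq.const_mul (by positivity)
  have hUq : ∀ p ∈ D.Ω, p ∈ U → ∑ y ∈ F, w y p ≤ η⁻¹ * q p := by
    intro p hp hpU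
    rw [hsum p hp]
    obtain ⟨y, hy, hpy⟩ := mem_iUnion₂.1 hpU
    have h3 := (hF y hy).2.2.2.2.2.2 p (ball_subset_ball (mul_le_mul_of_nonneg_right (min_le_left _ _) (D.d_nonneg _)) hpy) hp
    have h4 : uO K μ (⋃ y ∈ F, O y) p ≤ uO K μ (frontier D.Ω) p := hK.uO_mono hp hfm (iUnion₂_subset fun y _ => hOf y) le_rfl
    rw [inv_mul_eq_div, le_div_iff₀ hη]
    nlinarith
  choose G hGS hGt hGU using fun y => rd_lim hUm (hwp y)
  have hGsum : ∑ y ∈ F, G y x ≤ η⁻¹ * q x :=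
    le_of_tendsto' (tendsto_finsetSum F fun y _ => hGt y x hx) fun n => rd_sum F hUm (fun y _ => hwp y) hq' hUq n x hx
  have hGw : ∀ y ∈ F, c1 * D.ch * c2 * w y x ≤ G y x := by
    intro y hy
    obtain ⟨hyf, hr0, hrr, hXΩ, hXd, hXκ, -⟩ := hF y hy
    have hvan : ∀ z ∈ frontier D.Ω, r y < dist z y → Tendsto (w y) (𝓝[D.Ω] z) (𝓝 0) := by
      intro z hz hzy
      refine tendsto_ind (hK.uO_van (C := O y) ((D.frontier_compact).inter_left isClosed_closedBall) (hOf y) (hOm y) le_rfl hz ?_)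
      intro h
      exact absurd (mem_closedBall.1 h.1) (not_le.2 hzy)
    have hb : ∀ p ∈ Metric.ball (X y) (D.st * D.d (X y)), c1 * (D.ch * w y (X y)) ≤ G y p := by
      refine h1 _ (hGS y) _ hXΩ _ (mul_nonneg hch.le ((hwp y).nn _ hXΩ)) fun p hp => ?_
      have hp' : p ∈ Metric.ball (X y) (D.st * D.d (X y)) := ball_subset_ball (mul_le_mul_of_nonneg_right (min_le_right _ _) (D.d_nonneg _)) hp
      rw [hGU y p (ball_st_sub hXΩ hp') (mem_iUnion₂.2 ⟨y, hy, hp⟩)]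
      exact (hwp y).ball_le hXΩ hp'
    have hcc : 0 < c1 * D.ch := by positivity
    have := h2 y hyf (r y) hr0 hrr _ (hwp y) hvan (X y) (by rw [hXd, one_mul]) (by
      rw [one_div, inv_mul_eq_div, div_le_iff₀ (by positivity)]; linarith) _ ((hGS y).const_mul (c := (c1 * D.ch)⁻¹) (by positivity)) (by
      intro p hp
      rw [inv_mul_eq_div, le_div_iff₀ hcc]
      have := hb p hp; linarith) x hx (hxF y hy)
    rw [inv_mul_eq_div, le_div_iff₀ hcc] at this
    linarith
  have h5 : c1 * D.ch * c2 * ∑ y ∈ F, w y x ≤ η⁻¹ * q x := by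
    rw [Finset.mul_sum]; exact (Finset.sum_le_sum hGw).trans hGsum
  rw [hsum x hx, inv_mul_eq_div, le_div_iff₀ hη] at h5
  linarith

/-- covering lemma -/
lemma COV (hK : D.Kers x0 K) {κ σ η : ℝ} (hκ : 1 ≤ κ) (hσ : 0 < σ) (hη : 0 < η) {q : ES N → ℝ} (hq : D.Sp q) {E : Set (ES N)}
    (hEf : E ⊆ frontier D.Ω)
    (hE : ∀ y ∈ E, ∀ ρ > 0, ∃ x ∈ D.Ω, dist x y < ρ ∧ dist x y ≤ κ * D.d x ∧
      ∀ p ∈ ball x (σ * D.d x), p ∈ D.Ω → η * uO K μ (frontier D.Ω) p ≤ q p) :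
    ∃ O : Set (ES N), MeasurableSet O ∧ O ⊆ frontier D.Ω ∧ μ (E \ O) = 0 ∧ ∃ c > 0, ∀ x ∈ D.Ω, c * uO K μ O x ≤ q x := by
  have hfm : MeasurableSet (frontier D.Ω) := isClosed_frontier.measurableSet
  obtain ⟨c, hc, h⟩ := cov_fin (μ := μ) hK hκ hσ
  have hr0 := D.r0_pos
  have key : ∀ n : ℕ, ∃ O : Set (ES N), MeasurableSet O ∧ O ⊆ frontier D.Ω ∧ μ (E \ O) = 0 ∧
      ∀ x ∈ D.Ω, 3 / (n + 1 : ℝ) ≤ D.d x → c * η * uO K μ O x ≤ q x := by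
    intro n
    set R : ℝ := min D.r0 (1 / (n + 1)) with hR
    have hRp : 0 < R := by positivity
    set f : ES N → Set ℝ := fun y => {t | ∃ x ∈ D.Ω, dist x y = t ∧ dist x y ≤ κ * D.d x ∧
      ∀ p ∈ ball x (σ * D.d x), p ∈ D.Ω → η * uO K μ (frontier D.Ω) p ≤ q p} with hf
    obtain ⟨t, r, htc, htE, htr, htμ, htd⟩ := Besicovitch.exists_disjoint_closedBall_covering_ae μ f E (by
      intro y hy δ hδ
      obtain ⟨x, hx, h1, h2, h3⟩ := hE y hy δ hδ
      refine ⟨dist x y, ⟨x, hx, rfl, h2, h3⟩, dist_pos.2 ?_, h1⟩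
      rintro rfl
      exact D.frontier_notMem (hEf hy) hx) (fun _ => R) (fun _ _ => hRp)
    have hX : ∀ y, ∃ x, y ∈ t → x ∈ D.Ω ∧ dist x y = r y ∧ dist x y ≤ κ * D.d x ∧
        ∀ p ∈ ball x (σ * D.d x), p ∈ D.Ω → η * uO K μ (frontier D.Ω) p ≤ q p := by
      intro y
      by_cases hy : y ∈ t
      · obtain ⟨x, hx, h'⟩ := (htr y hy).1
        exact ⟨x, fun _ => ⟨hx, h'⟩⟩
      · exact ⟨y, fun h => absurd h hy⟩
    choose X hX using hX
    have hm : ∀ y, MeasurableSet (closedBall y (r y) ∩ frontier D.Ω) := fun y => isClosed_closedBall.measurableSet.inter hfm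
    refine ⟨⋃ y ∈ t, closedBall y (r y) ∩ frontier D.Ω, MeasurableSet.biUnion htc fun y _ => hm y,
      iUnion₂_subset fun y _ => inter_subset_right, ?_, ?_⟩
    · refine measure_mono_null ?_ htμ
      rintro y ⟨hyE, hy⟩
      refine ⟨hyE, fun hy' => hy ?_⟩
      obtain ⟨z, hz, hyz⟩ := mem_iUnion₂.1 hy'
      exact mem_iUnion₂.2 ⟨z, hz, hyz, hEf hyE⟩
    · intro x hx hxd
      have hfin : ∀ F : Finset (ES N), (F : Set (ES N)) ⊆ t → c * η * uO K μ (⋃ y ∈ F, closedBall y (r y) ∩ frontier D.Ω) x ≤ q x := by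
        intro F hFt
        refine h q hq η hη F r X (fun y hy => ?_) (htd.subset hFt) x hx fun y hy => ?_
        · have hyt := hFt hy
          obtain ⟨a1, a2, a3, a4⟩ := hX y hyt
          have a5 := (htr y hyt).2
          exact ⟨hEf (htE hyt), a5.1, a5.2.trans_le (min_le_left _ _), a1, a2, a2 ▸ a3, a4⟩
        · have hyt := hFt hy
          have a5 := (htr y hyt).2.2
          have a6 : r y < 1 / (n + 1) := a5.trans_le (min_le_right _ _)
          have a7 := D.d_le_dist (hEf (htE hyt)) x
          have : 3 / (n + 1 : ℝ) = 3 * (1 / (n + 1)) := by ring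
          linarith
      have hct : Countable t := htc.to_subtype
      rcases isEmpty_or_nonempty t with he | he
      · have := hfin ∅ (by simp)
        have e : t = ∅ := isEmpty_coe_sort.1 he
        subst e
        simpa using this
      · obtain ⟨g, hg⟩ := exists_surjective_nat t
        set S : ℕ → Set (ES N) := fun k => ⋃ i ∈ Finset.range k, closedBall (g i : ES N) (r (g i)) ∩ frontier D.Ω with hS
        have hSm : Monotone S := fun i j hij => biUnion_subset_biUnion_left fun a ha => by
          simp only [Finset.coe_range, Finset.mem_coe, Finset.mem_range, mem_Iio] at ha ⊢; omega
        have hSU : (⋃ k, S k) = ⋃ y ∈ t, closedBall y (r y) ∩ frontier D.Ω := by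
          ext p
          constructor
          · intro hp
            obtain ⟨k, hk⟩ := mem_iUnion.1 hp
            obtain ⟨i, _, hi⟩ := mem_iUnion₂.1 hk
            exact mem_iUnion₂.2 ⟨g i, (g i).2, hi⟩
          · intro hp
            obtain ⟨y, hy, hyp⟩ := mem_iUnion₂.1 hp
            obtain ⟨i, hi⟩ := hg ⟨y, hy⟩
            refine mem_iUnion.2 ⟨i + 1, mem_iUnion₂.2 ⟨i, Finset.self_mem_range_succ i, ?_⟩⟩
            rw [hi]; exact hyp
        have hSms : ∀ k, MeasurableSet (S k) := fun k => Finset.measurableSet_biUnion _ fun i _ => hm _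
        have ht : Tendsto (fun k => uO K μ (S k) x) atTop (𝓝 (uO K μ (⋃ k, S k) x)) :=
          tendsto_setIntegral_of_monotone hSms hSm (hK.int hx (iUnion_subset fun k => iUnion₂_subset fun i _ => inter_subset_right))
        rw [← hSU]
        refine le_of_tendsto' (ht.const_mul (c * η)) fun k => ?_
        classical
        have := hfin ((Finset.range k).image fun i => (g i : ES N)) (by
          intro y hy
          simp only [Finset.coe_image, Set.mem_image] at hy
          obtain ⟨i, _, rfl⟩ := hy
          exact (g i).2)
        rwa [Finset.set_biUnion_finset_image] at this
  choose O hOm hOf hOE hOq using key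
  refine ⟨⋂ n, O n, MeasurableSet.iInter hOm, (iInter_subset _ 0).trans (hOf 0), ?_, c * η, by positivity, fun x hx => ?_⟩
  · rw [diff_iInter]; exact measure_iUnion_null hOE
  · obtain ⟨n, hn⟩ := exists_nat_gt (3 / D.d x)
    have hdx := D.d_pos hx
    have := hOq n x hx (by
      rw [div_le_iff₀ (by positivity)]
      rw [div_lt_iff₀ hdx] at hn
      nlinarith)
    refine le_trans ?_ this
    exact mul_le_mul_of_nonneg_left (hK.uO_mono hx (hOm n) (iInter_subset _ n) (hOf n)) (by positivity)
end
end Dom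
end

section
namespace Dom
variable {N : ℕ} {D : Dom N}

lemma Sp.min {q q' : ES N → ℝ} (hq : D.Sp q) (hq' : D.Sp q') : D.Sp (fun x => min (q x) (q' x)) :=
  ⟨hq.lc.min hq'.lc, fun x hx => le_min (hq.nn x hx) (hq'.nn x hx), fun x hx => le_min
    ((P_mono (hq.lc.min hq'.lc) hq.lc hx fun _ _ => min_le_left _ _).trans (hq.sup x hx))
    ((P_mono (hq.lc.min hq'.lc) hq'.lc hx fun _ _ => min_le_right _ _).trans (hq'.sup x hx))⟩

/-- two-sided Harnack on small balls -/
lemma Hp.two {f : ES N → ℝ} (hf : D.Hp f) {ε : ℝ} (hε : 0 < ε) {x p : ES N} (hx : x ∈ D.Ω)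
    (hp : dist p x < Min.min (1/2) (D.sg ε / 2) * D.d x) : p ∈ D.Ω ∧ f x ≤ (1 + ε) * f p ∧ f p ≤ (1 + ε) * f x := by
  have hdx := D.d_pos hx
  have hsg := D.sg_pos ε
  have a1 : dist p x < 1 / 2 * D.d x := hp.trans_le (mul_le_mul_of_nonneg_right (min_le_left _ _) hdx.le)
  have a2 : dist p x < D.sg ε / 2 * D.d x := hp.trans_le (mul_le_mul_of_nonneg_right (min_le_right _ _) hdx.le)
  have a3 := D.d_lip x p
  rw [dist_comm] at a3
  have a4 : D.d x / 2 < D.d p := by linarith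
  have hpΩ : p ∈ D.Ω := D.mem_of_pos (by linarith)
  refine ⟨hpΩ, hf.hp ε hε x hx p (by rw [dist_comm]; nlinarith), hf.hp ε hε p hpΩ x ?_⟩
  nlinarith

section
variable {x0 : ES N} {K : ES N → ES N → ℝ} {μ : Measure (ES N)} [IsFiniteMeasure μ]

lemma Kers.null_of_le (hK : D.Kers x0 K) {O : Set (ES N)} (hOm : MeasurableSet O) (hO : O ⊆ frontier D.Ω) (h : uO K μ O x0 ≤ 0) :
    μ O = 0 := by
  unfold uO at h
  rw [setIntegral_congr_fun hOm (g := fun _ => (1:ℝ)) (fun y hy => hK.one y (hO hy))] at h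
  rw [setIntegral_const, smul_eq_mul, mul_one] at h
  have : μ.real O = 0 := le_antisymm h measureReal_nonneg
  exact (measureReal_eq_zero_iff).1 this

lemma Kers.null_of_tendsto (hK : D.Kers x0 K) {O : Set (ES N)} (hOm : MeasurableSet O) (hO : O ⊆ frontier D.Ω)
    (h : ∀ z ∈ frontier D.Ω, Tendsto (uO K μ O) (𝓝[D.Ω] z) (𝓝 0)) : μ O = 0 := by
  have hp : D.Hp (D.Ω.indicator (uO K μ O)) := hK.uO_hp hOm hO
  have hC : IsCompact (closure D.Ω) := D.hbd.isCompact_closure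
  have ht : ∀ z ∈ frontier D.Ω, z ∈ closure D.Ω → Tendsto (D.Ω.indicator (uO K μ O)) (𝓝[D.Ω] z) (𝓝 0) := fun z hz _ => tendsto_ind (h z hz)
  obtain ⟨B, hB⟩ := bdd_of_tendsto hC hp.cont ht
  have := MPL hp.lc (S := D.Ω) le_rfl (fun x hx => (hp.har x hx).ge) (fun x hx y hy hyn => absurd (D.cb_sub hx hy) hyn)
    (fun x hx => hB x hx (subset_closure hx)) ((UVan_of_tendsto hC ht).mono subset_closure fun _ _ _ => le_rfl) x0 hK.mem
  rw [indicator_of_mem hK.mem] at this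
  exact hK.null_of_le hOm hO this

lemma ntzero (hK : D.Kers x0 K) {q h : ES N → ℝ} (hq : D.Sp q)
    (hnull : ∀ O : Set (ES N), MeasurableSet O → O ⊆ frontier D.Ω → ∀ c > 0, (∀ x ∈ D.Ω, c * uO K μ O x ≤ q x) → μ O = 0)
    (hbump : ∀ ε > 0, ∀ M : ℕ, ∃ σ > 0, ∃ η > 0, ∀ x ∈ D.Ω, h x ≤ M * uO K μ (frontier D.Ω) x → ε * uO K μ (frontier D.Ω) x < q x →
      ∀ p ∈ ball x (σ * D.d x), p ∈ D.Ω → η * uO K μ (frontier D.Ω) p ≤ q p) :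
    ∀ᵐ y ∂μ, y ∈ frontier D.Ω → ∀ κ : ℝ, ∀ M : ℕ, ∀ ε > 0, ∃ ρ > 0, ∀ x ∈ D.Ω, dist x y < ρ → dist x y ≤ κ * D.d x →
      h x ≤ M * uO K μ (frontier D.Ω) x → q x ≤ ε * uO K μ (frontier D.Ω) x := by
  have hfm : MeasurableSet (frontier D.Ω) := isClosed_frontier.measurableSet
  have key : ∀ k M n : ℕ, ∀ᵐ y ∂μ, y ∈ frontier D.Ω → ∃ ρ > 0, ∀ x ∈ D.Ω, dist x y < ρ → dist x y ≤ (k + 1 : ℝ) * D.d x →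
      h x ≤ M * uO K μ (frontier D.Ω) x → q x ≤ 1 / (n + 1 : ℝ) * uO K μ (frontier D.Ω) x := by
    intro k M n
    obtain ⟨σ, hσ, η, hη, hb⟩ := hbump (1 / (n + 1 : ℝ)) (by positivity) M
    set E : Set (ES N) := {y | ¬ (y ∈ frontier D.Ω → ∃ ρ > 0, ∀ x ∈ D.Ω, dist x y < ρ → dist x y ≤ (k + 1 : ℝ) * D.d x →
      h x ≤ M * uO K μ (frontier D.Ω) x → q x ≤ 1 / (n + 1 : ℝ) * uO K μ (frontier D.Ω) x)} with hE
    have hEE : ∀ y ∈ E, y ∈ frontier D.Ω ∧ ∀ ρ > 0, ∃ x ∈ D.Ω, dist x y < ρ ∧ dist x y ≤ (k + 1 : ℝ) * D.d x ∧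
        h x ≤ M * uO K μ (frontier D.Ω) x ∧ 1 / (n + 1 : ℝ) * uO K μ (frontier D.Ω) x < q x := by
      intro y hy
      have hy' : ¬ (y ∈ frontier D.Ω → ∃ ρ > 0, ∀ x ∈ D.Ω, dist x y < ρ → dist x y ≤ (k + 1 : ℝ) * D.d x →
        h x ≤ M * uO K μ (frontier D.Ω) x → q x ≤ 1 / (n + 1 : ℝ) * uO K μ (frontier D.Ω) x) := hy
      push Not at hy'
      exact hy'
    obtain ⟨O, hOm, hOf, hEO, c, hc, hcq⟩ := COV hK (μ := μ) (κ := k + 1) (by linarith [(Nat.cast_nonneg k : (0:ℝ) ≤ k)]) hσ hη hq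
      (E := E) (fun y hy => (hEE y hy).1) (by
        intro y hy ρ hρ
        obtain ⟨x, hx, b1, b2, b3, b4⟩ := (hEE y hy).2 ρ hρ
        exact ⟨x, hx, b1, b2, hb x hx b3 b4⟩)
    have hO := hnull O hOm hOf c hc hcq
    have : μ E = 0 := measure_mono_null (fun y hy => by
      by_cases h : y ∈ O
      · exact Or.inr h
      · exact Or.inl ⟨hy, h⟩) (measure_union_null hEO hO)
    exact this
  have := ae_all_iff.2 fun k => ae_all_iff.2 fun M => ae_all_iff.2 (key k M)
  filter_upwards [this] with y hy hyf κ M ε hε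
  obtain ⟨k, hk⟩ := exists_nat_ge κ
  obtain ⟨n, hn⟩ := exists_nat_one_div_lt hε
  obtain ⟨ρ, hρ, hh⟩ := hy k M n hyf
  refine ⟨ρ, hρ, fun x hx h1 h2 h3 => (hh x hx h1 (h2.trans ?_) h3).trans ?_⟩
  · exact mul_le_mul_of_nonneg_right (by linarith) (D.d_nonneg x)
  · exact mul_le_mul_of_nonneg_right hn.le (hK.uO_nn hx hfm le_rfl)

lemma far0 (hK : D.Kers x0 K) {z1 z2 : ES N} (h1 : z1 ∈ frontier D.Ω) (h2 : z2 ∈ frontier D.Ω) (hne : z1 ≠ z2) :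
    ∀ᵐ y ∂μ, y ∈ frontier D.Ω → ∀ κ : ℝ, ∀ ε > 0, ∃ ρ > 0, ∀ x ∈ D.Ω, dist x y < ρ → dist x y ≤ κ * D.d x →
      min (D.Ω.indicator (K z1) x) (D.Ω.indicator (K z2) x) ≤ ε * uO K μ (frontier D.Ω) x := by
  have hfm : MeasurableSet (frontier D.Ω) := isClosed_frontier.measurableSet
  have m1 := (hK.ml z1 h1).mk'
  have m2 := (hK.ml z2 h2).mk'
  have hu : D.Hp (D.Ω.indicator (uO K μ (frontier D.Ω))) := hK.uO_hp hfm le_rfl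
  have := ntzero hK (μ := μ) (q := fun x => min (D.Ω.indicator (K z1) x) (D.Ω.indicator (K z2) x)) (h := fun _ => 0) (m1.hp.sp.min m2.hp.sp) ?_ ?_
  · filter_upwards [this] with y hy hyf κ ε hε
    obtain ⟨ρ, hρ, h⟩ := hy hyf κ 0 ε hε
    exact ⟨ρ, hρ, fun x hx a b => h x hx a b (by simp)⟩
  · intro O hOm hO c hc hle
    refine hK.null_of_tendsto hOm hO fun z hz => ?_
    have hle1 : ∀ x ∈ D.Ω, uO K μ O x ≤ c⁻¹ * D.Ω.indicator (K z1) x := fun x hx => by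
      rw [inv_mul_eq_div, le_div_iff₀ hc]; have := (hle x hx).trans (min_le_left _ _); linarith
    have hle2 : ∀ x ∈ D.Ω, uO K μ O x ≤ c⁻¹ * D.Ω.indicator (K z2) x := fun x hx => by
      rw [inv_mul_eq_div, le_div_iff₀ hc]; have := (hle x hx).trans (min_le_right _ _); linarith
    have h0 : ∀ᶠ x in 𝓝[D.Ω] z, 0 ≤ uO K μ O x := by
      filter_upwards [self_mem_nhdsWithin] with x hx using hK.uO_nn hx hOm hO
    by_cases hz1 : z = z1
    · have ht := (m2.van z hz (hz1 ▸ hne)).const_mul c⁻¹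
      rw [mul_zero] at ht
      exact tendsto_of_tendsto_of_tendsto_of_le_of_le' tendsto_const_nhds ht h0 (by filter_upwards [self_mem_nhdsWithin] with x hx using hle2 x hx)
    · have ht := (m1.van z hz hz1).const_mul c⁻¹
      rw [mul_zero] at ht
      exact tendsto_of_tendsto_of_tendsto_of_le_of_le' tendsto_const_nhds ht h0 (by filter_upwards [self_mem_nhdsWithin] with x hx using hle1 x hx)
  · intro ε hε M
    refine ⟨Min.min (1/2) (D.sg 1 / 2), lt_min (by norm_num) (by have := D.sg_pos 1; positivity), ε / 4, by positivity, ?_⟩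
    intro x hx _ hlt p hp hpΩ
    have b1 := (m1.hp.two one_pos hx hp).2.1
    have b2 := (m2.hp.two one_pos hx hp).2.1
    have b3 := (hu.two one_pos hx hp).2.2
    rw [indicator_of_mem hx, indicator_of_mem hpΩ] at b3
    have b4 := hlt.trans_le (min_le_left _ _)
    have b5 := hlt.trans_le (min_le_right _ _)
    have b6 : ε * uO K μ (frontier D.Ω) p ≤ ε * ((1 + 1) * uO K μ (frontier D.Ω) x) := mul_le_mul_of_nonneg_left b3 hε.le
    refine le_min ?_ ?_ <;> linarith

lemma far (hK : D.Kers x0 K) {t0 : ℝ} (ht0 : 0 < t0) :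
    ∀ᵐ y ∂μ, y ∈ frontier D.Ω → ∀ κ : ℝ, ∀ ε > 0, ∃ ρ > 0, ∀ x ∈ D.Ω, dist x y < ρ → dist x y ≤ κ * D.d x →
      ∀ z ∈ frontier D.Ω, t0 ≤ dist z y → K z x ≤ ε * uO K μ (frontier D.Ω) x := by
  by_cases hne : ∃ z1 ∈ frontier D.Ω, ∃ z2 ∈ frontier D.Ω, z1 ≠ z2
  swap
  · push Not at hne
    refine ae_of_all _ fun y hy κ ε hε => ⟨1, one_pos, fun x hx _ _ z hz hzy => ?_⟩
    rw [hne z hz y hy, dist_self] at hzy; linarith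
  obtain ⟨z1, h1, z2, h2, hne⟩ := hne
  have hfm : MeasurableSet (frontier D.Ω) := isClosed_frontier.measurableSet
  have hr := D.r0_pos
  have m1 := (hK.ml z1 h1).mk'
  have m2 := (hK.ml z2 h2).mk'
  obtain ⟨c, hc, hBH⟩ := BH D (K := 1) (ε := D.c0) le_rfl D.c0_pos (by linarith [D.c0_le])
  filter_upwards [far0 hK (μ := μ) h1 h2 hne] with y hy hyf κ ε hε
  set ρ := min (D.r0 / 2) (t0 / 2) with hρ
  have hρp : 0 < ρ := by positivity
  have q1 : ρ ≤ D.r0 / 2 := min_le_left _ _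
  have q2 : ρ ≤ t0 / 2 := min_le_right _ _
  obtain ⟨hA, hdA⟩ := cork hyf hρp (by linarith)
  set A := y + ρ • D.ev y
  have hAΩ : A ∈ D.Ω := D.mem_of_pos (lt_of_lt_of_le (mul_pos D.c0_pos hρp) hdA)
  obtain ⟨b, B, hb, hB, hbB⟩ := hK.bound hAΩ
  have hch := D.ch_pos
  set T := B / (D.ch * b) with hT
  have hTp : 0 < T := by positivity
  have hSp := (m1.hp.sp.min m2.hp.sp).const_mul hTp.le
  obtain ⟨ρ', hρ', h⟩ := hy hyf κ (ε * c / T) (by positivity)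
  refine ⟨min ρ' (ρ / 8), by positivity, fun x hx hxy hxκ z hz hzy => ?_⟩
  have a1 := h x hx (hxy.trans_le (min_le_left _ _)) hxκ
  have mz := (hK.ml z hz).mk'
  have a2 := hBH y hyf ρ hρp (by linarith) _ mz.hp (fun w hw hwy => mz.van w hw (by rintro rfl; linarith)) A hA hdA _ hSp (by
    intro p hp
    have b1 := m1.hp.ball_le hAΩ hp
    have b2 := m2.hp.ball_le hAΩ hp
    rw [indicator_of_mem hAΩ] at b1 b2 ⊢
    have b3 := (hbB z1 h1).1
    have b4 := (hbB z2 h2).1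
    have b5 := (hbB z hz).2
    have b6 : D.ch * b ≤ min (D.Ω.indicator (K z1) p) (D.Ω.indicator (K z2) p) := le_min
      ((mul_le_mul_of_nonneg_left b3 hch.le).trans b1) ((mul_le_mul_of_nonneg_left b4 hch.le).trans b2)
    have b7 : T * (D.ch * b) = B := by rw [hT]; field_simp
    have := mul_le_mul_of_nonneg_left b6 hTp.le
    linarith) x hx (hxy.trans_le (min_le_right _ _))
  rw [indicator_of_mem hx (K z)] at a2
  have a3 := mul_le_mul_of_nonneg_left a1 hTp.le
  have a4 : T * (ε * c / T * uO K μ (frontier D.Ω) x) = c * (ε * uO K μ (frontier D.Ω) x) := by field_simp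
  exact le_of_mul_le_mul_left (by linarith) hc
end
end Dom
end

section
lemma lower_cmp {l m : Measure ℝ} {η : ℝ≥0∞} (h : ∀ t, l (Iic t) ≤ η * m (Iic t)) {S : Set ℝ} (hS : IsLowerSet S) :
    l S ≤ η * m S := by
  by_cases hmax : ∃ b ∈ S, ∀ x ∈ S, x ≤ b
  · obtain ⟨b, hb, hbm⟩ := hmax
    have : S = Iic b := Set.ext fun x => ⟨fun hx => hbm x hx, fun hx => hS hx hb⟩
    rw [this]; exact h b
  · push Not at hmax
    have e : S = ⋃ q : {q : ℚ // (q : ℝ) ∈ S}, Iic ((q : ℚ) : ℝ) := by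
      ext x
      simp only [mem_iUnion, mem_Iic]
      constructor
      · intro hx
        obtain ⟨x', hx', hlt⟩ := hmax x hx
        obtain ⟨q, hq1, hq2⟩ := exists_rat_btwn hlt
        exact ⟨⟨q, hS hq2.le hx'⟩, hq1.le⟩
      · rintro ⟨⟨q, hq⟩, hxq⟩
        exact hS hxq hq
    have hdir : Directed (· ⊆ ·) (fun q : {q : ℚ // (q : ℝ) ∈ S} => Iic ((q : ℚ) : ℝ)) := by
      intro p q
      rcases le_total p.1 q.1 with hpq | hpq
      · exact ⟨q, Iic_subset_Iic.2 (by exact_mod_cast hpq), le_rfl⟩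
      · exact ⟨p, le_rfl, Iic_subset_Iic.2 (by exact_mod_cast hpq)⟩
    calc l S = ⨆ q : {q : ℚ // (q : ℝ) ∈ S}, l (Iic ((q : ℚ) : ℝ)) := by
          conv_lhs => rw [e]
          exact hdir.measure_iUnion
      _ ≤ η * m S := iSup_le fun q => (h _).trans (by
          gcongr
          exact fun x hx => hS hx q.2)

lemma antitone_cmp {l m : Measure ℝ} {η : ℝ≥0∞} (h : ∀ t, l (Iic t) ≤ η * m (Iic t)) {g : ℝ → ℝ} (hg : Antitone g)
    (h0 : ∀ t, 0 ≤ g t) : ∫⁻ t, ENNReal.ofReal (g t) ∂l ≤ η * ∫⁻ t, ENNReal.ofReal (g t) ∂m := by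
  rw [lintegral_eq_lintegral_meas_lt l (ae_of_all _ h0) hg.measurable.aemeasurable,
    lintegral_eq_lintegral_meas_lt m (ae_of_all _ h0) hg.measurable.aemeasurable]
  have hmeas : Measurable fun t => m {a | t < g a} := by
    refine Antitone.measurable fun s t hst => measure_mono fun a (ha : t < g a) => lt_of_le_of_lt hst ha
  rw [← lintegral_const_mul _ hmeas]
  refine lintegral_mono fun t => lower_cmp h ?_
  intro a b hba ha
  exact lt_of_lt_of_le ha (hg hba)

namespace Dom
variable {N : ℕ} {D : Dom N}

section
variable {x0 : ES N} {K : ES N → ES N → ℝ}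

lemma Kers.near (hK : D.Kers x0 K) {κ : ℝ} (hκ : 1 ≤ κ) : ∃ C : ℝ, 1 ≤ C ∧ ∀ y ∈ frontier D.Ω, ∀ τ, 0 < τ → τ < D.r0 → 3 * τ ≤ D.d x0 →
    ∀ l m : Measure (ES N), IsFiniteMeasure l → IsFiniteMeasure m → l (frontier D.Ω)ᶜ = 0 → m (frontier D.Ω)ᶜ = 0 → ∀ η : ℝ≥0∞, η ≠ ⊤ →
    (∀ t, 0 < t → t ≤ τ → l (closedBall y t) ≤ η * m (closedBall y t)) → ∀ x ∈ D.Ω, dist x y ≤ κ * D.d x →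
    ∫⁻ z in closedBall y τ ∩ frontier D.Ω, ‖K z x‖ₑ ∂l ≤ η * (ENNReal.ofReal C * ∫⁻ z in closedBall y τ ∩ frontier D.Ω, ‖K z x‖ₑ ∂m) := by
  obtain ⟨C, hC, hst⟩ := star D hκ
  refine ⟨max C 1, le_max_right _ _, ?_⟩
  intro y hy τ hτ hτr hτx l m hl hm hl0 hm0 η hη hball x hx hxκ
  set F := frontier D.Ω with hF
  set W := closedBall y τ ∩ F with hW
  have hWm : MeasurableSet W := measurableSet_closedBall.inter isClosed_frontier.measurableSet
  have hdx0 := D.d_le_dist hy x0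
  -- kernel comparison
  have hcmp : ∀ z ∈ W, ∀ z' ∈ F, dist z' y ≤ dist z y → K z x ≤ max C 1 * K z' x := by
    intro z hz z' hz' hd
    have hp := (hK.ml z' hz').pos x hx
    rcases (dist_nonneg (x := z) (y := y)).eq_or_lt with h0 | h0
    · have e1 : z = y := dist_eq_zero.1 h0.symm
      have e2 : z' = y := dist_le_zero.1 (hd.trans h0.symm.le)
      rw [e1, ← e2]
      nlinarith [le_max_right C 1]
    · have hzτ : dist z y ≤ τ := hz.1
      have := hst y hy z z' _ _ (hK.ml z hz.2).mk' (hK.ml z' hz').mk' hd h0 (hzτ.trans_lt hτr) x0 hK.mem (by linarith) x hx hxκ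
      simp only [indicator_of_mem hx, indicator_of_mem hK.mem, hK.one z hz.2, hK.one z' hz', one_mul, mul_one] at this
      nlinarith [le_max_left C 1]
  set g : ℝ → ℝ := fun t => sInf ((fun z' => K z' x) '' {z' | z' ∈ F ∧ dist z' y ≤ max t 0}) with hg
  have hbdd : ∀ t, BddBelow ((fun z' => K z' x) '' {z' | z' ∈ F ∧ dist z' y ≤ max t 0}) := fun t =>
    ⟨0, by rintro _ ⟨z', hz', rfl⟩; exact ((hK.ml z' hz'.1).pos x hx).le⟩
  have hne : ∀ t, ((fun z' => K z' x) '' {z' | z' ∈ F ∧ dist z' y ≤ max t 0}).Nonempty := fun t =>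
    ⟨_, y, ⟨hy, by simp⟩, rfl⟩
  have hg0 : ∀ t, 0 ≤ g t := fun t => le_csInf (hne t) (by rintro _ ⟨z', hz', rfl⟩; exact ((hK.ml z' hz'.1).pos x hx).le)
  have hganti : Antitone g := fun s t hst' => csInf_le_csInf (hbdd t) (hne s)
    (image_mono fun z' hz' => ⟨hz'.1, hz'.2.trans (max_le_max hst' le_rfl)⟩)
  have hg1 : ∀ z ∈ W, g (dist z y) ≤ K z x := fun z hz => csInf_le (hbdd _) ⟨z, ⟨hz.2, le_max_left _ _⟩, rfl⟩
  have hC1 : 0 < max C 1 := lt_max_of_lt_left hC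
  have hg2 : ∀ z ∈ W, K z x ≤ max C 1 * g (dist z y) := by
    intro z hz
    have : K z x / max C 1 ≤ g (dist z y) := le_csInf (hne _) (by
      rintro _ ⟨z', hz', rfl⟩
      rw [div_le_iff₀' hC1]
      exact hcmp z hz z' hz'.1 (hz'.2.trans (max_eq_left dist_nonneg).le))
    rwa [div_le_iff₀' hC1] at this
  have hdm : Measurable fun z : ES N => dist z y := (continuous_id.dist continuous_const).measurable
  have hgm : Measurable fun t => ENNReal.ofReal (g t) := ENNReal.measurable_ofReal.comp hganti.measurable
  have hball0 : ∀ t, 0 ≤ t → t ≤ τ → l (closedBall y t) ≤ η * m (closedBall y t) := by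
    intro t ht htτ
    rcases ht.eq_or_lt with rfl | ht
    · have ei : ∀ ρ : Measure (ES N), IsFiniteMeasure ρ → Tendsto (fun t => ρ (closedBall y t)) (𝓝[>] 0) (𝓝 (ρ (closedBall y 0))) := by
        intro ρ hρ
        have h1 : closedBall y 0 = ⋂ r > (0:ℝ), closedBall y r := by
          ext z; simp only [mem_closedBall, mem_iInter]
          exact ⟨fun h r hr => h.trans hr.le, fun h => le_of_forall_gt_imp_ge_of_dense h⟩
        rw [h1]
        exact tendsto_measure_biInter_gt (fun r _ => measurableSet_closedBall.nullMeasurableSet)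
          (fun i j _ hij => closedBall_subset_closedBall hij) ⟨1, one_pos, measure_ne_top _ _⟩
      refine le_of_tendsto_of_tendsto (ei l hl) (ENNReal.Tendsto.const_mul (ei m hm) (Or.inr hη)) ?_
      filter_upwards [Ioc_mem_nhdsGT hτ] with t ht using hball t ht.1 ht.2
    · exact hball t ht htτ
  have hpush : ∀ ρ : Measure (ES N), ρ Fᶜ = 0 → ∀ t, 0 ≤ t → (ρ.restrict W).map (fun z => dist z y) (Iic t) = ρ (closedBall y (min t τ)) := by
    intro ρ hρ t ht
    rw [Measure.map_apply hdm measurableSet_Iic, Measure.restrict_apply (hdm measurableSet_Iic)]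
    have : (fun z => dist z y) ⁻¹' Iic t ∩ W = closedBall y (min t τ) ∩ F := by
      ext z; simp only [mem_inter_iff, mem_preimage, mem_Iic, hW, mem_closedBall, le_min_iff]; tauto
    rw [this]
    exact measure_inter_conull hρ
  have hIic : ∀ t, (l.restrict W).map (fun z => dist z y) (Iic t) ≤ η * (m.restrict W).map (fun z => dist z y) (Iic t) := by
    intro t
    rcases lt_or_ge t 0 with ht | ht
    · rw [Measure.map_apply hdm measurableSet_Iic]
      have : (fun z => dist z y) ⁻¹' Iic t = ∅ := by
        ext z; simp only [mem_preimage, mem_Iic, mem_empty_iff_false, iff_false, not_le]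
        exact ht.trans_le dist_nonneg
      rw [this]; simp
    · rw [hpush l hl0 t ht, hpush m hm0 t ht]
      exact hball0 _ (le_min ht hτ.le) (min_le_right _ _)
  calc ∫⁻ z in W, ‖K z x‖ₑ ∂l ≤ ∫⁻ z in W, ENNReal.ofReal (max C 1) * ENNReal.ofReal (g (dist z y)) ∂l := by
        refine setLIntegral_mono' hWm fun z hz => ?_
        rw [Real.enorm_of_nonneg ((hK.ml z hz.2).pos x hx).le, ← ENNReal.ofReal_mul hC1.le]
        exact ENNReal.ofReal_le_ofReal (hg2 z hz)
    _ = ENNReal.ofReal (max C 1) * ∫⁻ t, ENNReal.ofReal (g t) ∂((l.restrict W).map (fun z => dist z y)) := by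
        rw [lintegral_map hgm hdm]
        exact lintegral_const_mul _ (hgm.comp hdm)
    _ ≤ ENNReal.ofReal (max C 1) * (η * ∫⁻ t, ENNReal.ofReal (g t) ∂((m.restrict W).map (fun z => dist z y))) := by
        gcongr; exact antitone_cmp hIic hganti hg0
    _ = η * (ENNReal.ofReal (max C 1) * ∫⁻ z in W, ENNReal.ofReal (g (dist z y)) ∂m) := by
        rw [lintegral_map hgm hdm]; ring
    _ ≤ _ := by
        refine mul_le_mul_right (mul_le_mul_right ?_ _) _
        refine setLIntegral_mono' hWm fun z hz => ?_
        rw [Real.enorm_of_nonneg ((hK.ml z hz.2).pos x hx).le]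
        exact ENNReal.ofReal_le_ofReal (hg1 z hz)

end
end Dom
end

section
def lamy {N : ℕ} (ν μ : Measure (ES N)) (y : ES N) : Measure (ES N) :=
  ν.singularPart μ + μ.withDensity (fun z => ‖(ν.rnDeriv μ z).toReal - (ν.rnDeriv μ y).toReal‖ₑ)

section
variable {N : ℕ} {μ ν : Measure (ES N)} [IsFiniteMeasure μ] [IsFiniteMeasure ν]

lemma lamy_finite (y : ES N) : IsFiniteMeasure (lamy ν μ y) := by
  have : IsFiniteMeasure (μ.withDensity (fun z => ‖(ν.rnDeriv μ z).toReal - (ν.rnDeriv μ y).toReal‖ₑ)) :=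
    isFiniteMeasure_withDensity ((Measure.integrable_toReal_rnDeriv.sub (integrable_const _)).2.ne)
  unfold lamy
  infer_instance

lemma lamy_null {S : Set (ES N)} (h1 : μ S = 0) (h2 : ν S = 0) (y : ES N) : lamy ν μ y S = 0 := by
  unfold lamy
  rw [Measure.add_apply, (withDensity_absolutelyContinuous μ _) h1, add_zero]
  exact le_antisymm ((Measure.singularPart_le ν μ S).trans h2.le) bot_le

lemma lamy_diff : ∀ᵐ y ∂μ, ∀ η : ℝ≥0∞, η ≠ 0 → η ≠ ⊤ → ∃ τ > (0:ℝ), ∀ t, 0 < t → t ≤ τ →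
    lamy ν μ y (closedBall y t) ≤ η * μ (closedBall y t) := by
  filter_upwards [(Besicovitch.vitaliFamily μ).ae_eventually_measure_zero_of_singular (Measure.mutuallySingular_singularPart ν μ),
    (Besicovitch.vitaliFamily μ).ae_tendsto_lintegral_enorm_sub_div_of_integrable (f := fun z => (ν.rnDeriv μ z).toReal) (Measure.integrable_toReal_rnDeriv)]
    with y h1 h2 η hη hη'
  have h3 := (h1.add h2).comp (Besicovitch.tendsto_filterAt μ y)
  rw [add_zero] at h3
  have h4 := h3.eventually_le_const (pos_iff_ne_zero.2 hη)
  obtain ⟨τ, hτ, h5⟩ := (mem_nhdsGT_iff_exists_Ioc_subset).1 h4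
  refine ⟨τ, hτ, fun t ht htτ => ?_⟩
  have h6 := h5 ⟨ht, htτ⟩
  simp only [mem_setOf_eq, Function.comp] at h6
  rw [← ENNReal.add_div, ENNReal.div_le_iff_le_mul (Or.inr hη') (Or.inr hη)] at h6
  unfold lamy
  rwa [Measure.add_apply, withDensity_apply _ measurableSet_closedBall]

lemma lamy_repr (y : ES N) {F : Set (ES N)} (hF : MeasurableSet F) {k : ES N → ℝ} (hkμ : IntegrableOn k F μ) (hkν : IntegrableOn k F ν) :
    ‖∫ z in F, k z ∂ν - (ν.rnDeriv μ y).toReal * ∫ z in F, k z ∂μ‖ₑ ≤ ∫⁻ z in F, ‖k z‖ₑ ∂(lamy ν μ y) := by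
  have hinst : ν.HaveLebesgueDecomposition μ := Measure.haveLebesgueDecomposition_of_sigmaFinite ν μ
  have hdec := Measure.haveLebesgueDecomposition_add ν μ
  have hfin : ∀ᵐ z ∂(μ.restrict F), ν.rnDeriv μ z < ⊤ := ae_restrict_of_ae (Measure.rnDeriv_lt_top ν μ)
  have hk1 : IntegrableOn k F (ν.singularPart μ) := hkν.mono_measure (Measure.singularPart_le ν μ)
  have hk2 : IntegrableOn k F (μ.withDensity (ν.rnDeriv μ)) := hkν.mono_measure (Measure.withDensity_rnDeriv_le ν μ)
  have e1 : ∫ z in F, k z ∂ν = ∫ z in F, k z ∂(ν.singularPart μ) + ∫ z in F, (ν.rnDeriv μ z).toReal * k z ∂μ := by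
    have a := setIntegral_withDensity_eq_setIntegral_toReal_smul (Measure.measurable_rnDeriv ν μ) hfin k hF
    simp only [smul_eq_mul] at a
    conv_lhs => rw [hdec]
    rw [Measure.restrict_add, integral_add_measure hk1 hk2, a]
  have hk3 : IntegrableOn (fun z => (ν.rnDeriv μ z).toReal * k z) F μ := by
    have := hk2
    unfold IntegrableOn at this
    rw [restrict_withDensity hF, integrable_withDensity_iff_integrable_smul' (Measure.measurable_rnDeriv ν μ) hfin] at this
    exact this
  have e2 : ∫ z in F, k z ∂ν - (ν.rnDeriv μ y).toReal * ∫ z in F, k z ∂μ = ∫ z in F, k z ∂(ν.singularPart μ) +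
      ∫ z in F, ((ν.rnDeriv μ z).toReal - (ν.rnDeriv μ y).toReal) * k z ∂μ := by
    have : ∫ z in F, ((ν.rnDeriv μ z).toReal - (ν.rnDeriv μ y).toReal) * k z ∂μ =
        ∫ z in F, (ν.rnDeriv μ z).toReal * k z ∂μ - ∫ z in F, (ν.rnDeriv μ y).toReal * k z ∂μ := by
      rw [← integral_sub hk3 (hkμ.const_mul _)]
      simp only [sub_mul]
    rw [this, integral_const_mul, e1]; ring
  have hgm : Measurable fun z => ‖(ν.rnDeriv μ z).toReal - (ν.rnDeriv μ y).toReal‖ₑ :=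
    ((Measure.measurable_rnDeriv ν μ).ennreal_toReal.sub measurable_const).enorm
  rw [e2]
  refine (enorm_add_le _ _).trans ?_
  unfold lamy
  rw [Measure.restrict_add, lintegral_add_measure]
  refine add_le_add (enorm_integral_le_lintegral_enorm _) ((enorm_integral_le_lintegral_enorm _).trans ?_)
  rw [setLIntegral_withDensity_eq_setLIntegral_mul_non_measurable _ hgm _ hF (ae_of_all _ fun z => enorm_lt_top)]
  refine le_of_eq (lintegral_congr fun z => ?_)
  simp [enorm_mul]

end

namespace Dom
section
variable {N : ℕ} {D : Dom N} {x0 : ES N} {K : ES N → ES N → ℝ} {μ ν : Measure (ES N)} [IsFiniteMeasure μ] [IsFiniteMeasure ν]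

lemma Kers.lint (hK : D.Kers x0 K) {x : ES N} (hx : x ∈ D.Ω) :
    ∫⁻ z in frontier D.Ω, ‖K z x‖ₑ ∂μ = ENNReal.ofReal (uO K μ (frontier D.Ω) x) := by
  have hfm : MeasurableSet (frontier D.Ω) := isClosed_frontier.measurableSet
  unfold uO
  rw [ofReal_integral_eq_lintegral_ofReal (hK.int hx le_rfl)]
  · exact setLIntegral_congr_fun hfm fun z hz => Real.enorm_of_nonneg ((hK.ml z hz).pos x hx).le
  · filter_upwards [ae_restrict_mem hfm] with z hz using ((hK.ml z hz).pos x hx).le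

lemma part1 (hK : D.Kers x0 K) (hμ : μ (frontier D.Ω)ᶜ = 0) (hν : ν (frontier D.Ω)ᶜ = 0) :
    ∀ᵐ y ∂μ, y ∈ frontier D.Ω → ∀ κ : ℝ, ∀ ε > 0, ∃ ρ > 0, ∀ x ∈ D.Ω, dist x y < ρ → dist x y ≤ κ * D.d x →
      |uO K ν (frontier D.Ω) x - (ν.rnDeriv μ y).toReal * uO K μ (frontier D.Ω) x| ≤ ε * uO K μ (frontier D.Ω) x := by
  have hfm : MeasurableSet (frontier D.Ω) := isClosed_frontier.measurableSet
  have hfar : ∀ᵐ y ∂μ, ∀ n : ℕ, y ∈ frontier D.Ω → ∀ κ : ℝ, ∀ ε > 0, ∃ ρ > 0, ∀ x ∈ D.Ω, dist x y < ρ → dist x y ≤ κ * D.d x →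
      ∀ z ∈ frontier D.Ω, 1 / (n + 1 : ℝ) ≤ dist z y → K z x ≤ ε * uO K μ (frontier D.Ω) x :=
    ae_all_iff.2 fun n => far hK (by positivity)
  filter_upwards [hfar, lamy_diff (μ := μ) (ν := ν)] with y hy1 hy2 hyF κ ε hε
  obtain ⟨C, hC, hnear⟩ := hK.near (le_max_right κ 1)
  obtain ⟨τ0, hτ0, hd⟩ := hy2 (ENNReal.ofReal (ε / (2 * C))) (by simp; positivity) ENNReal.ofReal_ne_top
  have hr := D.r0_pos
  have hdx := D.d_pos hK.mem
  obtain ⟨τ, hτ, hτ1, hτ2, hτ3⟩ : ∃ τ > 0, τ ≤ τ0 ∧ τ < D.r0 ∧ 3 * τ ≤ D.d x0 :=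
    ⟨min τ0 (min (D.r0 / 2) (D.d x0 / 3)), by positivity, min_le_left _ _, by
      have : min τ0 (min (D.r0 / 2) (D.d x0 / 3)) ≤ D.r0 / 2 := (min_le_right _ _).trans (min_le_left _ _)
      linarith, by
      have : min τ0 (min (D.r0 / 2) (D.d x0 / 3)) ≤ D.d x0 / 3 := (min_le_right _ _).trans (min_le_right _ _)
      linarith⟩
  obtain ⟨n, hn⟩ := exists_nat_one_div_lt hτ
  have hlf := lamy_finite (μ := μ) (ν := ν) y
  set L := (lamy ν μ y univ).toReal with hL
  have hL0 : 0 ≤ L := ENNReal.toReal_nonneg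
  obtain ⟨ρ, hρ, hfx⟩ := hy1 n hyF κ (ε / (2 * (L + 1))) (by positivity)
  refine ⟨ρ, hρ, fun x hx hxρ hxκ => ?_⟩
  have hu0 := hK.uO_nn (μ := μ) hx hfm le_rfl
  set U := uO K μ (frontier D.Ω) x with hU
  have hdx := D.d_pos hx
  have n1 := hnear y hyF τ hτ hτ2 hτ3 (lamy ν μ y) μ hlf inferInstance (lamy_null hμ hν y) hμ _ ENNReal.ofReal_ne_top
    (fun t ht htτ => hd t ht (htτ.trans hτ1)) x hx (hxκ.trans (mul_le_mul_of_nonneg_right (le_max_left _ _) hdx.le))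
  have n2 : ∫⁻ z in closedBall y τ ∩ frontier D.Ω, ‖K z x‖ₑ ∂μ ≤ ENNReal.ofReal U := by
    rw [hU, ← hK.lint hx]
    exact lintegral_mono_set inter_subset_right
  have n3 : ∫⁻ z in closedBall y τ ∩ frontier D.Ω, ‖K z x‖ₑ ∂(lamy ν μ y) ≤ ENNReal.ofReal (ε / 2 * U) := by
    refine n1.trans ?_
    have : ε / 2 * U = ε / (2 * C) * (C * U) := by field_simp
    rw [this, ENNReal.ofReal_mul (by positivity), ENNReal.ofReal_mul (by positivity)]
    gcongr
  have n4 : ∫⁻ z in frontier D.Ω \ closedBall y τ, ‖K z x‖ₑ ∂(lamy ν μ y) ≤ ENNReal.ofReal (ε / 2 * U) := by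
    calc _ ≤ ∫⁻ z in frontier D.Ω \ closedBall y τ, ENNReal.ofReal (ε / (2 * (L + 1)) * U) ∂(lamy ν μ y) := by
          refine setLIntegral_mono' (hfm.diff measurableSet_closedBall) fun z hz => ?_
          rw [Real.enorm_of_nonneg ((hK.ml z hz.1).pos x hx).le]
          refine ENNReal.ofReal_le_ofReal (hfx x hx hxρ hxκ z hz.1 ?_)
          have := hz.2
          rw [mem_closedBall, not_le] at this
          linarith
      _ ≤ ENNReal.ofReal (ε / (2 * (L + 1)) * U) * lamy ν μ y univ := by
          rw [setLIntegral_const]; gcongr; exact subset_univ _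
      _ = ENNReal.ofReal (ε / (2 * (L + 1)) * U * L) := by
          rw [ENNReal.ofReal_mul (by positivity) (q := L), hL, ENNReal.ofReal_toReal (measure_ne_top _ _)]
      _ ≤ _ := by
          refine ENNReal.ofReal_le_ofReal ?_
          rw [div_mul_eq_mul_div, div_mul_eq_mul_div, div_mul_eq_mul_div, div_le_div_iff₀ (by positivity) (by norm_num)]
          have : 0 ≤ ε * U := by positivity
          nlinarith
  have n5 : ∫⁻ z in frontier D.Ω, ‖K z x‖ₑ ∂(lamy ν μ y) ≤ ENNReal.ofReal (ε * U) := by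
    have e : ENNReal.ofReal (ε * U) = ENNReal.ofReal (ε / 2 * U) + ENNReal.ofReal (ε / 2 * U) := by
      rw [← ENNReal.ofReal_add (by positivity) (by positivity)]; congr 1; ring
    rw [e, ← lintegral_inter_add_diff _ (frontier D.Ω) (measurableSet_closedBall (x := y) (ε := τ)), inter_comm]
    exact add_le_add n3 n4
  have n6 := (lamy_repr (μ := μ) (ν := ν) y hfm (hK.int hx le_rfl) (hK.int hx le_rfl)).trans n5
  rw [Real.enorm_eq_ofReal_abs] at n6
  exact (ENNReal.ofReal_le_ofReal_iff (by positivity)).1 n6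

end
end Dom
end

section
namespace Dom
section
variable {N : ℕ} {D : Dom N} {x0 : ES N} {K : ES N → ES N → ℝ} {μ ν : Measure (ES N)} [IsFiniteMeasure μ] [IsFiniteMeasure ν]

lemma cont_of_HP {s : ES N → ℝ} (hsnn : ∀ x ∈ D.Ω, 0 ≤ s x)
    (hHP : ∀ ε > (0:ℝ), ∃ δ > (0:ℝ), ∀ x ∈ D.Ω, ∀ y ∈ D.Ω, dist x y ≤ δ * D.d x → s x ≤ (1 + ε) * s y) : ContinuousOn s D.Ω := by
  intro x hx
  rw [Metric.continuousWithinAt_iff]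
  intro ε hε
  have hsx := hsnn x hx
  set e := min 1 (ε / (4 * (s x + 1))) with he
  have he0 : 0 < e := by positivity
  have he1 : e ≤ 1 := min_le_left _ _
  have he2 : e * (4 * (s x + 1)) ≤ ε := by
    rw [← le_div_iff₀ (by positivity)]; exact min_le_right _ _
  obtain ⟨δ, hδ, h⟩ := hHP e he0
  have hdx := D.d_pos hx
  refine ⟨min (D.d x / 2) (δ * D.d x / 2), by positivity, fun {y} hy hyx => ?_⟩
  have a1 := hyx.trans_le (min_le_left _ _)
  have a2 := hyx.trans_le (min_le_right _ _)
  have a3 := D.d_lip x y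
  rw [dist_comm] at a3
  have b1 := h x hx y hy (by rw [dist_comm]; nlinarith [mul_pos hδ hdx])
  have b2 := h y hy x hx (by nlinarith)
  have hsy := hsnn y hy
  rw [Real.dist_eq, abs_lt]
  constructor
  · nlinarith [mul_nonneg he0.le hsx]
  · nlinarith [mul_nonneg he0.le hsx]

lemma super_sp {s h : ES N → ℝ} (hs : LVSuperharmonic D.Ω D.V s) (hc : ContinuousOn s D.Ω) (hh : LVHarmonic D.Ω D.V h)
    (hle : ∀ x ∈ D.Ω, 0 ≤ h x ∧ h x ≤ s x) : D.Sp (fun x => D.Ω.indicator s x - D.Ω.indicator h x) := by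
  have hp := Hp.of_harm hh fun x hx => (hle x hx).1
  have hsm := meas_ind hc
  have hci : ContinuousOn (D.Ω.indicator s) D.Ω := hc.congr fun x hx => indicator_of_mem hx s
  have hsl : D.Lc (D.Ω.indicator s) := Lc.of_contOn hsm hci
  have hw : D.Weak (D.Ω.indicator s) 0 := by
    intro φ h1 h2
    have := Weak.of_super hs φ h1 h2
    have e1 : ∫ x in D.Ω, D.Ω.indicator s x * lap φ x = ∫ x in D.Ω, s x * lap φ x :=
      setIntegral_congr_fun D.isOpen.measurableSet fun x hx => by simp only [indicator_of_mem hx]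
    have e2 : ∫ x in D.Ω, (D.V x * D.Ω.indicator s x - 0) * φ x = ∫ x in D.Ω, (D.V x * s x - 0) * φ x :=
      setIntegral_congr_fun D.isOpen.measurableSet fun x hx => by simp only [indicator_of_mem hx]
    rw [e1, e2]
    exact this
  refine ⟨hsl.sub hp.lc, fun x hx => ?_, fun x hx => ?_⟩
  · simp only [indicator_of_mem hx]; linarith [(hle x hx).2]
  · rw [P_sub hsl hp.lc hx, hp.har x hx]
    have := P_weak hsm hci hw hx
    linarith

lemma part2 (hK : D.Kers x0 K) {s h : ES N → ℝ} (hs : LVSuperharmonic D.Ω D.V s) (hsnn : ∀ x ∈ D.Ω, 0 ≤ s x)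
    (hHP : ∀ ε > (0:ℝ), ∃ δ > (0:ℝ), ∀ x ∈ D.Ω, ∀ y ∈ D.Ω, dist x y ≤ δ * D.d x → s x ≤ (1 + ε) * s y)
    (hgm : IsGreatestLVHarmMinorant D.Ω D.V s h) :
    ∀ᵐ y ∂μ, y ∈ frontier D.Ω → ∀ κ : ℝ, ∀ M : ℕ, ∀ ε > 0, ∃ ρ > 0, ∀ x ∈ D.Ω, dist x y < ρ → dist x y ≤ κ * D.d x →
      h x ≤ M * uO K μ (frontier D.Ω) x → s x - h x ≤ ε * uO K μ (frontier D.Ω) x := by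
  have hfm : MeasurableSet (frontier D.Ω) := isClosed_frontier.measurableSet
  have hc := cont_of_HP hsnn hHP
  have hsp := super_sp hs hc hgm.1 hgm.2.1
  have hh := Hp.of_harm hgm.1 fun x hx => (hgm.2.1 x hx).1
  have hu : D.Hp (D.Ω.indicator (uO K μ (frontier D.Ω))) := hK.uO_hp hfm le_rfl
  have := ntzero hK (μ := μ) (h := h) hsp ?_ ?_
  · filter_upwards [this] with y hy hyf κ M ε hε
    obtain ⟨ρ, hρ, H⟩ := hy hyf κ M ε hε
    refine ⟨ρ, hρ, fun x hx a b c => ?_⟩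
    have := H x hx a b c
    simpa only [indicator_of_mem hx] using this
  · intro O hOm hO c hc0 hle
    have hO' := hK.uO_harm (μ := μ) hOm hO
    have h1 := hgm.2.2 _ (harm_lin hgm.1 hO' 1 c) (fun x hx => by
      have a1 := hle x hx
      simp only [indicator_of_mem hx] at a1
      have a2 := hK.uO_nn (μ := μ) hx hOm hO
      have a3 := (hgm.2.1 x hx).1
      exact ⟨by positivity, by linarith⟩) x0 hK.mem
    refine hK.null_of_le hOm hO ?_
    by_contra hcon
    push Not at hcon
    nlinarith [mul_pos hc0 hcon]
  · intro ε hε M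
    set e := min 1 (ε / (6 * (M + 1))) with he
    have he0 : 0 < e := by positivity
    have he1 : e ≤ 1 := min_le_left _ _
    have he2 : e * (6 * (M + 1)) ≤ ε := by
      rw [← le_div_iff₀ (by positivity)]; exact min_le_right _ _
    obtain ⟨δ, hδ, hd⟩ := hHP e he0
    have g1 := D.sg_pos e
    have g2 := D.sg_pos 1
    refine ⟨min δ (min (min (1/2) (D.sg e / 2)) (min (1/2) (D.sg 1 / 2))), by positivity, ε / 8, by positivity, ?_⟩
    intro x hx hM hεu p hp hpΩ
    have hdx := D.d_pos hx
    rw [mem_ball] at hp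
    have p1 : dist p x < δ * D.d x := hp.trans_le (mul_le_mul_of_nonneg_right (min_le_left _ _) hdx.le)
    have p2 : dist p x < min (1/2) (D.sg e / 2) * D.d x :=
      hp.trans_le (mul_le_mul_of_nonneg_right ((min_le_right _ _).trans (min_le_left _ _)) hdx.le)
    have p3 : dist p x < min (1/2) (D.sg 1 / 2) * D.d x :=
      hp.trans_le (mul_le_mul_of_nonneg_right ((min_le_right _ _).trans (min_le_right _ _)) hdx.le)
    have q1 := hd x hx p hpΩ (by rw [dist_comm]; exact p1.le)
    have q2 := (hh.two he0 hx p2).2.2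
    have q3 := (hu.two one_pos hx p3).2.2
    simp only [indicator_of_mem hx, indicator_of_mem hpΩ] at q2 q3 hεu ⊢
    have hu0 := hK.uO_nn (μ := μ) hx hfm le_rfl
    set U := uO K μ (frontier D.Ω) x
    set Up := uO K μ (frontier D.Ω) p
    have hhx := (hgm.2.1 x hx).1
    have hq0 : 0 ≤ s p - h p := by linarith [(hgm.2.1 p hpΩ).2]
    have r1 : (1 + e) * h p ≤ (1 + e) * ((1 + e) * h x) := mul_le_mul_of_nonneg_left q2 (by linarith)
    have r2 : (1 + e) * ((1 + e) * h x) ≤ h x + 3 * (e * h x) := by nlinarith [mul_nonneg he0.le hhx, mul_nonneg (mul_nonneg he0.le hhx) (sub_nonneg.2 he1)]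
    have r3 : e * h x ≤ e * (M * U) := mul_le_mul_of_nonneg_left hM he0.le
    have r4 : 6 * (e * (M * U)) ≤ ε * U := by
      have := mul_le_mul_of_nonneg_right he2 hu0
      nlinarith [mul_nonneg he0.le hu0]
    have r5 : ε / 2 * U ≤ (1 + e) * (s p - h p) := by nlinarith
    have r6 : (1 + e) * (s p - h p) ≤ 2 * (s p - h p) := by nlinarith
    nlinarith

theorem final (hK : D.Kers x0 K) {u s h : ES N → ℝ} (hupos : ∀ x ∈ D.Ω, 0 < u x) (hμ : μ (frontier D.Ω)ᶜ = 0)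
    (hrep : ∀ x ∈ D.Ω, u x = ∫ y, K y x ∂μ) (hs : LVSuperharmonic D.Ω D.V s) (hsnn : ∀ x ∈ D.Ω, 0 ≤ s x)
    (hHP : ∀ ε > (0:ℝ), ∃ δ > (0:ℝ), ∀ x ∈ D.Ω, ∀ y ∈ D.Ω, dist x y ≤ δ * D.d x → s x ≤ (1 + ε) * s y)
    (hgm : IsGreatestLVHarmMinorant D.Ω D.V s h) (hν : ν (frontier D.Ω)ᶜ = 0) (hhrep : ∀ x ∈ D.Ω, h x = ∫ y, K y x ∂ν) :
    ∀ᵐ y ∂μ, TendstoNT D.Ω (fun x => s x / u x) y (𝓝 ((ν.rnDeriv μ y).toReal)) := by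
  have hmem : ∀ᵐ y ∂μ, y ∈ frontier D.Ω := hμ
  have hmem' : ∀ᵐ y ∂ν, y ∈ frontier D.Ω := hν
  have hu : ∀ x ∈ D.Ω, uO K μ (frontier D.Ω) x = u x := fun x hx => by
    rw [hrep x hx, uO, Measure.restrict_eq_self_of_ae_mem hmem]
  have hh : ∀ x ∈ D.Ω, uO K ν (frontier D.Ω) x = h x := fun x hx => by
    rw [hhrep x hx, uO, Measure.restrict_eq_self_of_ae_mem hmem']
  filter_upwards [hmem, part1 hK hμ hν, part2 (μ := μ) hK hs hsnn hHP hgm] with y hy h1 h2 κ hκ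
  set f := (ν.rnDeriv μ y).toReal with hf
  rw [Metric.tendsto_nhdsWithin_nhds]
  intro ε hε
  obtain ⟨M, hM⟩ := exists_nat_ge (f + 1)
  obtain ⟨ρ1, hρ1, e1⟩ := h1 hy κ 1 one_pos
  obtain ⟨ρ2, hρ2, e2⟩ := h1 hy κ (ε / 3) (by positivity)
  obtain ⟨ρ3, hρ3, e3⟩ := h2 hy κ M (ε / 3) (by positivity)
  refine ⟨min ρ1 (min ρ2 ρ3), by positivity, fun {x} hxr hxy => ?_⟩
  obtain ⟨hx, hxκ⟩ := hxr
  have c1 := e1 x hx (hxy.trans_le (min_le_left _ _)) hxκ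
  have c2 := e2 x hx (hxy.trans_le ((min_le_right _ _).trans (min_le_left _ _))) hxκ
  have c3 := e3 x hx (hxy.trans_le ((min_le_right _ _).trans (min_le_right _ _))) hxκ
  rw [hu x hx, hh x hx] at c1 c2
  rw [hu x hx] at c3
  have hux := hupos x hx
  rw [abs_le] at c1 c2
  have c4 := c3 (by nlinarith)
  have c5 := (hgm.2.1 x hx).2
  rw [Real.dist_eq, abs_lt]
  constructor
  · rw [lt_sub_iff_add_lt, lt_div_iff₀ hux]; nlinarith [mul_pos hε hux]
  · rw [sub_lt_iff_lt_add, div_lt_iff₀ hux]; nlinarith [mul_pos hε hux]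

end
end Dom
end

/-- Proposition `propRFT`, relative Fatou theorem. If
`u = ∫ K_y^V dμ(y)` is a positive `L_V`-harmonic function and `s ≥ 0` is
`L_V`-superharmonic satisfying the strong Harnack property `(HP)_Ω`, then for
`μ`-a.e. `y ∈ ∂Ω` the ratio `s/u` has the nontangential limit `(dν/dμ)(y)` at `y`,
`ν` being the measure of the greatest `L_V`-harmonic minorant of `s`. -/
theorem statement6 {N : ℕ} (hN : 2 ≤ N) (Ω : Set (ES N))
    (hΩ : IsLipschitzDomain Ω) (hbd : Bornology.IsBounded Ω)
    (x₀ : ES N) (hx₀ : x₀ ∈ Ω) (a : ℝ) (ha : 0 < a)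
    (V : ES N → ℝ) (hV : VClass Ω a V)
    (KV : ES N → ES N → ℝ)
    (hKV : ∀ y ∈ frontier Ω, IsMartinKernel Ω V x₀ y (KV y))
    (u : ES N → ℝ) (hu : LVHarmonic Ω V u) (hupos : ∀ x ∈ Ω, 0 < u x)
    (μ : Measure (ES N)) [IsFiniteMeasure μ] (hμs : μ (frontier Ω)ᶜ = 0)
    (hrep : ∀ x ∈ Ω, u x = ∫ y, KV y x ∂μ)
    (s : ES N → ℝ) (hs : LVSuperharmonic Ω V s) (hsnn : ∀ x ∈ Ω, 0 ≤ s x)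
    (hHP : ∀ ε > (0:ℝ), ∃ δ > (0:ℝ), ∀ x ∈ Ω, ∀ y ∈ Ω,
      dist x y ≤ δ * dista Ω x → s x ≤ (1 + ε) * s y)
    (h : ES N → ℝ) (hgm : IsGreatestLVHarmMinorant Ω V s h)
    (ν : Measure (ES N)) [IsFiniteMeasure ν] (hνs : ν (frontier Ω)ᶜ = 0)
    (hhrep : ∀ x ∈ Ω, h x = ∫ y, KV y x ∂ν) :
    ∀ᵐ y ∂μ, TendstoNT Ω (fun x => s x / u x) y (𝓝 ((ν.rnDeriv μ y).toReal)) := by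
  have hK : Dom.Kers (⟨Ω, V, a, hN, hΩ, hbd, ha, hV⟩ : Dom N) x₀ KV :=
    ⟨hx₀, fun z hz => ⟨(hKV z hz).1, (hKV z hz).2.1, (hKV z hz).2.2.2⟩, fun z hz => (hKV z hz).2.2.1⟩
  exact Dom.final hK hupos hμs hrep hs hsnn hHP hgm hνs hhrep
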